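/- Crossing-cluster avoidance lemma: for any p > p_c(d) there exists a constant c_* ∈ (0,1) such that for all t ≥ 1/c_* and all 1 ≤ N ≤ exp(c_* log² n), P(E_N) ≤ c_*⁻¹ exp(−c_* N), where E_N is the event that there exist a crossing open cluster C of Λ_{2N} and a self-avoiding path π contained in Λ_N belonging to G_*(Λ_{tN}) with diam(π) ≥ N/2 and π ∩ C = ∅. -/

import Mathlib

open MeasureTheory
open scoped ENNReal NNReal

attribute [local instance] Classical.propDecidable

noncomputable section

namespace Perco

/-- Vertices of the lattice `ℤ^d`. -/
abbrev ZVec (d : ℕ) := Fin d → ℤ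

/-- The `ℓ¹` norm of a lattice point (as a natural number). -/
def norm1 (d : ℕ) (x : ZVec d) : ℕ := ∑ i, (x i).natAbs

/-- The `ℓ∞` norm of a lattice point (as a natural number). -/
def normInf (d : ℕ) (x : ZVec d) : ℕ := Finset.univ.sup fun i => (x i).natAbs

/-- Nearest-neighbour edges of `ℤ^d`, each written `(x_e, y_e)` with `‖x_e‖₁ < ‖y_e‖₁`. -/
def EdgeD (d : ℕ) := {e : ZVec d × ZVec d // norm1 d (e.1 - e.2) = 1 ∧ norm1 d e.1 < norm1 d e.2}

/-- A percolation configuration: each edge is open (`true`) or closed (`false`). -/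
abbrev Config (d : ℕ) := EdgeD d → Bool

/-- Adjacency in `ℤ^d`. -/
def Adj (d : ℕ) (x y : ZVec d) : Prop := norm1 d (x - y) = 1

/-- A (self-avoiding, nearest-neighbour) path, recorded as its list of vertices. -/
def IsPath (d : ℕ) (γ : List (ZVec d)) : Prop :=
  γ ≠ [] ∧ γ.Nodup ∧ γ.Chain' (Adj d)

/-- The (unordered) edge `{x,y}` is open in the configuration `ω`. -/
def EdgeOpen (d : ℕ) (ω : Config d) (x y : ZVec d) : Prop :=
  ∃ e : EdgeD d, (e.val = (x, y) ∨ e.val = (y, x)) ∧ ω e = true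

/-- All edges of the path are open. -/
def IsOpenPath (d : ℕ) (ω : Config d) (γ : List (ZVec d)) : Prop :=
  γ.Chain' (EdgeOpen d ω)

/-- The (unordered) edge `{x,y}` is an edge of the path `γ`. -/
def edgeMemPath (d : ℕ) (x y : ZVec d) (γ : List (ZVec d)) : Prop :=
  (x, y) ∈ γ.zip γ.tail ∨ (y, x) ∈ γ.zip γ.tail

/-- Truncated FPP weight of the edge `{x,y}`: `1` if open, `log² n` if closed. -/
def pairWeight (d n : ℕ) (ω : Config d) (x y : ZVec d) : ℝ :=
  if EdgeOpen d ω x y then 1 else (Real.log n) ^ 2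

/-- Total truncated weight of a path. -/
def pathCost (d n : ℕ) (ω : Config d) : List (ZVec d) → ℝ
  | [] => 0
  | [_] => 0
  | x :: y :: rest => pairWeight d n ω x y + pathCost d n ω (y :: rest)

/-- Truncated first-passage time between `x` and `y`. -/
def passageTime (d n : ℕ) (ω : Config d) (x y : ZVec d) : ℝ :=
  sInf {c : ℝ | ∃ γ : List (ZVec d), IsPath d γ ∧ γ.head? = some x ∧
    γ.getLast? = some y ∧ pathCost d n ω γ = c}

/-- Chemical distance between `x` and `y` using only open paths inside `U`. -/
def chemDistIn (d : ℕ) (ω : Config d) (U : Set (ZVec d)) (x y : ZVec d) : ℕ∞ :=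
  sInf {k : ℕ∞ | ∃ γ : List (ZVec d), IsPath d γ ∧ IsOpenPath d ω γ ∧ (∀ v ∈ γ, v ∈ U) ∧
    γ.head? = some x ∧ γ.getLast? = some y ∧ ((γ.length - 1 : ℕ) : ℕ∞) = k}

/-- Chemical distance in the whole lattice. -/
def chemDist (d : ℕ) (ω : Config d) (x y : ZVec d) : ℕ∞ := chemDistIn d ω Set.univ x y

/-- `x` belongs to an infinite open cluster. -/
def InInfCluster (d : ℕ) (ω : Config d) (x : ZVec d) : Prop :=
  {y | chemDist d ω x y ≠ ⊤}.Infinite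

/-- `x*`: a point of the infinite cluster at minimal `ℓ∞`-distance from `x`
(deterministic tie-breaking via choice); `x` itself if there is no infinite cluster. -/
def starPt (d : ℕ) (ω : Config d) (x : ZVec d) : ZVec d :=
  if h : ∃ y, InInfCluster d ω y ∧ ∀ z, InInfCluster d ω z →
      normInf d (y - x) ≤ normInf d (z - x)
  then h.choose else x

/-- `μ` is the Bernoulli(p) bond-percolation product measure on configurations. -/
def IsBernoulli (d : ℕ) (p : ℝ) (μ : Measure (Config d)) : Prop :=
  IsProbabilityMeasure μ ∧
  ∀ (s : Finset (EdgeD d)) (f : EdgeD d → Bool),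
    μ {ω | ∀ e ∈ s, ω e = f e} = ∏ e ∈ s, ENNReal.ofReal (if f e then p else 1 - p)

/-- The critical parameter of Bernoulli bond percolation on `ℤ^d`. -/
def pc (d : ℕ) : ℝ :=
  sSup {p : ℝ | 0 ≤ p ∧ p ≤ 1 ∧ ∀ μ : Measure (Config d), IsBernoulli d p μ →
    μ {ω | ∃ x, InInfCluster d ω x} = 0}

/-- The point `n·e₁`. -/
def ptE1 (d n : ℕ) : ZVec d := fun i => if (i : ℕ) = 0 then (n : ℤ) else 0

/-- `D*_n = D(0*, (n e₁)*)`, as a real number. -/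
def DstarR (d n : ℕ) (ω : Config d) : ℝ :=
  ((chemDist d ω (starPt d ω 0) (starPt d ω (ptE1 d n))).toNat : ℝ)

/-- `T_n = T(0, n e₁)`, the truncated passage time. -/
def TnR (d n : ℕ) (ω : Config d) : ℝ := passageTime d n ω 0 (ptE1 d n)

/-- The box `Λ_t(z)` with integer radius. -/
def boxZ (d : ℕ) (t : ℕ) (z : ZVec d) : Set (ZVec d) := {y | normInf d (y - z) ≤ t}

/-- The box `Λ_t(z)` with real radius. -/
def boxR (d : ℕ) (t : ℝ) (z : ZVec d) : Set (ZVec d) := {y | (normInf d (y - z) : ℝ) ≤ t}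

/-- The annulus `A_N(e) = Λ_{3N}(e) \ Λ_N(e)`. -/
def annulus (d : ℕ) (N : ℕ) (e : EdgeD d) : Set (ZVec d) :=
  {y | normInf d (y - e.val.1) ≤ 3 * N ∧ N < normInf d (y - e.val.1)}

/-- `π` is a geodesic of the truncated passage time between its endpoints, inside `A`. -/
def IsGeodesicIn (d n : ℕ) (ω : Config d) (A : Set (ZVec d)) (π : List (ZVec d)) : Prop :=
  IsPath d π ∧ (∀ v ∈ π, v ∈ A) ∧
  ∀ π' : List (ZVec d), IsPath d π' → (∀ v ∈ π', v ∈ A) →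
    π'.head? = π.head? → π'.getLast? = π.getLast? →
    pathCost d n ω π ≤ pathCost d n ω π'

/-- `γ ∈ 𝔾_*(A)`: a path in `A` obtained from some geodesic in `A` by replacing
segments by open paths (all edges of `γ` not on the geodesic are open). -/
def GstarIn (d n : ℕ) (ω : Config d) (A : Set (ZVec d)) (γ : List (ZVec d)) : Prop :=
  IsPath d γ ∧ (∀ v ∈ γ, v ∈ A) ∧
  ∃ π : List (ZVec d), IsGeodesicIn d n ω A π ∧
    ∀ x y, edgeMemPath d x y γ → ¬ edgeMemPath d x y π → EdgeOpen d ω x y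

/-- `γ` is a crossing path of the annulus `A_N(e)`. -/
def IsCrossing (d : ℕ) (N : ℕ) (e : EdgeD d) (γ : List (ZVec d)) : Prop :=
  IsPath d γ ∧ (∀ v ∈ γ, v ∈ annulus d N e) ∧
  (∃ v ∈ γ, normInf d (v - e.val.1) = N + 1) ∧ (∃ v ∈ γ, normInf d (v - e.val.1) = 3 * N)

/-- The event `𝒱¹_N(e)`: any two modified geodesics crossing `A_N(e)` are linked by an
open path inside `A_N(e)` of length at most `C_* N`. -/
def V1 (d : ℕ) (Cstar : ℝ) (n : ℕ) (e : EdgeD d) (N : ℕ) (ω : Config d) : Prop :=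
  ∀ γ1 γ2 : List (ZVec d),
    GstarIn d n ω (boxR d (Cstar * N) e.val.1) γ1 → IsCrossing d N e γ1 →
    GstarIn d n ω (boxR d (Cstar * N) e.val.1) γ2 → IsCrossing d N e γ2 →
    ∃ π : List (ZVec d), IsPath d π ∧ IsOpenPath d ω π ∧ (∀ v ∈ π, v ∈ annulus d N e) ∧
      (∃ u, π.head? = some u ∧ u ∈ γ1) ∧ (∃ v, π.getLast? = some v ∧ v ∈ γ2) ∧
      ((π.length : ℝ) - 1 ≤ Cstar * N)

/-- The event `𝒱²_N(e)`: points of `Λ_{3N}(e)` openly connected inside `Λ_{3N}(e)` are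
connected inside `Λ_{4N}(e)` by an open path of length at most `C_* N`. -/
def V2 (d : ℕ) (Cstar : ℝ) (e : EdgeD d) (N : ℕ) (ω : Config d) : Prop :=
  ∀ x y : ZVec d, x ∈ boxZ d (3 * N) e.val.1 → y ∈ boxZ d (3 * N) e.val.1 →
    (∃ γ, IsPath d γ ∧ IsOpenPath d ω γ ∧ (∀ v ∈ γ, v ∈ boxZ d (3 * N) e.val.1) ∧
      γ.head? = some x ∧ γ.getLast? = some y) →
    ∃ γ, IsPath d γ ∧ IsOpenPath d ω γ ∧ (∀ v ∈ γ, v ∈ boxZ d (4 * N) e.val.1) ∧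
      γ.head? = some x ∧ γ.getLast? = some y ∧ ((γ.length : ℝ) - 1 ≤ Cstar * N)

/-- The effective radius `R_e` as a natural number (`0` when undefined). -/
def ReffN (d : ℕ) (Cstar : ℝ) (n : ℕ) (e : EdgeD d) (ω : Config d) : ℕ :=
  sInf {N : ℕ | 1 ≤ N ∧ V1 d Cstar n e N ω ∧ V2 d Cstar e N ω}

/-- The effective radius `R_e`, valued in `ℝ≥0∞` (`∞` when undefined). -/
def ReffENN (d : ℕ) (Cstar : ℝ) (n : ℕ) (e : EdgeD d) (ω : Config d) : ℝ≥0∞ :=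
  sInf {r : ℝ≥0∞ | ∃ N : ℕ, r = N ∧ 1 ≤ N ∧ V1 d Cstar n e N ω ∧ V2 d Cstar e N ω}

/-- The truncated effective radius `R̂_e = min (C_* R_e) (log² n)`. -/
def RhatR (d : ℕ) (Cstar : ℝ) (n : ℕ) (e : EdgeD d) (ω : Config d) : ℝ :=
  (min (ENNReal.ofReal Cstar * ReffENN d Cstar n e ω)
    (ENNReal.ofReal ((Real.log n) ^ 2))).toReal

/-- `diam(γ) ≥ r`. -/
def DiamGE (d : ℕ) (γ : List (ZVec d)) (r : ℝ) : Prop :=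
  ∃ i : Fin d, ∃ x ∈ γ, ∃ y ∈ γ, r ≤ |((x i : ℤ) : ℝ) - ((y i : ℤ) : ℝ)|

/-- The boundary `∂Λ_t` (real radius `t`). -/
def bdryR (d : ℕ) (t : ℝ) : Set (ZVec d) :=
  {x | (normInf d x : ℝ) ≤ t ∧ t - 1 < (normInf d x : ℝ)}

/-- The slab `S(ℓ,t) = {x ∈ Λ_t : 0 ≤ x₁ ≤ ℓ}`. -/
def slab (d : ℕ) (l t : ℝ) : Set (ZVec d) :=
  {x | (normInf d x : ℝ) ≤ t ∧ ∀ i : Fin d, (i : ℕ) = 0 → 0 ≤ x i ∧ ((x i : ℤ) : ℝ) ≤ l}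

/-- The open cluster of the vertex `v`. -/
def openClusterOf (d : ℕ) (ω : Config d) (v : ZVec d) : Set (ZVec d) :=
  {y | chemDist d ω v y ≠ ⊤}

/-- The set `C` crosses the box `Λ_t(z)`: in each direction an open path of `C ∩ Λ_t(z)`
connects the two opposite faces. -/
def CrossesBox (d : ℕ) (ω : Config d) (C : Set (ZVec d)) (t : ℕ) (z : ZVec d) : Prop :=
  ∀ i : Fin d, ∃ γ, IsPath d γ ∧ IsOpenPath d ω γ ∧ (∀ u ∈ γ, u ∈ C ∧ u ∈ boxZ d t z) ∧
    (∃ u ∈ γ, u i = z i - t) ∧ (∃ u ∈ γ, u i = z i + t)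

/-- The event `𝓔_N`: some crossing open cluster of `Λ_{2N}` is avoided by a modified
geodesic `π ⊆ Λ_N` of diameter at least `N/2` belonging to `𝔾_*(Λ_{tN})`. -/
def ENevent (d n : ℕ) (t : ℝ) (N : ℕ) : Set (Config d) :=
  {ω | ∃ v0 : ZVec d, CrossesBox d ω (openClusterOf d ω v0) (2 * N) 0 ∧
    ∃ π : List (ZVec d), IsPath d π ∧ (∀ u ∈ π, u ∈ boxZ d N 0) ∧
      GstarIn d n ω (boxR d (t * N) 0) π ∧ DiamGE d π ((N : ℝ) / 2) ∧
      ∀ u ∈ π, u ∉ openClusterOf d ω v0}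

/-- `ρ` is a Garet–Marchand moderate-deviation constant for the chemical distance. -/
def GMprop (d : ℕ) (μ : Measure (Config d)) (ρ : ℝ) : Prop :=
  1 ≤ ρ ∧ ∃ c : ℝ, 0 < c ∧ ∀ x : ZVec d, ∀ t : ℝ, ρ * (normInf d x : ℝ) ≤ t →
    μ {ω | chemDist d ω 0 x ≠ ⊤ ∧ t ≤ ((chemDist d ω 0 x).toNat : ℝ)}
      ≤ ENNReal.ofReal (c⁻¹ * Real.exp (-c * t)) ∧
    μ {ω | t ≤ ((chemDist d ω (starPt d ω 0) (starPt d ω x)).toNat : ℝ) ∨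
        chemDist d ω (starPt d ω 0) (starPt d ω x) = ⊤}
      ≤ ENNReal.ofReal (c⁻¹ * Real.exp (-c * t))

/-- `cs` is a constant for which the crossing-cluster avoidance lemma holds. -/
def CrossProp (d : ℕ) (μ : Measure (Config d)) (cs : ℝ) : Prop :=
  0 < cs ∧ cs < 1 ∧ ∀ n : ℕ, 2 ≤ n → ∀ t : ℝ, 1 / cs ≤ t → ∀ N : ℕ, 1 ≤ N →
    (N : ℝ) ≤ Real.exp (cs * (Real.log n) ^ 2) →
    μ (ENevent d n t N) ≤ ENNReal.ofReal (cs⁻¹ * Real.exp (-cs * N))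

/-- `N_ρ = ⌊N / (16 ρ²)⌋`. -/
def Nrho (ρ : ℝ) (N : ℕ) : ℕ := Nat.floor ((N : ℝ) / (16 * ρ ^ 2))

/-- The cube of side-length `m` with lower corner `z`. -/
def cube (d : ℕ) (m : ℕ) (z : ZVec d) : Set (ZVec d) :=
  {y | ∀ i, z i ≤ y i ∧ y i ≤ z i + m}

/-- The open cluster of `v` inside `U`. -/
def clusterIn (d : ℕ) (ω : Config d) (U : Set (ZVec d)) (v : ZVec d) : Set (ZVec d) :=
  {y | chemDistIn d ω U v y ≠ ⊤}

/-- `k ≤ r` for `k : ℕ∞` and `r : ℝ` (in particular `k` is finite). -/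
def chemLE (k : ℕ∞) (r : ℝ) : Prop := ∃ m : ℕ, k = (m : ℕ∞) ∧ (m : ℝ) ≤ r

/-- The box `Λ_{3N}(e)` is good (Definition 2.2 of the paper). -/
def GoodBox (d n : ℕ) (ρ Cstar : ℝ) (e : EdgeD d) (N : ℕ) (ω : Config d) : Prop :=
  (∃ v0 ∈ boxZ d (3 * N) e.val.1,
    (∀ z : ZVec d, cube d (Nrho ρ N) z ⊆ boxZ d (3 * N) e.val.1 →
      ∀ i : Fin d, ∃ γ, IsPath d γ ∧ IsOpenPath d ω γ ∧
        (∀ u ∈ γ, u ∈ clusterIn d ω (boxZ d (3 * N) e.val.1) v0 ∧ u ∈ cube d (Nrho ρ N) z) ∧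
        (∃ u ∈ γ, u i = z i) ∧ (∃ u ∈ γ, u i = z i + (Nrho ρ N : ℤ))) ∧
    (∀ π, IsPath d π → (∀ u ∈ π, u ∈ boxZ d (3 * N) e.val.1) →
      GstarIn d n ω (boxR d (Cstar * N) e.val.1) π → DiamGE d π ((Nrho ρ N : ℝ)) →
      ∃ u ∈ π, u ∈ clusterIn d ω (boxZ d (3 * N) e.val.1) v0)) ∧
  (∀ x y : ZVec d, x ∈ boxZ d (3 * N) e.val.1 → y ∈ boxZ d (3 * N) e.val.1 →
    normInf d (x - y) ≤ 2 * Nrho ρ N → chemDist d ω x y ≠ ⊤ →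
    chemDistIn d ω (boxZ d (4 * N) e.val.1) x y = chemDist d ω x y ∧
    chemLE (chemDist d ω x y) (4 * ρ * (Nrho ρ N : ℝ))) ∧
  (∀ x y : ZVec d, x ∈ annulus d N e → y ∈ annulus d N e →
    (∀ b : ZVec d, (normInf d (b - e.val.1) = N ∨ normInf d (b - e.val.1) = 3 * N) →
      (N : ℝ) / 2 ≤ (normInf d (x - b) : ℝ) ∧ (N : ℝ) / 2 ≤ (normInf d (y - b) : ℝ)) →
    normInf d (x - y) ≤ 2 * Nrho ρ N → chemDist d ω x y ≠ ⊤ →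
    chemDistIn d ω (annulus d N e) x y = chemDist d ω x y ∧
    chemLE (chemDist d ω x y) (4 * ρ * (Nrho ρ N : ℝ)))

/-- Evaluate an edge-indexed function at the (unordered) pair `{x,y}`, `0` if not an edge. -/
def edgeFnVal (d : ℕ) (g : EdgeD d → ℝ) (x y : ZVec d) : ℝ :=
  if h : ∃ e : EdgeD d, e.val = (x, y) ∨ e.val = (y, x) then g h.choose else 0

/-- The sum of `g` over the edges of the path `γ`. -/
def pathSum (d : ℕ) (g : EdgeD d → ℝ) (γ : List (ZVec d)) : ℝ :=
  ((γ.zip γ.tail).map fun pr => edgeFnVal d g pr.1 pr.2).sum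

/-- Number of edges of `η` that are not edges of `γ`, i.e. `|η \ γ|`. -/
def diffEdgeCount (d : ℕ) (η γ : List (ZVec d)) : ℕ :=
  ((η.zip η.tail).filter fun pr => decide (¬ edgeMemPath d pr.1 pr.2 γ)).length

/-- Maximal total weight of a lattice animal (path) in `Ξ_L`. -/
def animalMax (d : ℕ) (L : ℕ) (g : EdgeD d → ℝ) : ℝ :=
  sSup {r : ℝ | ∃ γ : List (ZVec d), IsPath d γ ∧ (∀ v ∈ γ, v ∈ boxZ d L 0) ∧
    γ.length ≤ L + 1 ∧ r = pathSum d g γ}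

/-- `m = ⌊n^{1/4}⌋`. -/
def mOf (n : ℕ) : ℕ := Nat.floor ((n : ℝ) ^ ((1 : ℝ) / 4))

/-- The box `Λ_m` as a finite set. -/
def boxFinset (d m : ℕ) : Finset (ZVec d) := Finset.Icc (fun _ => -(m : ℤ)) (fun _ => (m : ℤ))

/-- The spatially averaged passage time `F_m`. -/
def Fm (d n : ℕ) (ω : Config d) : ℝ :=
  (∑ z ∈ boxFinset d (mOf n), passageTime d n ω z (z + ptE1 d n)) / (boxFinset d (mOf n)).card

/-- The σ-algebra generated by the states of the first `i` edges. -/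
def edgeFiltration (d : ℕ) (ε : ℕ ≃ EdgeD d) (i : ℕ) : MeasurableSpace (Config d) :=
  MeasurableSpace.comap (fun ω (j : Fin i) => ω (ε j)) MeasurableSpace.pi

/-- The martingale increment `Δ_i = E[e^{λ F_m} | 𝓕_i] − E[e^{λ F_m} | 𝓕_{i−1}]`. -/
def mgDelta (d n : ℕ) (ε : ℕ ≃ EdgeD d) (lam : ℝ) (μ : Measure (Config d)) (i : ℕ) :
    Config d → ℝ :=
  fun ω => (μ[fun ω' => Real.exp (lam * Fm d n ω') | edgeFiltration d ε i]) ω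
    - (μ[fun ω' => Real.exp (lam * Fm d n ω') | edgeFiltration d ε (i - 1)]) ω

/-- The entropy `Ent[X] = E[X log (X / E[X])]`. -/
def entOf {α : Type*} [MeasurableSpace α] (μ : Measure α) (X : α → ℝ) : ℝ :=
  ∫ ω, X ω * Real.log (X ω / ∫ ω', X ω' ∂μ) ∂μ

end Perco
namespace Perco

/-! ### Product Bernoulli measures on arbitrary index types -/

/-- The Bernoulli measure on `Bool` with parameter `p`. -/
def bp (p : unitInterval) : Measure Bool :=
  ENNReal.ofReal (p : ℝ) • Measure.dirac true + ENNReal.ofReal (1 - (p : ℝ)) • Measure.dirac false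

theorem bp_true (p : unitInterval) : bp p {true} = ENNReal.ofReal (p : ℝ) := by
  simp [bp]

theorem bp_false (p : unitInterval) : bp p {false} = ENNReal.ofReal (1 - (p : ℝ)) := by
  simp [bp]

instance (p : unitInterval) : IsProbabilityMeasure (bp p) := by
  constructor
  simp only [bp, Measure.coe_add, Measure.coe_smul, Pi.add_apply, Pi.smul_apply, measure_univ,
    smul_eq_mul, mul_one]
  rw [← ENNReal.ofReal_add p.2.1 (by linarith [p.2.2])]
  simp

/-- The product of Bernoulli measures with parameters `q i`. -/
def bern {I : Type} (q : I → unitInterval) : Measure (I → Bool) :=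
  Measure.infinitePi fun i => bp (q i)

instance {I : Type} (q : I → unitInterval) : IsProbabilityMeasure (bern q) := by
  unfold bern; infer_instance

section
variable {I J : Type}

theorem bern_cyl (q : I → unitInterval) (s : Finset I) (f : I → Bool) :
    bern q {ω | ∀ i ∈ s, ω i = f i} = ∏ i ∈ s, bp (q i) {f i} := by
  have := Measure.infinitePi_pi (fun i => bp (q i)) (s := s) (t := fun i => {f i})
    (fun i _ => measurableSet_singleton _)
  rw [← this]
  rfl

theorem bern_cyl_false (q : I → unitInterval) (s : Finset I) :
    bern q {ω | ∀ i ∈ s, ω i = false} = ∏ i ∈ s, ENNReal.ofReal (1 - (q i : ℝ)) := by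
  have := bern_cyl q s (fun _ => false)
  simpa only [bp_false] using this

theorem measurableSet_cyl (s : Finset I) (f : I → Bool) :
    MeasurableSet {ω : I → Bool | ∀ i ∈ s, ω i = f i} := by
  have : {ω : I → Bool | ∀ i ∈ s, ω i = f i} = ⋂ i ∈ s, (fun ω : I → Bool => ω i) ⁻¹' {f i} := by
    ext; simp
  rw [this]
  exact Finset.measurableSet_biInter _ fun i _ => measurable_pi_apply i (measurableSet_singleton _)

theorem pi_eq_generateFrom_false :
    (MeasurableSpace.pi : MeasurableSpace (I → Bool)) =
      MeasurableSpace.generateFrom {A | ∃ s : Finset I, A = {ω | ∀ i ∈ s, ω i = false}} := by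
  apply le_antisymm
  · refine iSup_le fun i => ?_
    rintro A ⟨B, -, rfl⟩
    have h0 : MeasurableSet[MeasurableSpace.generateFrom
        {A : Set (I → Bool) | ∃ s : Finset I, A = {ω | ∀ i ∈ s, ω i = false}}]
        {ω : I → Bool | ω i = false} :=
      MeasurableSpace.measurableSet_generateFrom ⟨{i}, by simp⟩
    have key : Measurable[MeasurableSpace.generateFrom
        {A : Set (I → Bool) | ∃ s : Finset I, A = {ω | ∀ i ∈ s, ω i = false}}]
        (fun ω : I → Bool => ω i) := by
      refine @measurable_to_bool _ (_) _ ?_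
      have : (fun ω : I → Bool => ω i) ⁻¹' {true} = {ω : I → Bool | ω i = false}ᶜ := by
        ext ω; simp
      rw [this]
      exact h0.compl
    exact key (MeasurableSet.of_discrete)
  · refine MeasurableSpace.generateFrom_le ?_
    rintro A ⟨s, rfl⟩
    exact measurableSet_cyl s _

theorem eq_bern_of_false (q : I → unitInterval) (μ : Measure (I → Bool)) [IsProbabilityMeasure μ]
    (h : ∀ s : Finset I,
      μ {ω | ∀ i ∈ s, ω i = false} = ∏ i ∈ s, ENNReal.ofReal (1 - (q i : ℝ))) : μ = bern q := by
  refine ext_of_generate_finite _ pi_eq_generateFrom_false ?_ ?_ (by simp)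
  · rintro A ⟨s, rfl⟩ B ⟨t, rfl⟩ -
    refine ⟨s ∪ t, ?_⟩
    ext ω
    simp only [Set.mem_inter_iff, Set.mem_ofPred_eq, Finset.mem_union]
    constructor
    · rintro ⟨h1, h2⟩ i (hi | hi)
      exacts [h1 i hi, h2 i hi]
    · intro h
      exact ⟨fun i hi => h i (Or.inl hi), fun i hi => h i (Or.inr hi)⟩
  · rintro A ⟨s, rfl⟩
    rw [h, bern_cyl_false]

theorem bern_map_comp (q : I → unitInterval) (j : J → I) (hj : Function.Injective j) :
    (bern q).map (fun ω e => ω (j e)) = bern (fun e => q (j e)) := by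
  have hm : Measurable (fun (ω : I → Bool) (e : J) => ω (j e)) :=
    measurable_pi_lambda _ fun e => measurable_pi_apply _
  have : IsProbabilityMeasure ((bern q).map (fun (ω : I → Bool) (e : J) => ω (j e))) :=
    Measure.isProbabilityMeasure_map hm.aemeasurable
  refine eq_bern_of_false _ _ fun s => ?_
  rw [Measure.map_apply hm (measurableSet_cyl s _)]
  have := bern_cyl_false q (s.image j)
  rw [Finset.prod_image (fun a _ b _ h => hj h)] at this
  rw [← this]
  congr 1
  ext ω
  simp

theorem bern_map_or {L E : Type} [Fintype L] (q : L × E → unitInterval) (r : E → unitInterval)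
    (hr : ∀ e, 1 - (r e : ℝ) = ∏ l, (1 - (q (l, e) : ℝ))) :
    (bern q).map (fun ω e => decide (∃ l, ω (l, e) = true)) = bern r := by
  have hm : Measurable (fun (ω : L × E → Bool) (e : E) => decide (∃ l, ω (l, e) = true)) := by
    refine measurable_pi_lambda _ fun e => measurable_to_bool ?_
    have : (fun ω : L × E → Bool => decide (∃ l, ω (l, e) = true)) ⁻¹' {true} =
        ⋃ l, (fun ω => ω (l, e)) ⁻¹' {true} := by ext; simp
    rw [this]
    exact MeasurableSet.iUnion fun l => measurable_pi_apply _ (measurableSet_singleton _)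
  have := Measure.isProbabilityMeasure_map (μ := bern q) hm.aemeasurable
  refine eq_bern_of_false _ _ fun s => ?_
  rw [Measure.map_apply hm (measurableSet_cyl s _)]
  have := bern_cyl_false q (s ×ˢ (Finset.univ : Finset L) |>.map (Equiv.prodComm E L).toEmbedding)
  rw [Finset.prod_map, Finset.prod_product] at this
  trans ∏ e ∈ s, ∏ l, ENNReal.ofReal (1 - (q (l, e) : ℝ))
  · refine Eq.trans ?_ this
    congr 1
    ext ω
    simp
    grind
  · refine Finset.prod_congr rfl fun e _ => ?_
    rw [hr, ENNReal.ofReal_prod_of_nonneg]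
    intro l _
    linarith [(q (l, e)).2.2]

/-! ### Events depending on a set of coordinates -/

/-- `A` depends only on the coordinates in `U`. -/
def Dep (U : Set I) (A : Set (I → Bool)) : Prop :=
  ∀ ω ω' : I → Bool, (∀ i ∈ U, ω i = ω' i) → ω ∈ A → ω' ∈ A

theorem Dep.iff {U : Set I} {A : Set (I → Bool)} (h : Dep U A) {ω ω' : I → Bool}
    (hω : ∀ i ∈ U, ω i = ω' i) : ω ∈ A ↔ ω' ∈ A :=
  ⟨h _ _ hω, h _ _ fun i hi => (hω i hi).symm⟩

theorem Dep.mono {U U' : Set I} {A : Set (I → Bool)} (h : Dep U A) (hU : U ⊆ U') : Dep U' A :=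
  fun _ _ hω => h _ _ fun i hi => hω i (hU hi)

theorem Dep.compl {U : Set I} {A : Set (I → Bool)} (h : Dep U A) : Dep U Aᶜ :=
  fun _ _ hω h1 h2 => h1 (h _ _ (fun i hi => (hω i hi).symm) h2)

theorem Dep.inter {U : Set I} {A B : Set (I → Bool)} (h : Dep U A) (h' : Dep U B) :
    Dep U (A ∩ B) :=
  fun _ _ hω h1 => ⟨h _ _ hω h1.1, h' _ _ hω h1.2⟩

theorem Dep.union {U : Set I} {A B : Set (I → Bool)} (h : Dep U A) (h' : Dep U B) :
    Dep U (A ∪ B) :=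
  fun _ _ hω h1 => h1.imp (h _ _ hω) (h' _ _ hω)

theorem Dep.iInter {κ : Sort*} {U : Set I} {A : κ → Set (I → Bool)} (h : ∀ k, Dep U (A k)) :
    Dep U (⋂ k, A k) :=
  fun _ _ hω h1 => Set.mem_iInter.2 fun k => h k _ _ hω (Set.mem_iInter.1 h1 k)

theorem Dep.iUnion {κ : Sort*} {U : Set I} {A : κ → Set (I → Bool)} (h : ∀ k, Dep U (A k)) :
    Dep U (⋃ k, A k) := fun _ _ hω h1 => by
  obtain ⟨k, hk⟩ := Set.mem_iUnion.1 h1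
  exact Set.mem_iUnion.2 ⟨k, h k _ _ hω hk⟩

/-- Extension of a configuration on `U` by `false`. -/
def extFalse (U : Set I) (f : U → Bool) : I → Bool :=
  fun i => if h : i ∈ U then f ⟨i, h⟩ else false

theorem Dep.extFalse_mem {U : Set I} {A : Set (I → Bool)} (h : Dep U A) (ω : I → Bool) :
    extFalse U (fun i => ω i) ∈ A ↔ ω ∈ A :=
  h.iff fun i hi => by simp [extFalse, hi]

theorem Dep.measurable_of_finite {U : Set I} (hU : U.Finite) {A : Set (I → Bool)} (h : Dep U A) :
    MeasurableSet A := by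
  have := hU.to_subtype
  have : A = (fun (ω : I → Bool) (i : U) => ω i) ⁻¹' {f | extFalse U f ∈ A} := by
    ext ω
    simp [h.extFalse_mem]
  rw [this]
  exact (measurable_pi_lambda _ fun i => measurable_pi_apply _) (Set.toFinite _).measurableSet

theorem measurable_extFalse (U : Set I) : Measurable (extFalse U) := by
  refine measurable_pi_lambda _ fun i => ?_
  by_cases h : i ∈ U
  · simpa [extFalse, h] using measurable_pi_apply (⟨i, h⟩ : U)
  · simp [extFalse, h]

theorem Dep.measurable_iSup {U : Set I} {A : Set (I → Bool)} (h : Dep U A) (hA : MeasurableSet A) :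
    MeasurableSet[⨆ i ∈ U, MeasurableSpace.comap (fun ω : I → Bool => ω i) inferInstance] A := by
  have : A = (fun (ω : I → Bool) (i : U) => ω i) ⁻¹' (extFalse U ⁻¹' A) := by
    ext ω
    simp [h.extFalse_mem]
  rw [this]
  have hm : Measurable[⨆ i ∈ U, MeasurableSpace.comap (fun ω : I → Bool => ω i) inferInstance]
      (fun (ω : I → Bool) (i : U) => ω i) := by
    refine @measurable_pi_lambda _ _ _ (_) _ _ fun i => ?_
    refine Measurable.mono (comap_measurable (fun ω : I → Bool => ω i)) ?_ le_rfl
    exact le_iSup₂_of_le (f := fun (i : I) (_ : i ∈ U) =>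
      MeasurableSpace.comap (fun ω : I → Bool => ω i) inferInstance) i.1 i.2 le_rfl
  exact hm (measurable_extFalse U hA)

theorem bern_indep (q : I → unitInterval) {U V : Set I} (hUV : Disjoint U V)
    {A B : Set (I → Bool)} (hA : Dep U A) (hB : Dep V B) (mA : MeasurableSet A)
    (mB : MeasurableSet B) : bern q (A ∩ B) = bern q A * bern q B := by
  have h1 : ProbabilityTheory.iIndepFun (fun (i : I) (ω : I → Bool) => ω i) (bern q) :=
    ProbabilityTheory.iIndepFun_infinitePi (X := fun _ (b : Bool) => b) fun _ => measurable_id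
  have h2 := ProbabilityTheory.indep_iSup_of_disjoint (fun i => (measurable_pi_apply i).comap_le)
    h1 hUV
  exact (ProbabilityTheory.Indep_iff _ _ _).1 h2 A B (hA.measurable_iSup mA) (hB.measurable_iSup mB)

theorem bern_indep_real (q : I → unitInterval) {U V : Set I} (hUV : Disjoint U V)
    {A B : Set (I → Bool)} (hA : Dep U A) (hB : Dep V B) (mA : MeasurableSet A)
    (mB : MeasurableSet B) : (bern q).real (A ∩ B) = (bern q).real A * (bern q).real B := by
  simp only [Measure.real, bern_indep q hUV hA hB mA mB, ENNReal.toReal_mul]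

/-! ### The Harris inequality -/

/-- `A` is an increasing event. -/
def Incr (A : Set (I → Bool)) : Prop := ∀ ω ω' : I → Bool, ω ≤ ω' → ω ∈ A → ω' ∈ A

theorem Incr.inter {A B : Set (I → Bool)} (h : Incr A) (h' : Incr B) : Incr (A ∩ B) :=
  fun _ _ hω h1 => ⟨h _ _ hω h1.1, h' _ _ hω h1.2⟩

theorem bern_real_eq_sum (q : I → unitInterval) (U : Finset I) {A : Set (I → Bool)}
    (hA : Dep (U : Set I) A) :
    (bern q).real A = ∑ f : ↥(U : Set I) → Bool, (∏ i : ↥(U : Set I), (bp (q i)).real {f i}) *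
      (if extFalse (U : Set I) f ∈ A then 1 else 0) := by
  have hc : ∀ f : ↥(U : Set I) → Bool, (bern q).real {ω | ∀ i : (U : Set I), ω i = f i} =
      ∏ i : ↥(U : Set I), (bp (q i)).real {f i} := by
    intro f
    have := bern_cyl q U (extFalse (U : Set I) f)
    have e1 : {ω : I → Bool | ∀ i ∈ U, ω i = extFalse (U : Set I) f i} =
        {ω | ∀ i : (U : Set I), ω i = f i} := by
      ext ω
      simp only [Set.mem_ofPred_eq, Subtype.forall, Finset.mem_coe]
      refine forall₂_congr fun i hi => ?_
      simp [extFalse, hi]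
    rw [e1] at this
    rw [Measure.real, this, ← Finset.prod_attach, ENNReal.toReal_prod]
    refine Finset.prod_congr rfl fun i _ => ?_
    rw [Measure.real]
    congr 3
    have := i.2
    simp only [extFalse]
    rw [dif_pos (show i.1 ∈ (U : Set I) from this)]
    rfl
  have hAU : A = ⋃ f ∈ (Finset.univ.filter fun f => extFalse (U : Set I) f ∈ A),
      {ω : I → Bool | ∀ i : (U : Set I), ω i = f i} := by
    ext ω
    simp only [Finset.mem_filter, Finset.mem_univ, true_and, Set.mem_iUnion, Set.mem_ofPred_eq,
      exists_prop]
    constructor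
    · intro h
      exact ⟨fun i => ω i, (hA.extFalse_mem ω).2 h, fun i => rfl⟩
    · rintro ⟨f, hf, hω⟩
      have : f = fun i : (U : Set I) => ω i := funext fun i => (hω i).symm
      subst this
      exact (hA.extFalse_mem ω).1 hf
  refine (congrArg (bern q).real hAU).trans ?_
  rw [measureReal_biUnion_finset]
  · rw [Finset.sum_filter]
    refine Finset.sum_congr rfl fun f _ => ?_
    split_ifs
    · rw [hc, mul_one]
    · rw [mul_zero]
  · intro f _ g _ hfg
    refine Set.disjoint_left.2 fun ω h1 h2 => hfg (funext fun i => ?_)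
    rw [← h1 i, ← h2 i]
  · intro f _
    have : Dep (U : Set I) {ω : I → Bool | ∀ i : (U : Set I), ω i = f i} := by
      intro ω ω' h h1 i
      rw [← h i i.2]; exact h1 i
    exact this.measurable_of_finite U.finite_toSet

theorem bern_harris (q : I → unitInterval) {U : Set I} (hU : U.Finite) {A B : Set (I → Bool)}
    (hA : Dep U A) (hB : Dep U B) (iA : Incr A) (iB : Incr B) :
    (bern q).real A * (bern q).real B ≤ (bern q).real (A ∩ B) := by
  obtain ⟨U, rfl⟩ := hU.exists_finset_coe
  rw [bern_real_eq_sum q U hA, bern_real_eq_sum q U hB, bern_real_eq_sum q U (hA.inter hB)]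
  have hmono : Monotone (extFalse (U : Set I)) := by
    intro f g hfg i
    by_cases h : i ∈ (U : Set I)
    · simpa [extFalse, h] using hfg ⟨i, h⟩
    · simp [extFalse, h]
  have h1 : ∑ f : ↥(U : Set I) → Bool, (∏ i : ↥(U : Set I), (bp (q i)).real {f i}) = 1 := by
    have := bern_real_eq_sum q U (A := Set.univ) (fun _ _ _ _ => trivial)
    simpa using this.symm
  have := fkg (α := ↥(U : Set I) → Bool) (β := ℝ)
    (fun f => if extFalse (U : Set I) f ∈ A then 1 else 0)
    (fun f => if extFalse (U : Set I) f ∈ B then 1 else 0)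
    (fun f => ∏ i : ↥(U : Set I), (bp (q i)).real {f i}) ?_ ?_ ?_ ?_ ?_ ?_
  · rw [h1, one_mul] at this
    refine this.trans (le_of_eq (Finset.sum_congr rfl fun f _ => ?_))
    congr 1
    by_cases h : extFalse (U : Set I) f ∈ A <;> by_cases h' : extFalse (U : Set I) f ∈ B <;>
      simp [h, h']
  · intro f; exact Finset.prod_nonneg fun i _ => measureReal_nonneg
  · intro f; dsimp; split_ifs <;> simp
  · intro f; dsimp; split_ifs <;> simp
  · intro f g hfg
    dsimp
    split_ifs with h h' <;> try simp
    exact absurd (iA _ _ (hmono hfg) h) h'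
  · intro f g hfg
    dsimp
    split_ifs with h h' <;> try simp
    exact absurd (iB _ _ (hmono hfg) h) h'
  · intro f g
    rw [← Finset.prod_mul_distrib, ← Finset.prod_mul_distrib]
    refine le_of_eq (Finset.prod_congr rfl fun i _ => ?_)
    simp only [Pi.inf_apply, Pi.sup_apply]
    cases f i <;> cases g i <;> simp [mul_comm]

end

/-! ### Connectivity -/

/-- `x` and `y` are joined by an `O`-path inside `R`. -/
def Cn {α : Type*} (O : α → α → Prop) (R : Set α) (x y : α) : Prop :=
  x ∈ R ∧ Relation.ReflTransGen (fun a b => O a b ∧ b ∈ R) x y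

namespace Cn
variable {α β : Type*} {O O' : α → α → Prop} {R R' S : Set α} {x y z a b : α}

theorem refl (hx : x ∈ R) : Cn O R x x := ⟨hx, .refl⟩

theorem right_mem (h : Cn O R x y) : y ∈ R := by
  rcases h.2.cases_tail with rfl | ⟨c, _, hc⟩
  exacts [h.1, hc.2]

theorem trans (h : Cn O R x y) (h' : Cn O R y z) : Cn O R x z := ⟨h.1, h.2.trans h'.2⟩

theorem tail (h : Cn O R x y) (hO : O y z) (hz : z ∈ R) : Cn O R x z := ⟨h.1, h.2.tail ⟨hO, hz⟩⟩

theorem single (hx : x ∈ R) (hO : O x y) (hy : y ∈ R) : Cn O R x y := (refl hx).tail hO hy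

theorem head (hx : x ∈ R) (hO : O x y) (h : Cn O R y z) : Cn O R x z := (single hx hO h.1).trans h

@[elab_as_elim]
theorem induct {P : (y : α) → Cn O R x y → Prop} (h0 : ∀ hx : x ∈ R, P x (refl hx))
    (h1 : ∀ a b (ha : Cn O R x a) (hab : O a b) (hb : b ∈ R), P a ha → P b (ha.tail hab hb))
    {y : α} (h : Cn O R x y) : P y h := by
  obtain ⟨hx, h⟩ := h
  induction h with
  | refl => exact h0 hx
  | tail hab hbc ih => exact h1 _ _ ⟨hx, hab⟩ hbc.1 hbc.2 ih

theorem symm (hO : ∀ a b, O a b → O b a) (h : Cn O R x y) : Cn O R y x := by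
  induction h using induct with
  | h0 hx => exact refl hx
  | h1 a b ha hab hb ih => exact head hb (hO _ _ hab) ih

theorem mono_in (h : Cn O R x y) (hR : R ⊆ R') (hO : ∀ a ∈ R, ∀ b ∈ R, O a b → O' a b) :
    Cn O' R' x y := by
  induction h using induct with
  | h0 hx => exact refl (hR hx)
  | h1 a b ha hab hb ih => exact ih.tail (hO _ ha.right_mem _ hb hab) (hR hb)

theorem mono (h : Cn O R x y) (hR : R ⊆ R') : Cn O R' x y := h.mono_in hR fun _ _ _ _ => id

theorem map (f : α → β) {O' : β → β → Prop} {R' : Set β} (h : Cn O R x y)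
    (hR : ∀ a ∈ R, f a ∈ R') (hO : ∀ a ∈ R, ∀ b ∈ R, O a b → O' (f a) (f b)) :
    Cn O' R' (f x) (f y) := by
  induction h using induct with
  | h0 hx => exact refl (hR _ hx)
  | h1 a b ha hab hb ih => exact ih.tail (hO _ ha.right_mem _ hb hab) (hR _ hb)

/-- The last exit from a set. -/
theorem last_exit (h : Cn O R x y) (hx : x ∈ S) (hy : y ∉ S) :
    ∃ a b, Cn O R x a ∧ a ∈ S ∧ b ∉ S ∧ O a b ∧ Cn O (R \ S) b y := by
  revert hy
  induction h using induct with
  | h0 _ => exact fun hy => absurd hx hy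
  | h1 a b ha hab hb ih =>
    intro hbS
    by_cases haS : a ∈ S
    · exact ⟨a, b, ha, haS, hbS, hab, refl ⟨hb, hbS⟩⟩
    · obtain ⟨a', b', h1, h2, h3, h4, h5⟩ := ih haS
      exact ⟨a', b', h1, h2, h3, h4, h5.tail hab ⟨hb, hbS⟩⟩

/-- The first exit from a set. -/
theorem first_exit (h : Cn O R x y) (hx : x ∈ S) (hy : y ∉ S) :
    ∃ a b, Cn O (R ∩ S) x a ∧ b ∉ S ∧ O a b ∧ Cn O R x b := by
  have key : Cn O (R ∩ S) x y ∨ ∃ a b, Cn O (R ∩ S) x a ∧ b ∉ S ∧ O a b ∧ Cn O R x b := by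
    clear hy
    induction h using induct with
    | h0 hx' => exact Or.inl (refl ⟨hx', hx⟩)
    | h1 a b ha hab hb ih =>
      rcases ih with ih | ih
      · by_cases hbS : b ∈ S
        · exact Or.inl (ih.tail hab ⟨hb, hbS⟩)
        · exact Or.inr ⟨a, b, ih, hbS, hab, ha.tail hab hb⟩
      · exact Or.inr ih
  rcases key with h | h
  · exact absurd h.right_mem.2 hy
  · exact h

theorem of_list {γ : List α} (h1 : γ.IsChain O) (h4 : ∀ v ∈ γ, v ∈ R) :
    ∀ x y, γ.head? = some x → y ∈ γ → Cn O R x y := by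
  induction γ with
  | nil => simp
  | cons a γ ih =>
    intro x y hx hy
    simp at hx
    subst hx
    rcases List.mem_cons.1 hy with rfl | hy
    · exact refl (h4 _ (by simp))
    · rw [List.isChain_cons] at h1
      obtain ⟨b, hb⟩ : ∃ b, γ.head? = some b := by
        cases γ with
        | nil => simp at hy
        | cons b _ => exact ⟨b, rfl⟩
      exact head (h4 _ (by simp)) (h1.1 b (by simp [hb]))
        (ih h1.2 (fun v hv => h4 v (List.mem_cons_of_mem _ hv)) b y hb hy)

end Cn

/-! ### Lattice geometry -/

section Lattice
variable {d : ℕ}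

theorem Adj.symm {x y : ZVec d} (h : Adj d x y) : Adj d y x := by
  unfold Adj norm1 at *
  rw [← h]
  refine Finset.sum_congr rfl fun i _ => ?_
  simp only [Pi.sub_apply]; omega

theorem adj_iff {x y : ZVec d} :
    Adj d x y ↔ ∃ i, (y i = x i + 1 ∨ y i = x i - 1) ∧ ∀ j, j ≠ i → y j = x j := by
  unfold Adj norm1
  constructor
  · intro h
    have h0 : ∃ i, (x - y) i ≠ 0 := by
      by_contra! hc
      simp [hc] at h
    obtain ⟨i, hi⟩ := h0
    have h1 := Finset.add_sum_erase Finset.univ (fun i => ((x - y) i).natAbs) (Finset.mem_univ i)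
    have h2 : ((x - y) i).natAbs = 1 ∧
        ∑ j ∈ Finset.univ.erase i, ((x - y) j).natAbs = 0 := by omega
    refine ⟨i, ?_, fun j hj => ?_⟩
    · have := h2.1
      simp only [Pi.sub_apply] at this
      omega
    · have := Finset.sum_eq_zero_iff.1 h2.2 j (by simp [hj])
      simp only [Pi.sub_apply] at this
      omega
  · rintro ⟨i, hi, hj⟩
    rw [Finset.sum_eq_single i]
    · simp only [Pi.sub_apply]; omega
    · intro j _ hji
      simp [hj j hji]
    · simp

theorem Adj.abs_le {x y : ZVec d} (h : Adj d x y) (j : Fin d) : |x j - y j| ≤ 1 := by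
  obtain ⟨i, hi, hj⟩ := adj_iff.1 h
  by_cases hji : j = i
  · subst hji; rw [_root_.abs_le]; omega
  · simp [hj j hji]

/-- The sup-norm ball of radius `r`, as a finite set. -/
def Bx (r : ℤ) (z : ZVec d) : Finset (ZVec d) :=
  Finset.Icc (fun i => z i - r) (fun i => z i + r)

theorem mem_Bx {r : ℤ} {z y : ZVec d} : y ∈ Bx r z ↔ ∀ i, |y i - z i| ≤ r := by
  simp only [Bx, Finset.mem_Icc, Pi.le_def]
  constructor
  · rintro ⟨h1, h2⟩ i
    rw [abs_le]; constructor <;> linarith [h1 i, h2 i]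
  · intro h
    constructor <;> intro i <;> have := abs_le.1 (h i) <;> linarith

/-- The sup-norm ball as a set. -/
abbrev Bs (r : ℤ) (z : ZVec d) : Set (ZVec d) := ↑(Bx r z)

theorem mem_Bs {r : ℤ} {z y : ZVec d} : y ∈ Bs r z ↔ ∀ i, |y i - z i| ≤ r := by
  rw [Bs, Finset.mem_coe, mem_Bx]

theorem Bx_self {r : ℤ} (hr : 0 ≤ r) (z : ZVec d) : z ∈ Bx r z := mem_Bx.2 fun i => by simpa

theorem Bx_subset {r s : ℤ} {z w : ZVec d} (h : ∀ i, |z i - w i| + r ≤ s) : Bx r z ⊆ Bx s w := by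
  intro y hy
  rw [mem_Bx] at *
  intro i
  have := abs_sub_le (y i) (z i) (w i)
  linarith [h i, hy i]

theorem Bx_mono {r s : ℤ} (h : r ≤ s) (z : ZVec d) : Bx r z ⊆ Bx s z :=
  Bx_subset fun i => by simpa

/-- A point of the ball all of whose neighbours do not lie in the ball is on its boundary. -/
theorem Adj.boundary {r : ℤ} {z a b : ZVec d} (h : Adj d a b) (ha : a ∈ Bx r z) (hb : b ∉ Bx r z) :
    ∃ i, |a i - z i| = r := by
  rw [mem_Bx] at *
  push Not at hb
  obtain ⟨i, hi⟩ := hb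
  refine ⟨i, ?_⟩
  have h1 := ha i
  have h2 := h.abs_le i
  have := abs_sub_le (b i) (a i) (z i)
  rw [abs_sub_comm] at h2
  omega

/-- The open-edge relation of a configuration on unordered pairs. -/
def Op (ω : Sym2 (ZVec d) → Bool) (a b : ZVec d) : Prop := Adj d a b ∧ ω s(a, b) = true

theorem Op.symm {ω : Sym2 (ZVec d) → Bool} {a b : ZVec d} (h : Op ω a b) : Op ω b a :=
  ⟨h.1.symm, by rw [Sym2.eq_swap]; exact h.2⟩

theorem Op.mono {ω ω' : Sym2 (ZVec d) → Bool} (hω : ω ≤ ω') {a b : ZVec d} (h : Op ω a b) :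
    Op ω' a b := by
  refine ⟨h.1, ?_⟩
  have := hω s(a, b)
  rw [h.2] at this
  exact top_le_iff.1 this

/-- The pairs with both endpoints in `R`. -/
def inner (R : Set (ZVec d)) : Set (Sym2 (ZVec d)) := {e | ∀ v ∈ e, v ∈ R}

theorem inner_finite {R : Set (ZVec d)} (hR : R.Finite) : (inner R).Finite := by
  refine (((hR.prod hR).image fun q => s(q.1, q.2))).subset ?_
  intro e
  induction e using Sym2.ind with
  | _ a b =>
    intro h
    exact ⟨(a, b), ⟨h a (by simp), h b (by simp)⟩, rfl⟩

theorem mem_inner {R : Set (ZVec d)} {a b : ZVec d} : s(a, b) ∈ inner R ↔ a ∈ R ∧ b ∈ R := by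
  simp [inner]

theorem inner_mono {R R' : Set (ZVec d)} (h : R ⊆ R') : inner R ⊆ inner R' :=
  fun _ he v hv => h (he v hv)

theorem dep_Cn (R : Set (ZVec d)) (x y : ZVec d) : Dep (inner R) {ω | Cn (Op ω) R x y} := by
  intro ω ω' h h1
  refine Cn.mono_in h1 le_rfl fun a ha b hb hab => ⟨hab.1, ?_⟩
  rw [← h s(a, b) (mem_inner.2 ⟨ha, hb⟩)]
  exact hab.2

theorem incr_Cn (R : Set (ZVec d)) (x y : ZVec d) : Incr {ω | Cn (Op ω) R x y} :=
  fun _ _ hω h1 => Cn.mono_in h1 le_rfl fun _ _ _ _ hab => hab.mono hω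

end Lattice

/-! ### Symmetries and the passage to configurations on edges -/

section
variable {d : ℕ}

theorem bern_aut (p : unitInterval) (τ : ZVec d ≃ ZVec d) {A : Set (Sym2 (ZVec d) → Bool)}
    (hA : MeasurableSet A) :
    (bern fun _ => p).real {ω | (fun e => ω (Sym2.map τ e)) ∈ A} = (bern fun _ => p).real A := by
  have h := bern_map_comp (fun _ : Sym2 (ZVec d) => p) (Sym2.map τ)
    (Sym2.map.injective τ.injective)
  have hm : Measurable (fun (ω : Sym2 (ZVec d) → Bool) (e : Sym2 (ZVec d)) => ω (Sym2.map τ e)) :=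
    measurable_pi_lambda _ fun e => measurable_pi_apply _
  conv_rhs => rw [← h]
  rw [Measure.real, Measure.real, Measure.map_apply hm hA]
  rfl

theorem Cn_aut {τ : ZVec d ≃ ZVec d} (hτ : ∀ a b, Adj d (τ a) (τ b) ↔ Adj d a b)
    {ω : Sym2 (ZVec d) → Bool} {R R' : Set (ZVec d)} (hR : ∀ a, τ a ∈ R' ↔ a ∈ R) {x y : ZVec d} :
    Cn (Op fun e => ω (Sym2.map τ e)) R x y ↔ Cn (Op ω) R' (τ x) (τ y) := by
  constructor
  · intro h
    refine h.map τ (fun a ha => (hR a).2 ha) fun a _ b _ hab => ⟨(hτ _ _).2 hab.1, ?_⟩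
    simpa using hab.2
  · intro h
    have := h.map (R' := R) (O' := Op fun e => ω (Sym2.map τ e)) τ.symm
      (fun a ha => (hR _).1 (by simpa using ha)) fun a _ b _ hab =>
        ⟨(hτ _ _).1 (by simpa using hab.1), by simpa using hab.2⟩
    simpa using this

theorem adj_add_right (v a b : ZVec d) : Adj d (a + v) (b + v) ↔ Adj d a b := by
  simp [Adj]

/-- The signed coordinate permutation of the lattice. -/
def signedPerm (π : Equiv.Perm (Fin d)) (s : Fin d → ℤˣ) : ZVec d ≃ ZVec d where
  toFun x i := s i * x (π i)
  invFun x i := s (π.symm i) * x (π.symm i)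
  left_inv x := by ext i; simp [← mul_assoc, ← Units.val_mul]
  right_inv x := by ext i; simp [← mul_assoc, ← Units.val_mul]

theorem adj_signedPerm (π : Equiv.Perm (Fin d)) (s : Fin d → ℤˣ) (a b : ZVec d) :
    Adj d (signedPerm π s a) (signedPerm π s b) ↔ Adj d a b := by
  unfold Adj norm1 signedPerm
  have : ∀ i, (((s i : ℤ) * a (π i)) - ((s i : ℤ) * b (π i))).natAbs = (a (π i) - b (π i)).natAbs := by
    intro i
    rw [← mul_sub, Int.natAbs_mul]
    simp
  simp only [Equiv.coe_fn_mk, Pi.sub_apply, this]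
  rw [Equiv.sum_comp π (fun i => (a i - b i).natAbs)]

theorem Adj.norm1_ne {x y : ZVec d} (h : Adj d x y) : norm1 d x ≠ norm1 d y := by
  obtain ⟨i, hi, hj⟩ := adj_iff.1 h
  unfold norm1
  rw [← Finset.add_sum_erase Finset.univ (fun i => (x i).natAbs) (Finset.mem_univ i),
    ← Finset.add_sum_erase Finset.univ (fun i => (y i).natAbs) (Finset.mem_univ i)]
  rw [Finset.sum_congr rfl (fun j hj' => by rw [← hj j (Finset.ne_of_mem_erase hj')])]
  omega

/-- The unordered pair underlying an edge. -/
def EdgeD.pair (e : EdgeD d) : Sym2 (ZVec d) := s(e.val.1, e.val.2)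

theorem EdgeD.pair_injective : Function.Injective (EdgeD.pair (d := d)) := by
  rintro ⟨⟨a, b⟩, h1, h2⟩ ⟨⟨a', b'⟩, h1', h2'⟩ h
  simp only [EdgeD.pair, Sym2.eq_iff] at h
  rcases h with ⟨rfl, rfl⟩ | ⟨rfl, rfl⟩
  · rfl
  · exact absurd h2 (not_lt.2 h2'.le)

theorem edgeOpen_pair (ω : Sym2 (ZVec d) → Bool) (x y : ZVec d) :
    EdgeOpen d (fun e => ω e.pair) x y ↔ Op ω x y := by
  constructor
  · rintro ⟨⟨⟨a, b⟩, h1, h2⟩, h | h, he⟩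
    · simp only [Prod.mk.injEq] at h
      obtain ⟨rfl, rfl⟩ := h
      exact ⟨h1, he⟩
    · simp only [Prod.mk.injEq] at h
      obtain ⟨rfl, rfl⟩ := h
      exact Op.symm ⟨h1, he⟩
  · rintro ⟨h, ho⟩
    rcases lt_or_gt_of_ne h.norm1_ne with hl | hl
    · exact ⟨⟨(x, y), h, hl⟩, Or.inl rfl, ho⟩
    · exact ⟨⟨(y, x), h.symm, hl⟩, Or.inr rfl, by rw [← ho]; exact congrArg ω Sym2.eq_swap⟩

theorem IsBernoulli.eq_map {p : unitInterval} {μ : Measure (Config d)} (h : IsBernoulli d p μ) :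
    μ = (bern fun _ : Sym2 (ZVec d) => p).map (fun ω e => ω e.pair) := by
  rw [bern_map_comp _ _ EdgeD.pair_injective]
  have := h.1
  refine eq_bern_of_false _ _ fun s => ?_
  simpa using h.2 s (fun _ => false)

theorem chemDist_ne_top {ω : Config d} {x y : ZVec d} (h : chemDist d ω x y ≠ ⊤) :
    Cn (EdgeOpen d ω) Set.univ x y := by
  unfold chemDist chemDistIn at h
  by_contra hc
  apply h
  rw [sInf_eq_top]
  rintro k ⟨γ, h1, h2, h3, h4, h5, h6⟩
  exact absurd (Cn.of_list h2 h3 x y h4 (List.mem_of_getLast? h5)) hc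

/-! ### The zero-one law -/

/-- The event that the ball of radius `m` is joined to the boundary of the ball of radius `n`. -/
def Dev (d m n : ℕ) : Set (Sym2 (ZVec d) → Bool) :=
  {ω | ∃ a ∈ Bx m 0, ∃ y : ZVec d, (∃ i, |y i| = n) ∧ Cn (Op ω) (Bs n 0) a y}

/-- The same event, without using the edges inside the inner ball. -/
def Dev' (d m n : ℕ) : Set (Sym2 (ZVec d) → Bool) :=
  {ω | ∃ a ∈ Bx (m + 1 : ℕ) 0, ∃ y : ZVec d, (∃ i, |y i| = n) ∧
    Cn (Op ω) (Bs n 0 \ Bs m 0) a y}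

theorem dep_Dev (m n : ℕ) : Dep (inner (Bs n (0 : ZVec d))) (Dev d m n) := by
  rintro ω ω' h ⟨a, ha, y, hy, hc⟩
  exact ⟨a, ha, y, hy, dep_Cn _ _ _ ω ω' h hc⟩

theorem dep_Dev' (m n : ℕ) :
    Dep (inner (Bs n (0 : ZVec d) \ Bs m 0)) (Dev' d m n) := by
  rintro ω ω' h ⟨a, ha, y, hy, hc⟩
  exact ⟨a, ha, y, hy, dep_Cn _ _ _ ω ω' h hc⟩

theorem measurable_Dev (m n : ℕ) : MeasurableSet (Dev d m n) :=
  (dep_Dev m n).measurable_of_finite (inner_finite (Finset.finite_toSet _))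

theorem Dev_subset_Dev' {m n : ℕ} (h : m < n) : Dev d m n ⊆ Dev' d m n := by
  rintro ω ⟨a, ha, y, ⟨i, hi⟩, hc⟩
  have hy : y ∉ Bs m 0 := by
    intro hy
    have := mem_Bx.1 (Finset.mem_coe.1 hy) i
    simp only [Pi.zero_apply, sub_zero] at this
    omega
  obtain ⟨a', b, h1, h2, h3, h4, h5⟩ := hc.last_exit (S := Bs m 0) ha hy
  refine ⟨b, ?_, y, ⟨i, hi⟩, h5⟩
  rw [mem_Bx]
  intro j
  have e1 := mem_Bx.1 (Finset.mem_coe.1 h2) j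
  have e2 := h4.1.symm.abs_le j
  have := abs_sub_le (b j) (a' j) ((0 : ZVec d) j)
  push_cast
  omega

theorem Dev'_subset_Dev {m n : ℕ} : Dev' d m n ⊆ Dev d (m + 1) n := by
  rintro ω ⟨a, ha, y, hy, hc⟩
  exact ⟨a, ha, y, hy, hc.mono Set.sdiff_subset⟩

theorem Dev_mono {m m' n : ℕ} (h : m ≤ m') : Dev d m n ⊆ Dev d m' n := by
  rintro ω ⟨a, ha, y, hy, hc⟩
  exact ⟨a, Bx_mono (by exact_mod_cast h) _ ha, y, hy, hc⟩

theorem bern_zero_one {I : Type} (q : I → unitInterval) {A : Set (I → Bool)} (hA : MeasurableSet A)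
    (h : ∀ s : Finset I, Dep {i | i ∉ s} A) : bern q A = 0 ∨ bern q A = 1 := by
  have key : (bern q).restrict A = bern q A • bern q := by
    refine ext_of_generate_finite _ pi_eq_generateFrom_false ?_ ?_ (by simp)
    · rintro A ⟨s, rfl⟩ B ⟨t, rfl⟩ -
      refine ⟨s ∪ t, ?_⟩
      ext ω
      simp only [Set.mem_inter_iff, Set.mem_ofPred_eq, Finset.mem_union]
      constructor
      · rintro ⟨h1, h2⟩ i (hi | hi)
        exacts [h1 i hi, h2 i hi]
      · intro h
        exact ⟨fun i hi => h i (Or.inl hi), fun i hi => h i (Or.inr hi)⟩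
    · rintro B ⟨s, rfl⟩
      rw [Measure.restrict_apply (measurableSet_cyl s _), Set.inter_comm]
      refine bern_indep q (U := {i | i ∉ s}) (V := s) ?_ (h s) ?_ hA (measurableSet_cyl s _)
      · rw [Set.disjoint_left]; exact fun i h1 h2 => h1 h2
      · intro ω ω' hω h1 i hi
        rw [← hω i hi]; exact h1 i hi
  have h1 := congrArg (fun μ => μ A) key
  simp only [Measure.restrict_apply hA, Set.inter_self, Measure.smul_apply, smul_eq_mul] at h1
  by_cases h0 : bern q A = 0
  · exact Or.inl h0
  · right
    have h2 := (ENNReal.mul_right_inj h0 (measure_ne_top _ _) (b := 1) (c := bern q A)).1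
      (by rw [mul_one]; exact h1)
    exact h2.symm

theorem Dev_of_infinite {ω : Sym2 (ZVec d) → Bool} {x : ZVec d}
    (h : InInfCluster d (fun e => ω e.pair) x) {m n : ℕ} (hx : x ∈ Bx m (0 : ZVec d)) (hmn : m ≤ n) :
    ω ∈ Dev d m n := by
  obtain ⟨y, hy, hyn⟩ := h.exists_notMem_finset (Bx n 0)
  have hc := chemDist_ne_top hy
  have hc' : Cn (Op ω) Set.univ x y :=
    hc.mono_in le_rfl fun a _ b _ hab => (edgeOpen_pair ω a b).1 hab
  obtain ⟨a, b, h1, h2, h3, h4⟩ := hc'.first_exit (S := Bs n 0)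
    (Bx_mono (by exact_mod_cast hmn) _ hx) hyn
  refine ⟨x, hx, a, ?_, by simpa using h1⟩
  simpa using h3.1.boundary h1.right_mem.2 h2

/-- Comparison of a set of configurations with an event depending only on the open edges. -/
theorem IsBernoulli.le_of {p : unitInterval} {μ : Measure (Config d)} (h : IsBernoulli d p μ)
    {E : Set (Config d)} {A : Set (Sym2 (ZVec d) → Bool)} (mA : MeasurableSet A)
    (hA : ∀ ω ω', Op ω = Op ω' → ω ∈ A → ω' ∈ A)
    (hE : ∀ ω : Sym2 (ZVec d) → Bool, (fun e : EdgeD d => ω e.pair) ∈ E → ω ∈ A) :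
    μ E ≤ (bern fun _ : Sym2 (ZVec d) => p) A := by
  have hm : Measurable (fun (ω : Sym2 (ZVec d) → Bool) (e : EdgeD d) => ω e.pair) :=
    measurable_pi_lambda _ fun e => measurable_pi_apply _
  set j : Config d → Sym2 (ZVec d) → Bool := fun ω e =>
    if h : ∃ e' : EdgeD d, e'.pair = e then ω h.choose else false with hj
  have mj : Measurable j := by
    refine measurable_pi_lambda _ fun e => ?_
    by_cases h : ∃ e' : EdgeD d, e'.pair = e
    · simpa [hj, h] using measurable_pi_apply _
    · simp [hj, h]
  have hje : ∀ ω : Config d, (fun e : EdgeD d => j ω e.pair) = ω := by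
    intro ω
    ext e
    have h : ∃ e' : EdgeD d, e'.pair = e.pair := ⟨e, rfl⟩
    have h2 := EdgeD.pair_injective h.choose_spec
    simp only [hj, dif_pos h]
    rw [h2]
  have hjo : ∀ ω : Sym2 (ZVec d) → Bool, Op (j fun e => ω e.pair) = Op ω := by
    intro ω
    ext a b
    rw [← edgeOpen_pair, hje fun e => ω e.pair, edgeOpen_pair]
  refine (measure_mono (t := j ⁻¹' A) fun ω hω => hE _ (by rwa [hje ω])).trans ?_
  rw [h.eq_map, Measure.map_apply hm (mj mA)]
  exact measure_mono fun ω hω => hA _ _ (hjo ω) hω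

theorem exists_Dev_prob {p0 : unitInterval} (hp : pc d < p0) {η : ℝ} (hη : 0 < η) :
    ∃ m : ℕ, ∀ n, m ≤ n → 1 - η ≤ (bern fun _ : Sym2 (ZVec d) => p0).real (Dev d m n) := by
  set P := bern fun _ : Sym2 (ZVec d) => p0 with hP
  set F : ℕ → Set (Sym2 (ZVec d) → Bool) := fun m => ⋂ n, ⋂ (_ : m ≤ n), Dev d m n with hF
  have mF : ∀ m, MeasurableSet (F m) := fun m =>
    MeasurableSet.iInter fun n => MeasurableSet.iInter fun _ => measurable_Dev m n
  have Fmono : Monotone F := by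
    intro m m' hm ω hω
    simp only [hF, Set.mem_iInter] at *
    exact fun n hn => Dev_mono hm (hω n (hm.trans hn))
  set A := ⋃ m, F m with hA
  have mA : MeasurableSet A := MeasurableSet.iUnion mF
  have hpos : P A ≠ 0 := by
    intro h0
    have hmem : (p0 : ℝ) ∈ {p : ℝ | 0 ≤ p ∧ p ≤ 1 ∧ ∀ μ : Measure (Config d), IsBernoulli d p μ →
        μ {ω | ∃ x, InInfCluster d ω x} = 0} := by
      refine ⟨p0.2.1, p0.2.2, fun μ hμ => ?_⟩
      refine le_antisymm ((hμ.le_of (A := A) mA ?_ ?_).trans_eq h0) zero_le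
      · intro ω ω' h hω
        simpa only [hA, hF, Set.mem_iUnion, Set.mem_iInter, Dev, Set.mem_ofPred_eq, h] using hω
      · rintro ω ⟨x, hx⟩
        simp only [hA, Set.mem_iUnion, hF, Set.mem_iInter]
        refine ⟨Finset.univ.sup fun i => (x i).natAbs, fun n hn => Dev_of_infinite hx ?_ hn⟩
        rw [mem_Bx]
        intro i
        have := Finset.le_sup (f := fun i => (x i).natAbs) (Finset.mem_univ i)
        simp only [Pi.zero_apply, sub_zero]
        rw [Int.abs_eq_natAbs]
        exact_mod_cast this
    have : (p0 : ℝ) ≤ pc d := le_csSup ⟨1, fun x hx => hx.2.1⟩ hmem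
    linarith
  have hone : P A = 1 := by
    refine (bern_zero_one _ mA fun s => ?_).resolve_left hpos
    obtain ⟨k, hk⟩ : ∃ k : ℕ, ∀ e ∈ s, e ∈ inner (Bs k (0 : ZVec d)) := by
      refine ⟨s.sup fun e => Sym2.lift ⟨fun a b => (Finset.univ.sup fun i => (a i).natAbs) ⊔
        Finset.univ.sup fun i => (b i).natAbs, fun a b => sup_comm _ _⟩ e, fun e he => ?_⟩
      have h1 := Finset.le_sup (f := fun e => Sym2.lift ⟨fun a b : ZVec d =>
        (Finset.univ.sup fun i => (a i).natAbs) ⊔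
        Finset.univ.sup fun i => (b i).natAbs, fun a b => sup_comm _ _⟩ e) he
      induction e using Sym2.ind with
      | _ a b =>
        simp only [Sym2.lift_mk] at h1
        rw [mem_inner]
        constructor <;> rw [Finset.mem_coe, mem_Bx] <;> intro i <;>
          simp only [Pi.zero_apply, sub_zero]
        · have := Finset.le_sup (f := fun i => (a i).natAbs) (Finset.mem_univ i)
          have := (this.trans le_sup_left).trans h1
          rw [Int.abs_eq_natAbs]
          exact_mod_cast this
        · have := Finset.le_sup (f := fun i => (b i).natAbs) (Finset.mem_univ i)
          have := (this.trans le_sup_right).trans h1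
          rw [Int.abs_eq_natAbs]
          exact_mod_cast this
    have e : A = ⋃ m, ⋂ n, ⋂ (_ : k + m < n), Dev' d (k + m) n := by
      ext ω
      simp only [hA, hF, Set.mem_iUnion, Set.mem_iInter]
      constructor
      · rintro ⟨m, hm⟩
        exact ⟨m, fun n hn => Dev_subset_Dev' hn (Dev_mono (by omega) (hm n (by omega)))⟩
      · rintro ⟨m, hm⟩
        exact ⟨k + m + 1, fun n hn => Dev'_subset_Dev (hm n (by omega))⟩
    rw [e]
    refine Dep.iUnion fun m => Dep.iInter fun n => Dep.iInter fun _ => ?_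
    refine (dep_Dev' (k + m) n).mono ?_
    intro e he hes
    have h1 := hk e hes
    induction e using Sym2.ind with
    | _ a b =>
      refine (mem_inner.1 he).1.2 (Bx_mono ?_ _ (mem_inner.1 h1).1)
      push_cast; omega
  have hlim : Filter.Tendsto (fun m => P (F m)) Filter.atTop (nhds (P A)) :=
    tendsto_measure_iUnion_atTop Fmono
  rw [hone] at hlim
  have hlim' := (ENNReal.tendsto_toReal ENNReal.one_ne_top).comp hlim
  have := hlim'.eventually (lt_mem_nhds (show 1 - η < (1 : ENNReal).toReal by simpa using hη))
  obtain ⟨m, hm⟩ := this.exists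
  refine ⟨m, fun n hn => hm.le.trans ?_⟩
  refine measureReal_mono ?_
  exact Set.iInter₂_subset n hn

end

/-! ### Many boundary points are connected to the seed -/

section
variable {I : Type}

theorem bern_harris_list_compl {κ : Type} (q : I → unitInterval) {U : Set I} (hU : U.Finite)
    (s : Finset κ) {A : κ → Set (I → Bool)} (hA : ∀ k ∈ s, Dep U (A k)) (iA : ∀ k ∈ s, Incr (A k)) :
    ∏ k ∈ s, (bern q).real (A k)ᶜ ≤ (bern q).real (⋃ k ∈ s, A k)ᶜ := by
  suffices h : Dep U (⋃ k ∈ s, A k) ∧ Incr (⋃ k ∈ s, A k) ∧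
    ∏ k ∈ s, (bern q).real (A k)ᶜ ≤ (bern q).real (⋃ k ∈ s, A k)ᶜ from h.2.2
  induction s using Finset.induction_on with
  | empty => exact ⟨by simp [Dep], by simp [Incr], by simp⟩
  | insert a s ha ih =>
    obtain ⟨h1, h2, h3⟩ := ih (fun k hk => hA k (Finset.mem_insert_of_mem hk))
      (fun k hk => iA k (Finset.mem_insert_of_mem hk))
    have e : (⋃ k ∈ insert a s, A k) = A a ∪ ⋃ k ∈ s, A k := by
      simp [Set.iUnion_iUnion_eq_or_left]
    rw [e, Finset.prod_insert ha]
    have ha1 := hA a (Finset.mem_insert_self _ _)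
    have ha2 := iA a (Finset.mem_insert_self _ _)
    refine ⟨ha1.union h1, fun ω ω' hω hm => hm.imp (ha2 _ _ hω) (h2 _ _ hω), ?_⟩
    refine (mul_le_mul_of_nonneg_left h3 measureReal_nonneg).trans ?_
    set B := ⋃ k ∈ s, A k
    have mA := ha1.measurable_of_finite hU
    have mB := h1.measurable_of_finite hU
    have := bern_harris q hU ha1 h1 ha2 h2
    have hu := measureReal_union_add_inter (μ := bern q) (s := A a) mB (measure_ne_top _ _) (measure_ne_top _ _)
    rw [probReal_compl_eq_one_sub mA, probReal_compl_eq_one_sub mB,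
      probReal_compl_eq_one_sub (mA.union mB)]
    nlinarith

theorem partition_lower {Ω κ : Type} [MeasurableSpace Ω] (P : Measure Ω) [IsProbabilityMeasure P]
    (t : Finset κ) {E F : κ → Set Ω} {c : ℝ} (h : ∀ k ∈ t, c * P.real (E k) ≤ P.real (E k ∩ F k))
    (hd : (t : Set κ).PairwiseDisjoint E) (mE : ∀ k ∈ t, MeasurableSet (E k))
    (mF : ∀ k ∈ t, MeasurableSet (F k)) :
    c * P.real (⋃ k ∈ t, E k) ≤ P.real (⋃ k ∈ t, E k ∩ F k) := by
  rw [measureReal_biUnion_finset hd mE, measureReal_biUnion_finset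
    (fun k hk l hl hkl => (hd hk hl hkl).mono Set.inter_subset_left Set.inter_subset_left)
    fun k hk => (mE k hk).inter (mF k hk), Finset.mul_sum]
  exact Finset.sum_le_sum h

theorem partition_upper {Ω κ : Type} [MeasurableSpace Ω] (P : Measure Ω) [IsProbabilityMeasure P]
    (t : Finset κ) {E F : κ → Set Ω} {c : ℝ} (hc : 0 ≤ c)
    (h : ∀ k ∈ t, P.real (E k ∩ F k) ≤ c * P.real (E k))
    (hd : (t : Set κ).PairwiseDisjoint E) (mE : ∀ k ∈ t, MeasurableSet (E k)) :
    P.real (⋃ k ∈ t, E k ∩ F k) ≤ c := by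
  refine (measureReal_biUnion_finset_le t _).trans ?_
  refine (Finset.sum_le_sum h).trans ?_
  rw [← Finset.mul_sum, ← measureReal_biUnion_finset hd mE]
  exact mul_le_of_le_one_right hc measureReal_le_one

theorem bern_closed_real (q : I → unitInterval) (s : Finset I) :
    (bern q).real {ω | ∀ i ∈ s, ω i = false} = ∏ i ∈ s, (1 - (q i : ℝ)) := by
  rw [Measure.real, bern_cyl_false, ENNReal.toReal_prod]
  refine Finset.prod_congr rfl fun i _ => ENNReal.toReal_ofReal ?_
  linarith [(q i).2.2]

theorem dep_closed (s : Set I) : Dep s {ω | ∀ i ∈ s, ω i = false} := by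
  intro ω ω' h h1 i hi
  rw [← h i hi]; exact h1 i hi

end

section
variable {d : ℕ}

theorem card_neighbors (y : ZVec d) : ∃ s : Finset (ZVec d), s.card ≤ 2 * d ∧ ∀ b, Adj d y b → b ∈ s := by
  refine ⟨(Finset.univ : Finset (Fin d × Bool)).image fun q =>
    Function.update y q.1 (y q.1 + if q.2 then 1 else -1), ?_, ?_⟩
  · refine Finset.card_image_le.trans ?_
    simp [mul_comm]
  · intro b hb
    obtain ⟨i, hi, hj⟩ := adj_iff.1 hb
    rw [Finset.mem_image]
    rcases hi with hi | hi
    · refine ⟨(i, true), Finset.mem_univ _, ?_⟩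
      ext j
      by_cases h : j = i
      · subst h; simp [hi]
      · simp [h, hj j h]
    · refine ⟨(i, false), Finset.mem_univ _, ?_⟩
      ext j
      by_cases h : j = i
      · subst h; simp [hi, sub_eq_add_neg]
      · simp [h, hj j h]

/-- Boundary points of the ball of radius `n` around `x` joined to the ball of radius `m`. -/
def Vset (m n : ℕ) (ω : Sym2 (ZVec d) → Bool) : Finset (ZVec d) :=
  (Bx n 0).filter fun y => (∃ i, |y i| = n) ∧ ∃ a ∈ Bx m 0, Cn (Op ω) (Bs n 0) a y

theorem mem_Dev_iff {m n : ℕ} {ω : Sym2 (ZVec d) → Bool} :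
    ω ∈ Dev d m n ↔ (Vset m n ω).Nonempty := by
  constructor
  · rintro ⟨a, ha, y, hy, hc⟩
    exact ⟨y, Finset.mem_filter.2 ⟨hc.right_mem, hy, a, ha, hc⟩⟩
  · rintro ⟨y, hy⟩
    obtain ⟨-, h1, a, ha, hc⟩ := Finset.mem_filter.1 hy
    exact ⟨a, ha, y, h1, hc⟩

theorem Vset_congr {m n : ℕ} {ω ω' : Sym2 (ZVec d) → Bool}
    (h : ∀ e ∈ inner (Bs n (0 : ZVec d)), ω e = ω' e) : Vset m n ω = Vset m n ω' := by
  ext y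
  simp only [Vset, Finset.mem_filter]
  have := fun a => (dep_Cn (Bs n 0) a y).iff h
  simp only [Set.mem_ofPred_eq] at this
  simp only [this]

/-- A path leaving the ball exits through a boundary point joined to the seed. -/
theorem exit_Vset {m n : ℕ} (hmn : m ≤ n) {ω : Sym2 (ZVec d) → Bool} (h : ω ∈ Dev d m (n + 1)) :
    ∃ y ∈ Vset m n ω, ∃ b, b ∉ Bx n 0 ∧ Op ω y b := by
  obtain ⟨a, ha, y, ⟨i, hi⟩, hc⟩ := h
  have hy : y ∉ Bs n 0 := by
    intro hy
    have := mem_Bs.1 hy i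
    simp only [Pi.zero_apply, sub_zero, hi] at this
    push_cast at this
    omega
  obtain ⟨a', b, h1, h2, h3, h4⟩ := hc.first_exit (S := Bs n 0) (Bx_mono (by exact_mod_cast hmn) _ ha) hy
  refine ⟨a', Finset.mem_filter.2 ⟨h1.right_mem.2, ?_, a, ha, h1.mono Set.inter_subset_right⟩, b,
    h2, h3⟩
  simpa using h3.1.boundary h1.right_mem.2 h2

theorem Dev_succ_subset {m n : ℕ} (hmn : m ≤ n) : Dev d m (n + 1) ⊆ Dev d m n := by
  intro ω h
  obtain ⟨y, hy, -⟩ := exit_Vset hmn h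
  exact mem_Dev_iff.2 ⟨y, hy⟩

theorem prob_Vset_small_le (p : unitInterval) (hp : (p : ℝ) < 1) {m n : ℕ} (hmn : m ≤ n) (M : ℕ) :
    (1 - (p : ℝ)) ^ (2 * d * M) * (bern fun _ : Sym2 (ZVec d) => p).real
      {ω | (Vset m n ω).Nonempty ∧ (Vset m n ω).card ≤ M} ≤
      (bern fun _ : Sym2 (ZVec d) => p).real (Dev d m n) -
      (bern fun _ : Sym2 (ZVec d) => p).real (Dev d m (n + 1)) := by
  set P := bern fun _ : Sym2 (ZVec d) => p with hP
  choose nb hnb1 hnb2 using card_neighbors (d := d)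
  set out : Finset (ZVec d) → Finset (Sym2 (ZVec d)) := fun Y =>
    Y.biUnion fun y => ((nb y).filter fun b => b ∉ Bx n 0).image fun b => s(y, b) with hout
  have hcard : ∀ Y, (out Y).card ≤ Y.card * (2 * d) := fun Y =>
    Finset.card_biUnion_le_card_mul _ _ _ fun y _ =>
      Finset.card_image_le.trans ((Finset.card_filter_le _ _).trans (hnb1 y))
  set t := (Bx n (0 : ZVec d)).powerset.filter fun Y => Y.Nonempty ∧ Y.card ≤ M with ht
  have hdepE : ∀ Y, Dep (inner (Bs n (0 : ZVec d))) {ω | Vset m n ω = Y} := by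
    intro Y ω ω' h h1
    rw [Set.mem_ofPred_eq, ← Vset_congr h]
    exact h1
  have mE : ∀ Y, MeasurableSet {ω : Sym2 (ZVec d) → Bool | Vset m n ω = Y} := fun Y =>
    (hdepE Y).measurable_of_finite (inner_finite (Finset.finite_toSet _))
  have h1p : 0 ≤ 1 - (p : ℝ) := by linarith
  have key := partition_lower P t (E := fun Y => {ω | Vset m n ω = Y})
    (F := fun Y => {ω | ∀ e ∈ out Y, ω e = false}) (c := (1 - (p : ℝ)) ^ (2 * d * M)) ?_ ?_ ?_ ?_
  · have e1 : (⋃ Y ∈ t, {ω | Vset m n ω = Y}) =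
        {ω : Sym2 (ZVec d) → Bool | (Vset m n ω).Nonempty ∧ (Vset m n ω).card ≤ M} := by
      ext ω
      simp only [Set.mem_iUnion, Set.mem_ofPred_eq, exists_prop, exists_eq_right', ht,
        Finset.mem_filter, Finset.mem_powerset]
      exact and_iff_right (Finset.filter_subset _ _)
    rw [e1] at key
    refine key.trans ?_
    rw [← measureReal_sdiff (Dev_succ_subset hmn) (measurable_Dev m (n + 1))]
    refine measureReal_mono ?_
    intro ω hω
    simp only [Set.mem_iUnion, exists_prop] at hω
    obtain ⟨Y, hY, h1, h2⟩ := hω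
    rw [Set.mem_ofPred_eq] at h1
    rw [ht, Finset.mem_filter] at hY
    refine ⟨mem_Dev_iff.2 (h1 ▸ hY.2.1), fun hD => ?_⟩
    obtain ⟨y, hy, b, hb, ho⟩ := exit_Vset hmn hD
    have := h2 s(y, b) (Finset.mem_biUnion.2 ⟨y, h1 ▸ hy, Finset.mem_image.2
      ⟨b, Finset.mem_filter.2 ⟨hnb2 _ _ ho.1, hb⟩, rfl⟩⟩)
    rw [ho.2] at this
    exact absurd this (by simp)
  · intro Y hY
    rw [ht, Finset.mem_filter] at hY
    rw [hP, bern_indep_real _ (U := inner (Bs n (0 : ZVec d))) (V := out Y) ?_ (hdepE Y)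
      (show Dep (out Y : Set (Sym2 (ZVec d))) {ω | ∀ e ∈ out Y, ω e = false} by
        simpa using dep_closed (out Y : Set (Sym2 (ZVec d)))) (mE Y) (measurableSet_cyl _ _),
      mul_comm]
    · refine mul_le_mul_of_nonneg_left ?_ measureReal_nonneg
      have := bern_closed_real (fun _ : Sym2 (ZVec d) => p) (out Y)
      rw [this, Finset.prod_const]
      refine pow_le_pow_of_le_one h1p (by linarith [p.2.1]) ((hcard Y).trans ?_)
      rw [mul_comm]
      exact Nat.mul_le_mul_left _ hY.2.2
    · rw [Set.disjoint_left]
      intro e he he'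
      rw [Finset.mem_coe, Finset.mem_biUnion] at he'
      obtain ⟨y, -, he'⟩ := he'
      rw [Finset.mem_image] at he'
      obtain ⟨b, hb, rfl⟩ := he'
      exact (Finset.mem_filter.1 hb).2 (mem_inner.1 he).2
  · intro Y _ Y' _ hne
    refine Set.disjoint_left.2 fun ω h h' => hne ?_
    rw [← (show Vset m n ω = Y from h)]; exact h'
  · exact fun Y _ => mE Y
  · exact fun Y _ => measurableSet_cyl _ _

theorem tendsto_prob_Vset_small (p : unitInterval) (hp : (p : ℝ) < 1) (m M : ℕ) {η : ℝ}
    (hη : 0 < η) : ∃ n0, ∀ n, n0 ≤ n → (bern fun _ : Sym2 (ZVec d) => p).real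
      {ω | (Vset m n ω).Nonempty ∧ (Vset m n ω).card ≤ M} ≤ η := by
  set P := bern fun _ : Sym2 (ZVec d) => p with hP
  set u : ℕ → ℝ := fun k => P.real (Dev d m (m + k)) with hu
  have hanti : Antitone u := antitone_nat_of_succ_le fun k =>
    measureReal_mono (Dev_succ_subset (Nat.le_add_right m k))
  have hlim := tendsto_atTop_ciInf hanti ⟨0, by rintro _ ⟨k, rfl⟩; exact measureReal_nonneg⟩
  have hlim2 := hlim.sub (hlim.comp (Filter.tendsto_add_atTop_nat 1))
  rw [sub_self] at hlim2
  set c := (1 - (p : ℝ)) ^ (2 * d * M) with hc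
  have hcpos : 0 < c := pow_pos (by linarith) _
  obtain ⟨k0, hk0⟩ := Filter.eventually_atTop.1
    (hlim2.eventually (gt_mem_nhds (show (0 : ℝ) < c * η by positivity)))
  refine ⟨m + k0, fun n hn => ?_⟩
  obtain ⟨k, rfl⟩ : ∃ k, n = m + k := ⟨n - m, by omega⟩
  have h1 := hk0 k (by omega)
  have h2 := prob_Vset_small_le (d := d) p hp (m := m) (n := m + k) (by omega) M
  simp only [Function.comp, hu] at h1
  have h3 := h2.trans_lt h1
  exact (lt_of_mul_lt_mul_left h3 hcpos.le).le

/-! ### Faces -/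

/-- An orthant of a face of the ball of radius `n` around `x`. -/
def Fc (n : ℕ) (x : ZVec d) (i : Fin d) (s : Fin d → ℤˣ) : Finset (ZVec d) :=
  (Bx n x).filter fun y => y i - x i = s i * n ∧ ∀ j, 0 ≤ (s j : ℤ) * (y j - x j)

/-- Points of an orthant of a face joined to the seed at the centre. -/
def VT (m n : ℕ) (x : ZVec d) (i : Fin d) (s : Fin d → ℤˣ) (ω : Sym2 (ZVec d) → Bool) :
    Finset (ZVec d) :=
  (Fc n x i s).filter fun y => ∃ a ∈ Bx m x, Cn (Op ω) (Bs n x) a y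

theorem VT_congr {m n : ℕ} {x : ZVec d} {i : Fin d} {s : Fin d → ℤˣ} {ω ω' : Sym2 (ZVec d) → Bool}
    (h : ∀ e ∈ inner (Bs n x), ω e = ω' e) : VT m n x i s ω = VT m n x i s ω' := by
  ext y
  simp only [VT, Finset.mem_filter]
  have := fun a => (dep_Cn (Bs n x) a y).iff h
  simp only [Set.mem_ofPred_eq] at this
  simp only [this]

theorem VT_mono {m n : ℕ} {x : ZVec d} {i : Fin d} {s : Fin d → ℤˣ} {ω ω' : Sym2 (ZVec d) → Bool}
    (h : ω ≤ ω') : VT m n x i s ω ⊆ VT m n x i s ω' := by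
  intro y
  simp only [VT, Finset.mem_filter]
  rintro ⟨h1, a, ha, hc⟩
  exact ⟨h1, a, ha, incr_Cn _ _ _ ω ω' h hc⟩

theorem dep_VT {m n M : ℕ} {x : ZVec d} {i : Fin d} {s : Fin d → ℤˣ} :
    Dep (inner (Bs n x)) {ω | M < (VT m n x i s ω).card} := by
  intro ω ω' h h1
  rw [Set.mem_ofPred_eq, ← VT_congr h]
  exact h1

theorem prob_VT_eq (p : unitInterval) (m n M : ℕ) (x : ZVec d) (i i0 : Fin d) (s : Fin d → ℤˣ) :
    (bern fun _ : Sym2 (ZVec d) => p).real {ω | M < (VT m n x i s ω).card} =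
    (bern fun _ : Sym2 (ZVec d) => p).real {ω | M < (VT m n 0 i0 1 ω).card} := by
  set σ := Equiv.swap i0 i
  set τ : ZVec d ≃ ZVec d := (Equiv.subRight x).trans (signedPerm σ fun j => s (σ j)) with hτ
  have hτa : ∀ y j, τ y j = s (σ j) * (y (σ j) - x (σ j)) := fun y j => rfl
  have hadj : ∀ a b, Adj d (τ a) (τ b) ↔ Adj d a b := by
    intro a b
    rw [hτ, Equiv.trans_apply, Equiv.trans_apply, adj_signedPerm, Equiv.subRight_apply,
      Equiv.subRight_apply, Adj, Adj, sub_sub_sub_cancel_right]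
  have habs : ∀ y j, |τ y j| = |y (σ j) - x (σ j)| := by
    intro y j
    rcases Int.units_eq_one_or (s (σ j)) with h | h <;> rw [hτa, abs_mul, h] <;> simp
  have hBx : ∀ (r : ℕ) y, τ y ∈ Bx r (0 : ZVec d) ↔ y ∈ Bx r x := by
    intro r y
    simp only [mem_Bx, Pi.zero_apply, sub_zero, habs]
    exact ⟨fun h j => by simpa using h (σ.symm j), fun h j => h _⟩
  have hF : ∀ y, τ y ∈ Fc n 0 i0 1 ↔ y ∈ Fc n x i s := by
    intro y
    simp only [Fc, Finset.mem_filter, hBx, Pi.zero_apply, sub_zero, hτa, Pi.one_apply,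
      Units.val_one, one_mul]
    have e : σ i0 = i := Equiv.swap_apply_left _ _
    rw [e]
    refine and_congr_right fun _ => and_congr ?_ ?_
    · rcases Int.units_eq_one_or (s i) with h | h <;> rw [h] <;> push_cast <;>
        constructor <;> intro h <;> linarith
    · exact ⟨fun h j => by simpa using h (σ.symm j), fun h j => h _⟩
  rw [← bern_aut p τ ((dep_VT (m := m) (n := n) (M := M) (x := x) (i := i)
    (s := s)).measurable_of_finite (inner_finite (Finset.finite_toSet _)))]
  congr 1
  ext ω
  simp only [Set.mem_ofPred_eq]
  have : (VT m n x i s fun e => ω (Sym2.map τ e)).map τ.toEmbedding = VT m n 0 i0 1 ω := by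
    ext y
    simp only [Finset.mem_map_equiv, VT, Finset.mem_filter]
    rw [← hF, Equiv.apply_symm_apply]
    refine and_congr_right fun _ => ?_
    have hc : ∀ a, Cn (Op fun e => ω (Sym2.map τ e)) (Bs n x) a (τ.symm y) ↔
        Cn (Op ω) (Bs n 0) (τ a) y := by
      intro a
      rw [Cn_aut (R' := Bs n 0) hadj (fun a => by simp only [Bs, Finset.mem_coe, hBx]),
        Equiv.apply_symm_apply]
    constructor
    · rintro ⟨a, ha, h⟩
      exact ⟨τ a, (hBx _ _).2 ha, (hc a).1 h⟩
    · rintro ⟨a, ha, h⟩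
      refine ⟨τ.symm a, (hBx _ _).1 (by simpa using ha), (hc _).2 (by simpa using h)⟩
  rw [← this, Finset.card_map]

theorem exists_Fc_of_mem {m n : ℕ} {ω : Sym2 (ZVec d) → Bool} {y : ZVec d} (hy : y ∈ Vset m n ω) :
    ∃ q : Fin d × (Fin d → ℤˣ), y ∈ VT m n 0 q.1 q.2 ω := by
  obtain ⟨h1, ⟨i, hi⟩, h2⟩ := Finset.mem_filter.1 hy
  have hs : ∀ j, ∃ u : ℤˣ, 0 ≤ (u : ℤ) * y j ∧ (u : ℤ) * y j = |y j| := by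
    intro j
    rcases abs_cases (y j) with ⟨h, h'⟩ | ⟨h, h'⟩
    · exact ⟨1, by simpa using h', by simp [h]⟩
    · exact ⟨-1, by simp; omega, by simp [h]⟩
  choose s hs hs' using hs
  refine ⟨(i, s), Finset.mem_filter.2 ⟨Finset.mem_filter.2 ⟨h1, ?_, ?_⟩, h2⟩⟩
  · have := hs' i
    rw [hi] at this
    rw [← this, ← mul_assoc]
    simp
  · simpa using hs

/-- With high probability many points of a given orthant of a face are joined to the seed. -/
theorem exists_VT_prob {p0 : unitInterval} (hd : 0 < d) (hp : pc d < p0) (hp1 : (p0 : ℝ) < 1) {η : ℝ}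
    (hη : 0 < η) : ∃ m, ∀ M, ∃ n0, ∀ n, n0 ≤ n → ∀ x i s,
      (bern fun _ : Sym2 (ZVec d) => p0).real {ω | (VT m n x i s ω).card ≤ M} ≤ η := by
  set P := bern fun _ : Sym2 (ZVec d) => p0 with hP
  set D := Fintype.card (Fin d × (Fin d → ℤˣ)) with hD
  obtain ⟨m, hm⟩ := exists_Dev_prob (d := d) hp (η := η ^ D / 2) (by positivity)
  refine ⟨m, fun M => ?_⟩
  obtain ⟨n0, hn0⟩ := tendsto_prob_Vset_small (d := d) p0 hp1 m (D * M) (η := η ^ D / 2)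
    (by positivity)
  refine ⟨max m n0, fun n hn x i s => ?_⟩
  have hn1 := hm n (le_trans (le_max_left _ _) hn)
  have hn2 := hn0 n (le_trans (le_max_right _ _) hn)
  set A : Fin d × (Fin d → ℤˣ) → Set (Sym2 (ZVec d) → Bool) := fun q =>
    {ω | M < (VT m n 0 q.1 q.2 ω).card} with hA
  have hmeas : ∀ x i s, MeasurableSet {ω : Sym2 (ZVec d) → Bool | M < (VT m n x i s ω).card} :=
    fun x i s => dep_VT.measurable_of_finite (inner_finite (Finset.finite_toSet _))
  have hall : ∀ x i s, P.real {ω | (VT m n x i s ω).card ≤ M} =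
      1 - P.real {ω | M < (VT m n 0 ⟨0, hd⟩ 1 ω).card} := by
    intro x i s
    rw [← prob_VT_eq p0 m n M x i ⟨0, hd⟩ s, ← probReal_compl_eq_one_sub (hmeas _ _ _)]
    congr 1
    ext ω
    simp
  have hprod := bern_harris_list_compl (fun _ : Sym2 (ZVec d) => p0) (inner_finite
    (Finset.finite_toSet (Bx n 0))) Finset.univ (A := A) (fun _ _ => dep_VT)
    (fun _ _ ω ω' h h1 => lt_of_lt_of_le h1 (Finset.card_le_card (VT_mono h)))
  have e1 : ∀ q ∈ Finset.univ, P.real (A q)ᶜ = P.real {ω | (VT m n x i s ω).card ≤ M} := by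
    intro q _
    rw [hall x i s, ← hall 0 q.1 q.2]
    congr 1
    ext ω
    simp [hA]
  rw [Finset.prod_congr rfl e1, Finset.prod_const, Finset.card_univ, ← hD] at hprod
  have hsub : (⋃ q ∈ Finset.univ, A q)ᶜ ⊆ (Dev d m n)ᶜ ∪
      {ω | (Vset m n ω).Nonempty ∧ (Vset m n ω).card ≤ D * M} := by
    intro ω hω
    by_cases hV : (Vset m n ω).Nonempty
    · refine Or.inr ⟨hV, ?_⟩
      have hs : Vset m n ω ⊆ Finset.univ.biUnion fun q : Fin d × (Fin d → ℤˣ) =>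
          VT m n 0 q.1 q.2 ω := by
        intro y hy
        obtain ⟨q, hq⟩ := exists_Fc_of_mem hy
        exact Finset.mem_biUnion.2 ⟨q, Finset.mem_univ _, hq⟩
      refine (Finset.card_le_card hs).trans (Finset.card_biUnion_le_card_mul _ _ _ fun q _ => ?_)
      by_contra! h
      exact hω (Set.mem_iUnion₂.2 ⟨q, Finset.mem_univ _, h⟩)
    · exact Or.inl fun h => hV (mem_Dev_iff.1 h)
  have h3 := hprod.trans ((measureReal_mono hsub).trans (measureReal_union_le _ _))
  rw [probReal_compl_eq_one_sub (measurable_Dev m n)] at h3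
  have hD0 : D ≠ 0 := (Fintype.card_pos_iff.2 ⟨(⟨0, hd⟩, 1)⟩).ne'
  exact (pow_le_pow_iff_left₀ measureReal_nonneg hη.le hD0).1 (by linarith)

end

/-! ### Layers of randomness and the renormalisation step -/

section
variable {I : Type}

theorem bern_full_real (q : I → unitInterval) (s : Finset I) :
    (bern q).real {ω | ∀ i ∈ s, ω i = true} = ∏ i ∈ s, (q i : ℝ) := by
  have := bern_cyl q s fun _ => true
  rw [Measure.real, this, ENNReal.toReal_prod]
  refine Finset.prod_congr rfl fun i _ => ?_
  rw [bp_true, ENNReal.toReal_ofReal (q i).2.1]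

theorem dep_full (s : Finset I) : Dep (s : Set I) {ω : I → Bool | ∀ i ∈ s, ω i = true} := by
  intro ω ω' h h1 i hi
  rw [← h i hi]; exact h1 i hi

theorem bern_no_full {κ : Type} (q : I → unitInterval) (ε : unitInterval) (K : ℕ) (Y : Finset κ)
    (s : κ → Finset I) (hs : ∀ y ∈ Y, (s y).card = K) (hq : ∀ y ∈ Y, ∀ i ∈ s y, q i = ε)
    (hd : (Y : Set κ).PairwiseDisjoint s) :
    Dep (⋃ y ∈ Y, (s y : Set I)) {ω : I → Bool | ∀ y ∈ Y, ¬ ∀ i ∈ s y, ω i = true} ∧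
    (bern q).real {ω | ∀ y ∈ Y, ¬ ∀ i ∈ s y, ω i = true} = (1 - (ε : ℝ) ^ K) ^ Y.card := by
  induction Y using Finset.induction_on with
  | empty => exact ⟨by simp [Dep], by simp⟩
  | insert a Y ha ih =>
    obtain ⟨h1, h2⟩ := ih (fun y hy => hs y (Finset.mem_insert_of_mem hy))
      (fun y hy => hq y (Finset.mem_insert_of_mem hy))
      (hd.subset (by simp))
    have e : {ω : I → Bool | ∀ y ∈ insert a Y, ¬ ∀ i ∈ s y, ω i = true} =
        {ω : I → Bool | ∀ i ∈ s a, ω i = true}ᶜ ∩ {ω | ∀ y ∈ Y, ¬ ∀ i ∈ s y, ω i = true} := by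
      ext ω
      simp only [Finset.forall_mem_insert, Set.mem_inter_iff, Set.mem_compl_iff, Set.mem_ofPred_eq]
    have ma := (dep_full (s a)).measurable_of_finite (Finset.finite_toSet _)
    refine ⟨?_, ?_⟩
    · rw [e]
      refine Dep.inter ((dep_full _).compl.mono ?_) (h1.mono ?_)
      · exact Set.subset_biUnion_of_mem (u := fun y => (s y : Set I)) (Finset.mem_insert_self a Y)
      · exact Set.biUnion_subset_biUnion_left fun y hy => Finset.mem_insert_of_mem hy
    · rw [e, bern_indep_real q ?_ (dep_full (s a)).compl h1 ma.compl
        (h1.measurable_of_finite (Y.finite_toSet.biUnion fun _ _ => Finset.finite_toSet _)), h2,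
        probReal_compl_eq_one_sub ma,
        bern_full_real, Finset.prod_congr rfl (fun i hi => congrArg Subtype.val
          (hq a (Finset.mem_insert_self _ _) i hi)), Finset.prod_const,
        hs a (Finset.mem_insert_self _ _), Finset.card_insert_of_notMem ha, pow_succ, mul_comm]
      rw [Set.disjoint_iUnion₂_right]
      intro y hy
      rw [Finset.disjoint_coe]
      exact hd (by simp) (by simp [show y ∈ Y from hy]) fun h => ha (h ▸ hy)

end

section
variable {d : ℕ}

theorem card_Bx (m : ℕ) (x : ZVec d) : (Bx m x).card = (2 * m + 1) ^ d := by
  rw [Bx, Pi.card_Icc]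
  simp only [Int.card_Icc]
  rw [Finset.prod_congr rfl (g := fun _ => 2 * m + 1) (fun i _ => by omega), Finset.prod_const]
  simp

theorem exists_spread (m L : ℕ) (Y : Finset (ZVec d)) (h : L * (2 * m + 1) ^ d < Y.card) :
    ∃ Y' ⊆ Y, L < Y'.card ∧
      ∀ y ∈ Y', ∀ z ∈ Y', y ≠ z → ∀ v, ¬ (v ∈ Bx m y ∧ v ∈ Bx m z) := by
  set f : ZVec d → Fin d → ZMod (2 * m + 1) := fun y i => (y i : ZMod (2 * m + 1))
  obtain ⟨c, -, hc⟩ := Finset.exists_lt_card_fiber_of_mul_lt_card_of_maps_to (s := Y)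
    (t := Finset.univ) (f := f) (n := L) (fun _ _ => Finset.mem_univ _) (by
      rw [Finset.card_univ, Fintype.card_fun, ZMod.card, Fintype.card_fin, mul_comm]; exact h)
  refine ⟨_, Finset.filter_subset _ _, hc, ?_⟩
  intro y hy z hz hne v ⟨hvy, hvz⟩
  rw [Finset.mem_filter] at hy hz
  obtain ⟨i, hi⟩ := Function.ne_iff.1 hne
  have h1 : ((y i : ℤ) : ZMod (2 * m + 1)) = (z i : ℤ) := by
    have := congrFun (hy.2.trans hz.2.symm) i
    exact this
  rw [ZMod.intCast_eq_intCast_iff_dvd_sub] at h1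
  have h2 := abs_le.1 (mem_Bx.1 hvy i)
  have h3 := abs_le.1 (mem_Bx.1 hvz i)
  have h4 : z i - y i = 0 := by
    refine Int.eq_zero_of_abs_lt_dvd h1 ?_
    rw [abs_lt]
    push_cast
    constructor <;> omega
  omega

/-- Colours of the coarse sites. -/
abbrev Col (d : ℕ) := Fin d → ZMod 9

/-- Indices of the layered configuration: a base layer and two layers for each colour. -/
abbrev LI (d : ℕ) := Option (Col d × Bool) × Sym2 (ZVec d)

def lq (p0 ε : unitInterval) : LI d → unitInterval := fun q => if q.1 = none then p0 else ε

/-- One layer of a layered configuration. -/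
def ly (l : Option (Col d × Bool)) (ω : LI d → Bool) : Sym2 (ZVec d) → Bool := fun e => ω (l, e)

def li (l : Option (Col d × Bool)) (U : Set (Sym2 (ZVec d))) : Set (LI d) :=
  {q | q.1 = l ∧ q.2 ∈ U}

theorem li_finite {l : Option (Col d × Bool)} {U : Set (Sym2 (ZVec d))} (hU : U.Finite) :
    (li l U).Finite :=
  (hU.image fun e => (l, e)).subset fun q hq => ⟨q.2, hq.2, by rw [← hq.1]⟩

theorem li_disjoint {l l' : Option (Col d × Bool)} (h : l ≠ l') (U U' : Set (Sym2 (ZVec d))) :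
    Disjoint (li l U) (li l' U') :=
  Set.disjoint_left.2 fun _ h1 h2 => h (h1.1.symm.trans h2.1)

theorem Dep.ly {l : Option (Col d × Bool)} {U : Set (Sym2 (ZVec d))}
    {A : Set (Sym2 (ZVec d) → Bool)} (h : Dep U A) : Dep (li l U) {ω | ly l ω ∈ A} :=
  fun _ _ hω h1 => h _ _ (fun e he => hω (l, e) ⟨rfl, he⟩) h1

theorem lq_base_real (p0 ε : unitInterval) {A : Set (Sym2 (ZVec d) → Bool)}
    (hA : MeasurableSet A) :
    (bern (lq p0 ε)).real {ω : LI d → Bool | ly none ω ∈ A} = (bern fun _ => p0).real A := by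
  have h := bern_map_comp (lq (d := d) p0 ε) (fun e : Sym2 (ZVec d) => (none, e))
    fun a b h => (Prod.ext_iff.1 h).2
  have hm : Measurable (fun (ω : LI d → Bool) (e : Sym2 (ZVec d)) => ω (none, e)) :=
    measurable_pi_lambda _ fun e => measurable_pi_apply _
  have e : (fun e : Sym2 (ZVec d) => lq (d := d) p0 ε (none, e)) = fun _ => p0 := by
    ext e; simp [lq]
  rw [e] at h
  rw [← h, Measure.real, Measure.real, Measure.map_apply hm hA]
  rfl

/-- All edges of the ball of radius `m` around `y` are open. -/
def Seed (m : ℕ) (ω : Sym2 (ZVec d) → Bool) (y : ZVec d) : Prop :=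
  ∀ e ∈ (Bx m y).sym2, ω e = true

/-- Points reached from the set `S` by a fresh edge followed by a base path off `S`. -/
def Dset (S : Finset (ZVec d)) (x : ZVec d) (n : ℕ) (β σ : Sym2 (ZVec d) → Bool) :
    Finset (ZVec d) :=
  (Bx n x).filter fun v => ∃ a b, a ∈ S ∧ a ∈ Bx n x ∧ b ∉ S ∧ Op σ a b ∧
    Cn (Op β) (Bs n x \ S) b v

def Suc (m n : ℕ) (S : Finset (ZVec d)) (x : ZVec d) (i : Fin d) (s : Fin d → ℤˣ)
    (D : Finset (ZVec d)) (τ : Sym2 (ZVec d) → Bool) (y : ZVec d) : Prop :=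
  y ∈ Fc n x i s ∧ Seed m τ y ∧ (y ∈ S ∨ y ∈ D)

theorem prob_no_seed (p0 ε : unitInterval) (m n L : ℕ) (x : ZVec d) (i : Fin d) (s : Fin d → ℤˣ)
    {l : Option (Col d × Bool)} (hl : l ≠ none) :
    (bern (lq p0 ε)).real {ω : LI d → Bool | ∀ y ∈ VT m n x i s (ly none ω), ¬ Seed m (ly l ω) y} ≤
      (bern fun _ : Sym2 (ZVec d) => p0).real
        {ω | (VT m n x i s ω).card ≤ L * (2 * m + 1) ^ d} +
      (1 - (ε : ℝ) ^ (((2 * m + 1) ^ d + 1).choose 2)) ^ L := by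
  set P := bern (lq (d := d) p0 ε) with hP
  set M := L * (2 * m + 1) ^ d with hM
  set K := ((2 * m + 1) ^ d + 1).choose 2 with hK
  have hε0 : 0 ≤ (ε : ℝ) ^ K := pow_nonneg ε.2.1 _
  have hε1 : (ε : ℝ) ^ K ≤ 1 := pow_le_one₀ ε.2.1 ε.2.2
  set t := (Fc n x i s).powerset.filter fun Y => M < Y.card with ht
  have hdep : ∀ Y, Dep (li none (inner (Bs n x))) {ω : LI d → Bool | VT m n x i s (ly none ω) = Y} := by
    intro Y
    refine Dep.ly (A := {ω | VT m n x i s ω = Y}) fun ω ω' h h1 => ?_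
    rw [Set.mem_ofPred_eq, ← VT_congr h]
    exact h1
  have hfin : (li none (inner (Bs n x))).Finite := li_finite (inner_finite (Finset.finite_toSet _))
  have hm0 : MeasurableSet {ω : Sym2 (ZVec d) → Bool | (VT m n x i s ω).card ≤ M} := by
    have : {ω : Sym2 (ZVec d) → Bool | (VT m n x i s ω).card ≤ M} =
      {ω | M < (VT m n x i s ω).card}ᶜ := by ext; simp
    rw [this]
    exact (dep_VT.measurable_of_finite (inner_finite (Finset.finite_toSet _))).compl
  have key := partition_upper P t (E := fun Y => {ω | VT m n x i s (ly none ω) = Y})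
    (F := fun Y => {ω | ∀ y ∈ Y, ¬ Seed m (ly l ω) y}) (c := (1 - (ε : ℝ) ^ K) ^ L)
    (pow_nonneg (by linarith) _) ?_ ?_ fun Y _ => (hdep Y).measurable_of_finite hfin
  · rw [← lq_base_real p0 ε hm0]
    refine (measureReal_mono ?_).trans ((measureReal_union_le _ _).trans (add_le_add le_rfl key))
    intro ω hω
    by_cases h : (VT m n x i s (ly none ω)).card ≤ M
    · exact Or.inl h
    · refine Or.inr (Set.mem_iUnion₂.2 ⟨VT m n x i s (ly none ω), ?_, rfl, hω⟩)
      exact Finset.mem_filter.2 ⟨Finset.mem_powerset.2 (Finset.filter_subset _ _), by omega⟩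
  · intro Y hY
    obtain ⟨Y', hY', hL, hsp⟩ := exists_spread m L Y (Finset.mem_filter.1 hY).2
    set sd : ZVec d → Finset (LI d) := fun y => (Bx m y).sym2.map ⟨fun e => (l, e),
      fun a b h => (Prod.ext_iff.1 h).2⟩ with hsd
    obtain ⟨h1, h2⟩ := bern_no_full (lq (d := d) p0 ε) ε K Y' sd
      (fun y _ => by rw [hsd, Finset.card_map, Finset.card_sym2, card_Bx])
      (fun y _ q hq => by
        obtain ⟨e, he, rfl⟩ := Finset.mem_map.1 hq
        exact if_neg hl)
      (fun y hy z hz hne => by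
        rw [Function.onFun, Finset.disjoint_left]
        intro q hq hq'
        obtain ⟨e, he, rfl⟩ := Finset.mem_map.1 hq
        obtain ⟨e', he', h⟩ := Finset.mem_map.1 hq'
        obtain rfl : e' = e := (Prod.ext_iff.1 h).2
        rw [Finset.mem_sym2_iff] at he he'
        induction e' using Sym2.ind with
        | _ a b => exact hsp y hy z hz hne a ⟨he a (by simp), he' a (by simp)⟩)
    have hsub : {ω : LI d → Bool | VT m n x i s (ly none ω) = Y} ∩
        {ω | ∀ y ∈ Y, ¬ Seed m (ly l ω) y} ⊆ {ω : LI d → Bool | VT m n x i s (ly none ω) = Y} ∩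
        {ω | ∀ y ∈ Y', ¬ ∀ q ∈ sd y, ω q = true} := by
      rintro ω ⟨ha, hb⟩
      refine ⟨ha, fun y hy hc => hb y (hY' hy) fun e he => hc (l, e) ?_⟩
      exact Finset.mem_map.2 ⟨e, he, rfl⟩
    refine (measureReal_mono hsub).trans ?_
    rw [hP, bern_indep_real _ ?_ (hdep Y) h1 ((hdep Y).measurable_of_finite hfin)
      (h1.measurable_of_finite (Y'.finite_toSet.biUnion fun _ _ => Finset.finite_toSet _)), h2,
      mul_comm]
    · refine mul_le_mul_of_nonneg_right ?_ measureReal_nonneg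
      exact pow_le_pow_of_le_one (by linarith) (by linarith) hL.le
    · rw [Set.disjoint_left]
      intro q hq hq'
      obtain ⟨y, -, hy⟩ := Set.mem_iUnion₂.1 hq'
      obtain ⟨e, he, rfl⟩ := Finset.mem_map.1 hy
      exact hl hq.1
  · intro Y _ Y' _ hne
    refine Set.disjoint_left.2 fun ω h h' => hne ?_
    rw [← (show VT m n x i s (ly none ω) = Y from h)]; exact h'

theorem ly_closed (p0 ε : unitInterval) (l : Option (Col d × Bool)) (z : Finset (Sym2 (ZVec d))) :
    Dep (li l z) {ω : LI d → Bool | ∀ e ∈ z, ly l ω e = false} ∧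
    (bern (lq p0 ε)).real {ω : LI d → Bool | ∀ e ∈ z, ly l ω e = false} =
      (1 - ((if l = none then p0 else ε : unitInterval) : ℝ)) ^ z.card := by
  refine ⟨fun ω ω' h h1 e he => ?_, ?_⟩
  · rw [← h1 e he]; exact (h (l, e) ⟨rfl, he⟩).symm
  · have := bern_closed_real (lq (d := d) p0 ε) (z.map ⟨fun e => (l, e),
      fun a b h => (Prod.ext_iff.1 h).2⟩)
    rw [Finset.prod_map] at this
    simp only [Finset.forall_mem_map, lq] at this
    exact this.trans ((Finset.prod_congr rfl fun _ _ => rfl).trans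
      (Finset.prod_const (1 - ((if l = none then p0 else ε : unitInterval) : ℝ))))

theorem prob_no_suc (p0 ε : unitInterval) (hp1 : (p0 : ℝ) < 1) (m n L r : ℕ) (S : Finset (ZVec d))
    (x : ZVec d) (hS : Bx m x ⊆ S) (i : Fin d) (s : Fin d → ℤˣ) (c : Col d) :
    (bern (lq p0 ε)).real {ω : LI d → Bool | ¬ ∃ y, Suc m n S x i s
      (Dset S x n (ly none ω) (ly (some (c, true)) ω)) (ly (some (c, false)) ω) y} ≤
      ((1 - (p0 : ℝ)) ^ r)⁻¹ * ((bern fun _ : Sym2 (ZVec d) => p0).real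
        {ω | (VT m n x i s ω).card ≤ L * (2 * m + 1) ^ d} +
      (1 - (ε : ℝ) ^ (((2 * m + 1) ^ d + 1).choose 2)) ^ L) + (1 - (ε : ℝ)) ^ r := by
  set P := bern (lq (d := d) p0 ε) with hP
  have hε0 : 0 ≤ 1 - (ε : ℝ) := by linarith [ε.2.2]
  set ex : Finset (Sym2 (ZVec d)) := ((Bx n x ×ˢ Bx n x).filter fun q => q.1 ∈ S ∧ q.2 ∉ S).image
    fun q => s(q.1, q.2) with hex
  set Z : (LI d → Bool) → Finset (Sym2 (ZVec d)) := fun ω => ex.filter fun e =>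
    ∃ a b, e = s(a, b) ∧ a ∈ S ∧ a ∈ Bx n x ∧ b ∉ S ∧ Adj d a b ∧ ∃ y ∈ Fc n x i s,
      Seed m (ly (some (c, false)) ω) y ∧ Cn (Op (ly none ω)) (Bs n x \ S) b y with hZ
  set N : (LI d → Bool) → Prop := fun ω => ∀ y ∈ Fc n x i s, Seed m (ly (some (c, false)) ω) y →
    y ∉ S with hN
  set U : Set (LI d) := li none (inner (Bs n x \ S)) ∪ li (some (c, false)) (inner (Bs (n + m) x))
    with hU
  have hUf : U.Finite := (li_finite (inner_finite ((Finset.finite_toSet _).subset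
    Set.sdiff_subset))).union (li_finite (inner_finite (Finset.finite_toSet _)))
  have hdep : ∀ z, Dep U {ω | N ω ∧ Z ω = z} := by
    intro z ω ω' h ⟨h1, h2⟩
    have hs : ∀ y ∈ Fc n x i s, Seed m (ly (some (c, false)) ω) y ↔
        Seed m (ly (some (c, false)) ω') y := by
      intro y hy
      refine forall₂_congr fun e he => ?_
      rw [ly, ly, h (some (c, false), e) (Or.inr ⟨rfl, fun v hv => ?_⟩)]
      have hv' := Finset.mem_sym2_iff.1 he v hv
      refine Bx_subset (fun j => ?_) hv'
      have := mem_Bx.1 (Finset.mem_filter.1 hy).1 j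
      linarith
    have hc : ∀ b y, Cn (Op (ly none ω)) (Bs n x \ S) b y ↔ Cn (Op (ly none ω')) (Bs n x \ S) b y := by
      intro b y
      exact (dep_Cn (Bs n x \ S) b y).iff fun e he => h (none, e) (Or.inl ⟨rfl, he⟩)
    refine ⟨fun y hy hy' => h1 y hy ((hs y hy).2 hy'), ?_⟩
    rw [← h2]
    simp only [hZ]
    refine Finset.filter_congr fun e _ => ?_
    simp only [hc]
    constructor
    · rintro ⟨a, b, q1, q2, q3, q4, q5, y, hy, q6, q7⟩
      exact ⟨a, b, q1, q2, q3, q4, q5, y, hy, (hs y hy).2 q6, q7⟩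
    · rintro ⟨a, b, q1, q2, q3, q4, q5, y, hy, q6, q7⟩
      exact ⟨a, b, q1, q2, q3, q4, q5, y, hy, (hs y hy).1 q6, q7⟩
  have mE : ∀ z, MeasurableSet {ω | N ω ∧ Z ω = z} := fun z => (hdep z).measurable_of_finite hUf
  have hdisj : ∀ t : Finset (Finset (Sym2 (ZVec d))),
      (t : Set (Finset (Sym2 (ZVec d)))).PairwiseDisjoint fun z => {ω | N ω ∧ Z ω = z} := by
    intro t z _ z' _ hne
    refine Set.disjoint_left.2 fun ω h h' => hne ?_
    rw [← h.2]; exact h'.2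
  have mF : ∀ (l : Option (Col d × Bool)) (z : Finset (Sym2 (ZVec d))),
      MeasurableSet {ω : LI d → Bool | ∀ e ∈ z, ly l ω e = false} := fun l z =>
    (ly_closed p0 ε l z).1.measurable_of_finite (li_finite (Finset.finite_toSet _))
  have hlow := partition_lower P (ex.powerset.filter fun z => z.card ≤ r)
    (E := fun z => {ω | N ω ∧ Z ω = z}) (F := fun z => {ω | ∀ e ∈ z, ly none ω e = false})
    (c := (1 - (p0 : ℝ)) ^ r) ?_ (hdisj _) (fun z _ => mE z) (fun z _ => mF _ z)
  · have hup := partition_upper P (ex.powerset.filter fun z => r < z.card)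
      (E := fun z => {ω | N ω ∧ Z ω = z})
      (F := fun z => {ω | ∀ e ∈ z, ly (some (c, true)) ω e = false})
      (c := (1 - (ε : ℝ)) ^ r) (pow_nonneg hε0 _) ?_ (hdisj _) (fun z _ => mE z)
    · have hpr : 0 < (1 - (p0 : ℝ)) ^ r := pow_pos (by linarith) _
      have hG : (1 - (p0 : ℝ)) ^ r * P.real (⋃ z ∈ ex.powerset.filter fun z => z.card ≤ r,
          {ω | N ω ∧ Z ω = z}) ≤ _ := hlow.trans ((measureReal_mono ?_).trans
        (prob_no_seed p0 ε m n L x i s (l := some (c, false)) (by simp)))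
      · rw [← le_inv_mul_iff₀ hpr] at hG
        refine (measureReal_mono ?_).trans ((measureReal_union_le _ _).trans (add_le_add hG hup))
        intro ω hω
        have hNω : N ω := fun y hy hs hyS => hω ⟨y, hy, hs, Or.inl hyS⟩
        have hZω : Z ω ∈ ex.powerset := Finset.mem_powerset.2 (Finset.filter_subset _ _)
        by_cases hr : (Z ω).card ≤ r
        · exact Or.inl (Set.mem_iUnion₂.2 ⟨Z ω, Finset.mem_filter.2 ⟨hZω, hr⟩, hNω, rfl⟩)
        · refine Or.inr (Set.mem_iUnion₂.2 ⟨Z ω, Finset.mem_filter.2 ⟨hZω, by omega⟩, ⟨hNω, rfl⟩,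
            fun e he => ?_⟩)
          obtain ⟨-, a, b, rfl, ha, ha', hb, hab, y, hy, hs, hc⟩ := Finset.mem_filter.1 he
          by_contra ho
          rw [Bool.not_eq_false] at ho
          exact hω ⟨y, hy, hs, Or.inr (Finset.mem_filter.2
            ⟨hc.right_mem.1, a, b, ha, ha', hb, ⟨hab, ho⟩, hc⟩)⟩
      · intro ω hω y hy hs
        obtain ⟨z, hz, ⟨hNω, hZω⟩, hcl⟩ := Set.mem_iUnion₂.1 hω
        obtain ⟨hyF, a, ha, hc⟩ := Finset.mem_filter.1 hy
        obtain ⟨a', b, h1, h2, h3, h4, h5⟩ := hc.last_exit (S := (S : Set (ZVec d))) (hS ha)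
          (hNω y hyF hs)
        have hmem : s(a', b) ∈ Z ω := by
          refine Finset.mem_filter.2 ⟨Finset.mem_image.2 ⟨(a', b), Finset.mem_filter.2
            ⟨Finset.mem_product.2 ⟨h1.right_mem, h5.1.1⟩, h2, h3⟩, rfl⟩, a', b, rfl, h2,
            h1.right_mem, h3, h4.1, y, hyF, hs, h5⟩
        have := hcl _ (hZω ▸ hmem)
        rw [h4.2] at this
        exact absurd this (by simp)
    · intro z hz
      rw [hP, bern_indep_real _ ?_ (hdep z) (ly_closed p0 ε _ z).1 (mE z) (mF _ z),
        (ly_closed p0 ε _ z).2, mul_comm]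
      · refine mul_le_mul_of_nonneg_right ?_ measureReal_nonneg
        exact pow_le_pow_of_le_one hε0 (by simpa using ε.2.1) (Finset.mem_filter.1 hz).2.le
      · rw [Set.disjoint_union_left]
        exact ⟨li_disjoint (by simp) _ _, li_disjoint (by simp) _ _⟩
  · intro z hz
    rw [hP, bern_indep_real _ ?_ (hdep z) (ly_closed p0 ε _ z).1 (mE z) (mF _ z),
      (ly_closed p0 ε _ z).2, mul_comm]
    · refine mul_le_mul_of_nonneg_left ?_ measureReal_nonneg
      exact pow_le_pow_of_le_one (by simpa using hp1.le) (by simpa using p0.2.1)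
        (Finset.mem_filter.1 hz).2
    · rw [Set.disjoint_union_left]
      refine ⟨Set.disjoint_left.2 fun q hq hq' => ?_, li_disjoint (by simp) _ _⟩
      have h1 := Finset.mem_powerset.1 (Finset.mem_filter.1 hz).1 hq'.2
      rw [hex, Finset.mem_image] at h1
      obtain ⟨⟨a, b⟩, hab, he⟩ := h1
      have h2 := hq.2
      rw [← he] at h2
      exact (mem_inner.1 h2).1.2 (Finset.mem_filter.1 hab).2.1

/-- The renormalisation step succeeds with high probability. -/
theorem exists_step {p0 ε : unitInterval} (hd : 0 < d) (hp : pc d < p0) (hp1 : (p0 : ℝ) < 1)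
    (hε : 0 < (ε : ℝ)) {η : ℝ} (hη : 0 < η) : ∃ m n0 : ℕ, ∀ n, n0 ≤ n → ∀ (S : Finset (ZVec d)) x i s c,
      Bx m x ⊆ S → (bern (lq p0 ε)).real {ω : LI d → Bool | ¬ ∃ y, Suc m n S x i s
      (Dset S x n (ly none ω) (ly (some (c, true)) ω)) (ly (some (c, false)) ω) y} ≤ η := by
  obtain ⟨r, hr⟩ := exists_pow_lt_of_lt_one (half_pos hη) (show 1 - (ε : ℝ) < 1 by linarith)
  have hpr : 0 < (1 - (p0 : ℝ)) ^ r := pow_pos (by linarith) _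
  set η' := (1 - (p0 : ℝ)) ^ r * (η / 2) with hη'
  have hη'0 : 0 < η' := by positivity
  obtain ⟨m, hm⟩ := exists_VT_prob hd hp hp1 (half_pos hη'0)
  obtain ⟨L, hL⟩ := exists_pow_lt_of_lt_one (half_pos hη'0)
    (show 1 - (ε : ℝ) ^ (((2 * m + 1) ^ d + 1).choose 2) < 1 by
      have := pow_pos hε (((2 * m + 1) ^ d + 1).choose 2)
      linarith)
  obtain ⟨n0, hn0⟩ := hm (L * (2 * m + 1) ^ d)
  refine ⟨m, n0, fun n hn S x i s c hS => ?_⟩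
  refine (prob_no_suc p0 ε hp1 m n L r S x hS i s c).trans ?_
  have h1 := hn0 n hn x i s
  have h2 : ((1 - (p0 : ℝ)) ^ r)⁻¹ * ((bern fun _ : Sym2 (ZVec d) => p0).real
        {ω | (VT m n x i s ω).card ≤ L * (2 * m + 1) ^ d} +
      (1 - (ε : ℝ) ^ (((2 * m + 1) ^ d + 1).choose 2)) ^ L) ≤ η / 2 := by
    rw [inv_mul_le_iff₀ hpr]
    linarith
  linarith

end

/-! ### Dynamic renormalisation -/

section
variable {d : ℕ}

theorem Adj.update_sign {v y : ZVec d} {i : Fin d} (h : v i ≠ y i) :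
    Adj d v (Function.update v i (v i + (y i - v i).sign)) := by
  refine adj_iff.2 ⟨i, ?_, fun j hj => Function.update_of_ne hj _ _⟩
  rw [Function.update_self]
  rcases lt_or_gt_of_ne (sub_ne_zero.2 h.symm) with h' | h'
  · rw [Int.sign_eq_neg_one_of_neg h']; right; ring
  · rw [Int.sign_eq_one_of_pos h']; left; ring

theorem norm1_update_sign {v y : ZVec d} {i : Fin d} (h : v i ≠ y i) :
    norm1 d (y - Function.update v i (v i + (y i - v i).sign)) < norm1 d (y - v) := by
  refine Finset.sum_lt_sum (fun j _ => ?_) ⟨i, Finset.mem_univ _, ?_⟩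
  · by_cases hj : j = i
    · subst hj
      simp only [Pi.sub_apply, Function.update_self]
      rcases lt_or_gt_of_ne (sub_ne_zero.2 h.symm) with h' | h'
      · rw [Int.sign_eq_neg_one_of_neg h']; omega
      · rw [Int.sign_eq_one_of_pos h']; omega
    · simp [Function.update_of_ne hj]
  · simp only [Pi.sub_apply, Function.update_self]
    rcases lt_or_gt_of_ne (sub_ne_zero.2 h.symm) with h' | h'
    · rw [Int.sign_eq_neg_one_of_neg h']; omega
    · rw [Int.sign_eq_one_of_pos h']; omega

/-- A set closed under moving one coordinate at a time towards `y` is connected to `y`. -/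
theorem Cn_star {R : Set (ZVec d)} {y : ZVec d}
    (hR : ∀ v ∈ R, ∀ i, v i ≠ y i → Function.update v i (v i + (y i - v i).sign) ∈ R)
    {v : ZVec d} (hv : v ∈ R) : Cn (Adj d) R v y := by
  suffices H : ∀ k, ∀ v ∈ R, norm1 d (y - v) = k → Cn (Adj d) R v y from H _ v hv rfl
  intro k
  induction k using Nat.strong_induction_on with
  | _ k ih =>
    intro v hv hk
    by_cases h : v = y
    · subst h; exact Cn.refl hv
    · obtain ⟨i, hi⟩ := Function.ne_iff.1 h
      refine Cn.head hv (Adj.update_sign hi) (ih _ ?_ _ (hR v hv i hi) rfl)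
      exact hk ▸ norm1_update_sign hi

theorem update_sign_between {v y : ZVec d} {i : Fin d} (h : v i ≠ y i) (j : Fin d) :
    min (v j) (y j) ≤ Function.update v i (v i + (y i - v i).sign) j ∧
    Function.update v i (v i + (y i - v i).sign) j ≤ max (v j) (y j) := by
  by_cases hj : j = i
  · subst hj
    rw [Function.update_self]
    rcases lt_or_gt_of_ne (sub_ne_zero.2 h.symm) with h' | h'
    · rw [Int.sign_eq_neg_one_of_neg h']; omega
    · rw [Int.sign_eq_one_of_pos h']; omega
  · rw [Function.update_of_ne hj]; exact ⟨min_le_left _ _, le_max_left _ _⟩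

theorem Cn_Icc {u w v y : ZVec d} (hv : v ∈ Set.Icc u w) (hy : y ∈ Set.Icc u w) :
    Cn (Adj d) (Set.Icc u w) v y := by
  refine Cn_star (fun a ha i hi => Set.mem_Icc.2 ⟨fun j => ?_, fun j => ?_⟩) hv
  · exact (le_min (ha.1 j) (hy.1 j)).trans (update_sign_between hi j).1
  · exact (update_sign_between hi j).2.trans (max_le (ha.2 j) (hy.2 j))

theorem Bs_eq_Icc (r : ℤ) (z : ZVec d) :
    Bs r z = Set.Icc (fun i => z i - r) (fun i => z i + r) := by
  simp [Bs, Bx]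

theorem Cn_Bs {r : ℤ} {z v y : ZVec d} (hv : v ∈ Bs r z) (hy : y ∈ Bs r z) :
    Cn (Adj d) (Bs r z) v y := by
  rw [Bs_eq_Icc] at *
  exact Cn_Icc hv hy

/-- State of the exploration: explored vertices, activated coarse sites with the centre of a seed,
and failed coarse sites. -/
structure ESt (d : ℕ) where
  S : Finset (ZVec d)
  act : Finset (ZVec d × ZVec d)
  fail : Finset (ZVec d)

def ESt.tested (st : ESt d) (w : ZVec d) : Prop := w ∈ st.fail ∨ ∃ x, (w, x) ∈ st.act

def col (z : ZVec d) : Col d := fun i => (z i : ZMod 9)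

def ESt.cand (W : Finset (ZVec d)) (st : ESt d) (q : ZVec d × ZVec d × ZVec d) : Prop :=
  (q.1, q.2.1) ∈ st.act ∧ q.2.2 ∈ W ∧ Adj d q.1 q.2.2 ∧ ¬ st.tested q.2.2

def ESt.nxt (W : Finset (ZVec d)) (st : ESt d) : Option (ZVec d × ZVec d × ZVec d) :=
  if h : ∃ q, st.cand W q then some h.choose else none

theorem ESt.nxt_some {W : Finset (ZVec d)} {st : ESt d} {q : ZVec d × ZVec d × ZVec d}
    (h : st.nxt W = some q) : st.cand W q := by
  unfold ESt.nxt at h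
  split_ifs at h with hq
  obtain rfl := Option.some_injective _ h
  exact hq.choose_spec

theorem ESt.nxt_none {W : Finset (ZVec d)} {st : ESt d} (h : st.nxt W = none)
    (q : ZVec d × ZVec d × ZVec d) : ¬ st.cand W q := by
  unfold ESt.nxt at h
  split_ifs at h with hq
  exact fun h' => hq ⟨q, h'⟩

def ESt.upd (m : ℕ) (st : ESt d) (z' : ZVec d) (D : Finset (ZVec d)) : Option (ZVec d) → ESt d
  | some y => ⟨st.S ∪ D ∪ Bx m y, insert (z', y) st.act, st.fail⟩
  | none => ⟨st.S ∪ D, st.act, insert z' st.fail⟩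

/-- The rule choosing the orthant towards which to explore. -/
abbrev Dir (d : ℕ) := ZVec d → ZVec d → ZVec d → Fin d × (Fin d → ℤˣ)

/-- Points found when testing a coarse site. -/
def ESt.dd (n : ℕ) (st : ESt d) (q : ZVec d × ZVec d × ZVec d) (ω : LI d → Bool) :
    Finset (ZVec d) :=
  Dset st.S q.2.1 n (ly none ω) (ly (some (col q.2.2, true)) ω)

def ESt.win (m n : ℕ) (dir : Dir d) (st : ESt d) (q : ZVec d × ZVec d × ZVec d) (ω : LI d → Bool)
    (y : ZVec d) : Prop :=
  Suc m n st.S q.2.1 (dir q.1 q.2.1 q.2.2).1 (dir q.1 q.2.1 q.2.2).2 (st.dd n q ω)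
    (ly (some (col q.2.2, false)) ω) y

/-- Centre of the seed found when testing a coarse site. -/
def ESt.pk (m n : ℕ) (dir : Dir d) (st : ESt d) (q : ZVec d × ZVec d × ZVec d) (ω : LI d → Bool) :
    Option (ZVec d) :=
  if h : ∃ y, st.win m n dir q ω y then some h.choose else none

def ESt.stp (m n : ℕ) (W : Finset (ZVec d)) (dir : Dir d) (st : ESt d) (ω : LI d → Bool) : ESt d :=
  match st.nxt W with
  | none => st
  | some q => st.upd m q.2.2 (st.dd n q ω) (st.pk m n dir q ω)

def explore (m n : ℕ) (W : Finset (ZVec d)) (dir : Dir d) : ℕ → ESt d → (LI d → Bool) → ESt d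
  | 0, st, _ => st
  | k + 1, st, ω => explore m n W dir k (st.stp m n W dir ω) ω

def Reg (n : ℕ) (W : Finset (ZVec d)) : Set (ZVec d) := ⋃ w ∈ W, Bs (4 * n) ((n : ℤ) • w)

theorem Reg_finite (n : ℕ) (W : Finset (ZVec d)) : (Reg n W).Finite :=
  W.finite_toSet.biUnion fun _ _ => Finset.finite_toSet _

structure EOk (m n : ℕ) (W : Finset (ZVec d)) (st : ESt d) : Prop where
  act_mem : ∀ z x, (z, x) ∈ st.act → z ∈ W ∧ x ∈ Bx n ((n : ℤ) • z) ∧ Bx m x ⊆ st.S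
  disj : ∀ z ∈ st.fail, ∀ x, (z, x) ∉ st.act
  fail_sub : st.fail ⊆ W

def DirOk (n : ℕ) (dir : Dir d) : Prop := ∀ z x z', x ∈ Bx n ((n : ℤ) • z) → Adj d z z' →
  ∀ y ∈ Fc n x (dir z x z').1 (dir z x z').2, y ∈ Bx n ((n : ℤ) • z')

theorem exists_dirOk (hd : 0 < d) (n : ℕ) : ∃ dir : Dir d, DirOk n dir := by
  suffices H : ∀ z x z' : ZVec d, ∃ q : Fin d × (Fin d → ℤˣ), x ∈ Bx n ((n : ℤ) • z) → Adj d z z' →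
      ∀ y ∈ Fc n x q.1 q.2, y ∈ Bx n ((n : ℤ) • z') by
    choose dir h using H
    exact ⟨dir, h⟩
  intro z x z'
  by_cases ha : Adj d z z'
  · obtain ⟨i, hi, hj⟩ := adj_iff.1 ha
    refine ⟨(i, fun j => if j = i then (if z' i = z i + 1 then 1 else -1) else
      if 0 ≤ x j - n * z j then -1 else 1), fun hx _ y hy => mem_Bx.2 fun j => ?_⟩
    obtain ⟨h1, h2, h3⟩ := Finset.mem_filter.1 hy
    have hxj := abs_le.1 (mem_Bx.1 hx j)
    have hyj := abs_le.1 (mem_Bx.1 h1 j)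
    dsimp only at h2 h3
    simp only [Pi.smul_apply, smul_eq_mul] at hxj ⊢
    rw [abs_le]
    by_cases h : j = i
    · subst h
      rw [if_pos rfl] at h2
      rcases hi with hi | hi
      · rw [if_pos hi] at h2
        rw [hi, mul_add]
        push_cast at h2
        constructor <;> linarith
      · rw [if_neg (by omega)] at h2
        rw [hi, mul_sub]
        push_cast at h2
        constructor <;> linarith
    · have h3 := h3 j
      rw [if_neg h] at h3
      rw [hj j h]
      split_ifs at h3 with h4
      · push_cast at h3
        constructor <;> linarith
      · push_cast at h3
        constructor <;> linarith
  · exact ⟨(⟨0, hd⟩, 1), fun _ h => absurd h ha⟩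

section
variable {m n : ℕ} {W : Finset (ZVec d)} {dir : Dir d}

theorem ESt.upd_S (st : ESt d) (z' : ZVec d) (D : Finset (ZVec d)) (y : Option (ZVec d)) :
    st.S ∪ D ⊆ (st.upd m z' D y).S := by
  cases y with
  | none => exact le_rfl
  | some y => exact Finset.subset_union_left

theorem ESt.upd_act (st : ESt d) (z' : ZVec d) (D : Finset (ZVec d)) (y : Option (ZVec d)) :
    st.act ⊆ (st.upd m z' D y).act := by
  cases y with
  | none => exact le_rfl
  | some y => exact Finset.subset_insert _ _

theorem ESt.upd_tested (st : ESt d) (z' : ZVec d) (D : Finset (ZVec d)) (y : Option (ZVec d))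
    (w : ZVec d) : (st.upd m z' D y).tested w ↔ w = z' ∨ st.tested w := by
  cases y with
  | none => simp [ESt.tested, ESt.upd, or_assoc]
  | some y =>
    simp only [ESt.tested, ESt.upd, Finset.mem_insert, Prod.mk.injEq]
    constructor
    · rintro (h | ⟨x, ⟨h, -⟩ | h⟩)
      exacts [.inr (.inl h), .inl h, .inr (.inr ⟨x, h⟩)]
    · rintro (h | h | ⟨x, h⟩)
      exacts [.inr ⟨y, .inl ⟨h, rfl⟩⟩, .inl h, .inr ⟨x, .inr h⟩]

theorem EOk.upd {st : ESt d} (h : EOk m n W st) (hdir : DirOk n dir)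
    {q : ZVec d × ZVec d × ZVec d} (hq : st.cand W q) (D : Finset (ZVec d)) (y : Option (ZVec d))
    (hy : ∀ y' ∈ y, y' ∈ Fc n q.2.1 (dir q.1 q.2.1 q.2.2).1 (dir q.1 q.2.1 q.2.2).2) :
    EOk m n W (st.upd m q.2.2 D y) := by
  obtain ⟨h1, h2, h3, h4⟩ := hq
  cases y with
  | none =>
    refine ⟨fun z x hz => ?_, fun z hz x hx => ?_, ?_⟩
    · obtain ⟨a, b, c⟩ := h.act_mem z x hz
      exact ⟨a, b, c.trans Finset.subset_union_left⟩
    · rcases Finset.mem_insert.1 hz with rfl | hz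
      · exact h4 (Or.inr ⟨x, hx⟩)
      · exact h.disj z hz x hx
    · exact Finset.insert_subset h2 h.fail_sub
  | some y =>
    refine ⟨fun z x hz => ?_, fun z hz x hx => ?_, h.fail_sub⟩
    · rcases Finset.mem_insert.1 hz with e | hz
      · obtain ⟨rfl, rfl⟩ := Prod.mk.inj e
        exact ⟨h2, hdir _ _ _ (h.act_mem _ _ h1).2.1 h3 _ (hy _ rfl), Finset.subset_union_right⟩
      · obtain ⟨a, b, c⟩ := h.act_mem z x hz
        exact ⟨a, b, c.trans (Finset.subset_union_left.trans Finset.subset_union_left)⟩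
    · rcases Finset.mem_insert.1 hx with e | hx
      · obtain ⟨rfl, rfl⟩ := Prod.mk.inj e
        exact h4 (Or.inl hz)
      · exact h.disj z hz x hx

theorem ESt.pk_mem {st : ESt d} {q : ZVec d × ZVec d × ZVec d} {ω : LI d → Bool} {y : ZVec d}
    (h : y ∈ st.pk m n dir q ω) : st.win m n dir q ω y := by
  unfold ESt.pk at h
  split_ifs at h with hy
  · obtain rfl := Option.some_injective _ h
    exact hy.choose_spec
  · simp at h

theorem ESt.pk_none {st : ESt d} {q : ZVec d × ZVec d × ZVec d} {ω : LI d → Bool}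
    (h : st.pk m n dir q ω = none) : ¬ ∃ y, st.win m n dir q ω y := by
  unfold ESt.pk at h
  split_ifs at h with hy
  exact hy

theorem EOk.stp {st : ESt d} (h : EOk m n W st) (hdir : DirOk n dir) (ω : LI d → Bool) :
    EOk m n W (st.stp m n W dir ω) := by
  unfold ESt.stp
  split
  · exact h
  · next q hq =>
    exact h.upd hdir (ESt.nxt_some hq) _ _ fun y hy => (ESt.pk_mem hy).1

theorem EOk.explore {st : ESt d} (h : EOk m n W st) (hdir : DirOk n dir) (ω : LI d → Bool) (k : ℕ) :
    EOk m n W (explore m n W dir k st ω) := by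
  induction k generalizing st with
  | zero => exact h
  | succ k ih => exact ih (h.stp hdir ω)

theorem ESt.stp_act (st : ESt d) (ω : LI d → Bool) : st.act ⊆ (st.stp m n W dir ω).act := by
  unfold ESt.stp
  split
  · exact le_rfl
  · exact ESt.upd_act _ _ _ _

theorem explore_act (st : ESt d) (ω : LI d → Bool) (k : ℕ) :
    st.act ⊆ (explore m n W dir k st ω).act := by
  induction k generalizing st with
  | zero => exact le_rfl
  | succ k ih => exact (st.stp_act ω).trans (ih _)

/-- Coordinates which may be inspected from a given state on. -/
def ESt.avail (n : ℕ) (W : Finset (ZVec d)) (st : ESt d) : Set (LI d) :=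
  {q | q.2 ∈ inner (Reg n W) ∧ ((q.1 = none ∧ ∀ v ∈ q.2, v ∉ st.S) ∨
    ∃ w ∈ W, ¬ st.tested w ∧ ∃ t, q.1 = some (col w, t) ∧ q.2 ∈ inner (Bs (4 * n) ((n : ℤ) • w)))}

/-- Coordinates inspected when testing `w` with outcome `D`. -/
def ESt.used (n : ℕ) (W : Finset (ZVec d)) (st : ESt d) (w : ZVec d) (D : Finset (ZVec d)) :
    Set (LI d) :=
  {q | q.2 ∈ inner (Reg n W) ∧ ((q.1 = none ∧ (∀ v ∈ q.2, v ∉ st.S) ∧ ∃ v ∈ q.2, v ∈ D) ∨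
    ∃ t, q.1 = some (col w, t) ∧ q.2 ∈ inner (Bs (4 * n) ((n : ℤ) • w)))}

theorem finite_of_reg {A : Set (LI d)} (h : ∀ q ∈ A, q.2 ∈ inner (Reg n W)) : A.Finite :=
  (Set.finite_univ.prod (inner_finite (Reg_finite n W))).subset fun q hq => ⟨Set.mem_univ _, h q hq⟩

theorem ESt.used_subset {st : ESt d} {w : ZVec d} (hw : w ∈ W) (hw' : ¬ st.tested w)
    (D : Finset (ZVec d)) : st.used n W w D ⊆ st.avail n W := by
  rintro q ⟨h1, h2 | ⟨t, h2, h3⟩⟩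
  · exact ⟨h1, Or.inl ⟨h2.1, h2.2.1⟩⟩
  · exact ⟨h1, Or.inr ⟨w, hw, hw', t, h2, h3⟩⟩

theorem ESt.avail_upd_subset (st : ESt d) (z' : ZVec d) (D : Finset (ZVec d)) (y : Option (ZVec d)) :
    (st.upd m z' D y).avail n W ⊆ st.avail n W := by
  rintro q ⟨h1, h2 | ⟨w, hw, hw', t, h2, h3⟩⟩
  · exact ⟨h1, Or.inl ⟨h2.1, fun v hv hS => h2.2 v hv
      (st.upd_S z' D y (Finset.mem_union_left _ hS))⟩⟩
  · rw [ESt.upd_tested] at hw'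
    exact ⟨h1, Or.inr ⟨w, hw, fun h => hw' (Or.inr h), t, h2, h3⟩⟩

theorem ESt.used_disjoint (hn : 0 < n) (st : ESt d) (z' : ZVec d) (D : Finset (ZVec d))
    (y : Option (ZVec d)) :
    Disjoint (st.used n W z' D) ((st.upd m z' D y).avail n W) := by
  rw [Set.disjoint_left]
  rintro ⟨l, e⟩ ⟨-, h⟩ ⟨-, h'⟩
  rcases h with ⟨h1, h2, v, hv, hD⟩ | ⟨t, h1, h2⟩
  · rcases h' with ⟨h3, h4⟩ | ⟨w, hw, hw', t', h3, h4⟩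
    · exact h4 v hv (st.upd_S z' D y (Finset.mem_union_right _ hD))
    · simp only at h1 h3
      rw [h1] at h3
      exact absurd h3 (by simp)
  · rcases h' with ⟨h3, h4⟩ | ⟨w, hw, hw', t', h3, h4⟩
    · simp only at h1 h3
      rw [h1] at h3
      exact absurd h3 (by simp)
    · simp only at h1 h3 h2 h4
      rw [h1, Option.some.injEq, Prod.mk.injEq] at h3
      apply hw'
      rw [ESt.upd_tested]
      left
      ext i
      have hc : ((z' i : ℤ) : ZMod 9) = (w i : ℤ) := congrFun h3.1 i
      rw [ZMod.intCast_eq_intCast_iff_dvd_sub] at hc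
      induction e using Sym2.ind with
      | _ a b =>
        have ha := abs_le.1 (mem_Bs.1 (h2 a (by simp)) i)
        have hb := abs_le.1 (mem_Bs.1 (h4 a (by simp)) i)
        simp only [Pi.smul_apply, smul_eq_mul] at ha hb
        have hn' : (0 : ℤ) < n := by exact_mod_cast hn
        have h5 : w i - z' i = 0 := by
          refine Int.eq_zero_of_abs_lt_dvd hc ?_
          rw [abs_lt]
          constructor
          · by_contra! h6
            have : (n : ℤ) * (w i - z' i) ≤ n * (-9) := mul_le_mul_of_nonneg_left (by simpa using h6) hn'.le
            linarith
          · by_contra! h6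
            have : (n : ℤ) * 9 ≤ n * (w i - z' i) := mul_le_mul_of_nonneg_left (by simpa using h6) hn'.le
            linarith
        omega

theorem Bx_sub_of_cand {st : ESt d} (hok : EOk m n W st) {q : ZVec d × ZVec d × ZVec d}
    (hq : st.cand W q) : Bs (2 * n) q.2.1 ⊆ Bs (4 * n) ((n : ℤ) • q.2.2) := by
  have hx := (hok.act_mem _ _ hq.1).2.1
  refine Bx_subset fun i => ?_
  have h1 := abs_le.1 (mem_Bx.1 hx i)
  have h2 := abs_le.1 (hq.2.2.1.abs_le i)
  simp only [Pi.smul_apply, smul_eq_mul] at *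
  have : |q.2.1 i - n * q.2.2 i| ≤ 2 * n := by
    rw [abs_le]
    constructor <;> nlinarith
  linarith

theorem Bs_sub_Reg {w : ZVec d} (hw : w ∈ W) : Bs (4 * n) ((n : ℤ) • w) ⊆ Reg n W :=
  Set.subset_biUnion_of_mem (u := fun w => Bs (4 * n) ((n : ℤ) • w)) hw

theorem ESt.outcome_congr (hmn : m ≤ n) {st : ESt d} (hok : EOk m n W st)
    {q : ZVec d × ZVec d × ZVec d} (hq : st.cand W q) {ω ω' : LI d → Bool}
    (h : ∀ r ∈ st.used n W q.2.2 (st.dd n q ω), ω r = ω' r) :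
    st.dd n q ω' = st.dd n q ω ∧ st.pk m n dir q ω' = st.pk m n dir q ω := by
  have hB := Bx_sub_of_cand hok hq
  have hB1 : Bs n q.2.1 ⊆ Bs (4 * n) ((n : ℤ) • q.2.2) := fun v hv => hB (Bx_mono (by omega) _ hv)
  have hR := hB1.trans (Bs_sub_Reg hq.2.1)
  have hlay : ∀ t e, e ∈ inner (Bs (2 * n) q.2.1) →
      ω (some (col q.2.2, t), e) = ω' (some (col q.2.2, t), e) := fun t e he =>
    h _ ⟨inner_mono (hB.trans (Bs_sub_Reg hq.2.1)) he, Or.inr ⟨t, rfl, inner_mono hB he⟩⟩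
  have hB2 : Bs n q.2.1 ⊆ Bs (2 * n) q.2.1 := Bx_mono (by omega) _
  have hσ : ∀ a b, a ∈ Bx n q.2.1 → b ∈ Bx n q.2.1 → (Op (ly (some (col q.2.2, true)) ω) a b ↔
      Op (ly (some (col q.2.2, true)) ω') a b) := by
    intro a b ha hb
    rw [Op, Op, ly, ly, hlay true s(a, b) (mem_inner.2 ⟨hB2 ha, hB2 hb⟩)]
  have hβ : ∀ a b, a ∈ Bs n q.2.1 \ st.S → b ∈ Bs n q.2.1 \ st.S →
      (a ∈ st.dd n q ω ∨ b ∈ st.dd n q ω) → (Op (ly none ω) a b ↔ Op (ly none ω') a b) := by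
    intro a b ha hb hab
    rw [Op, Op, ly, ly, h (none, s(a, b)) ⟨mem_inner.2 ⟨hR ha.1, hR hb.1⟩,
      Or.inl ⟨rfl, by simpa using ⟨ha.2, hb.2⟩, by simpa using hab⟩⟩]
  have e1 : st.dd n q ω' = st.dd n q ω := by
    ext v
    constructor
    · intro hv
      obtain ⟨hv1, a, b, ha, ha', hb, hab, hc⟩ := Finset.mem_filter.1 hv
      clear hv hv1
      induction hc using Cn.induct with
      | h0 hx =>
        exact Finset.mem_filter.2 ⟨hx.1, a, b, ha, ha', hb, (hσ a b ha' hx.1).2 hab, Cn.refl hx⟩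
      | h1 u u' hu huu hu' ih =>
        obtain ⟨-, a2, b2, q1, q2, q3, q4, q5⟩ := Finset.mem_filter.1 ih
        exact Finset.mem_filter.2 ⟨hu'.1, a2, b2, q1, q2, q3, q4,
          q5.tail ((hβ u u' hu.right_mem hu' (Or.inl ih)).2 huu) hu'⟩
    · intro hv
      obtain ⟨hv1, a, b, ha, ha', hb, hab, hc⟩ := Finset.mem_filter.1 hv
      clear hv hv1
      induction hc using Cn.induct with
      | h0 hx =>
        exact Finset.mem_filter.2 ⟨hx.1, a, b, ha, ha', hb, (hσ a b ha' hx.1).1 hab, Cn.refl hx⟩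
      | h1 u u' hu huu hu' ih =>
        obtain ⟨-, a2, b2, q1, q2, q3, q4, q5⟩ := Finset.mem_filter.1 ih
        refine Finset.mem_filter.2 ⟨hu'.1, a2, b2, q1, q2, q3, q4,
          q5.tail ((hβ u u' hu.right_mem hu' (Or.inl ?_)).1 huu) hu'⟩
        exact Finset.mem_filter.2 ⟨hu.right_mem.1, a, b, ha, ha', hb, hab, hu⟩
  refine ⟨e1, ?_⟩
  have e2 : st.win m n dir q ω' = st.win m n dir q ω := by
    ext y
    unfold ESt.win Suc
    rw [e1]
    refine and_congr_right fun hy => and_congr_left fun _ => forall₂_congr fun e he => ?_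
    rw [ly, ly, hlay false e]
    intro v hv
    have hv' := Finset.mem_sym2_iff.1 he v hv
    refine Bx_subset (fun j => ?_) hv'
    have := mem_Bx.1 (Finset.mem_filter.1 hy).1 j
    have : (m : ℤ) ≤ n := by exact_mod_cast hmn
    linarith
  unfold ESt.pk
  rw [e2]

theorem explore_congr (hmn : m ≤ n) (hdir : DirOk n dir) {st : ESt d} (hok : EOk m n W st)
    {ω ω' : LI d → Bool} (h : ∀ r ∈ st.avail n W, ω r = ω' r) (k : ℕ) :
    explore m n W dir k st ω' = explore m n W dir k st ω := by
  induction k generalizing st with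
  | zero => rfl
  | succ k ih =>
    have e : st.stp m n W dir ω' = st.stp m n W dir ω := by
      unfold ESt.stp
      split
      · rfl
      · next q hq =>
        have hq := ESt.nxt_some hq
        obtain ⟨h1, h2⟩ := ESt.outcome_congr (dir := dir) hmn hok hq (ω := ω) (ω' := ω')
          fun r hr => h r (ESt.used_subset hq.2.1 hq.2.2.2 _ hr)
        rw [h1, h2]
    rw [explore, explore, e]
    refine ih (hok.stp hdir ω) fun r hr => h r ?_
    unfold ESt.stp at hr
    split at hr
    · exact hr
    · exact ESt.avail_upd_subset _ _ _ _ hr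

end

end

section
variable {d : ℕ}

theorem partition_upper_mul {Ω κ : Type} [MeasurableSpace Ω] (P : Measure Ω) [IsProbabilityMeasure P]
    (t : Finset κ) {E F : κ → Set Ω} {c : ℝ}
    (h : ∀ k ∈ t, P.real (E k ∩ F k) ≤ c * P.real (E k))
    (hd : (t : Set κ).PairwiseDisjoint E) (mE : ∀ k ∈ t, MeasurableSet (E k)) :
    P.real (⋃ k ∈ t, E k ∩ F k) ≤ c * P.real (⋃ k ∈ t, E k) := by
  refine (measureReal_biUnion_finset_le t _).trans ?_
  refine (Finset.sum_le_sum h).trans ?_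
  rw [← Finset.mul_sum, ← measureReal_biUnion_finset hd mE]

section
variable {m n : ℕ} {W : Finset (ZVec d)} {dir : Dir d}

theorem ESt.dd_mem (st : ESt d) (q : ZVec d × ZVec d × ZVec d) (ω : LI d → Bool) :
    st.dd n q ω ∈ (Bx n q.2.1).powerset :=
  Finset.mem_powerset.2 (Finset.filter_subset _ _)

theorem prob_fail (p0 ε : unitInterval) {η : ℝ} (h0 : 0 ≤ η) (hmn : m ≤ n) (hn : 0 < n)
    (hdir : DirOk n dir)
    (hstep : ∀ (S : Finset (ZVec d)) x i s c, Bx m x ⊆ S →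
      (bern (lq p0 ε)).real {ω : LI d → Bool | ¬ ∃ y, Suc m n S x i s
      (Dset S x n (ly none ω) (ly (some (c, true)) ω)) (ly (some (c, false)) ω) y} ≤ η)
    (k : ℕ) (st : ESt d) (hok : EOk m n W st) (F : Finset (ZVec d))
    (hF : ∀ z ∈ F, ∀ x, (z, x) ∉ st.act) :
    (bern (lq p0 ε)).real {ω | F ⊆ (explore m n W dir k st ω).fail} ≤ η ^ (F \ st.fail).card := by
  induction k generalizing st with
  | zero =>
    by_cases h : F ⊆ st.fail
    · rw [Finset.sdiff_eq_empty_iff_subset.2 h, Finset.card_empty, pow_zero]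
      exact measureReal_le_one
    · have : {ω : LI d → Bool | F ⊆ (explore m n W dir 0 st ω).fail} = ∅ := by
        ext ω
        simpa [explore] using h
      rw [this, measureReal_empty]
      positivity
  | succ k ih =>
    cases hq : st.nxt W with
    | none =>
      have : ∀ ω, explore m n W dir (k + 1) st ω = explore m n W dir k st ω := by
        intro ω
        rw [explore, ESt.stp, hq]
      simp only [this]
      exact ih st hok hF
    | some q =>
      have hexp : ∀ ω, explore m n W dir (k + 1) st ω =
          explore m n W dir k (st.upd m q.2.2 (st.dd n q ω) (st.pk m n dir q ω)) ω := by
        intro ω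
        rw [explore, ESt.stp, hq]
      simp only [hexp]
      have hq := ESt.nxt_some hq
      let E : Finset (ZVec d) × Option (ZVec d) → Set (LI d → Bool) := fun o =>
        {ω | st.dd n q ω = o.1 ∧ st.pk m n dir q ω = o.2}
      let G : Finset (ZVec d) × Option (ZVec d) → Set (LI d → Bool) := fun o =>
        {ω | F ⊆ (explore m n W dir k (st.upd m q.2.2 o.1 o.2) ω).fail}
      let t := (Bx n q.2.1).powerset ×ˢ
        Finset.insertNone (Fc n q.2.1 (dir q.1 q.2.1 q.2.2).1 (dir q.1 q.2.1 q.2.2).2)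
      have hok' : ∀ o ∈ t, EOk m n W (st.upd m q.2.2 o.1 o.2) := fun o ho =>
        hok.upd hdir hq _ _ fun y hy =>
          Finset.mem_insertNone.1 (Finset.mem_product.1 ho).2 y hy
      have hfu : ∀ D, (st.used n W q.2.2 D).Finite := fun D => finite_of_reg (W := W) fun r hr => hr.1
      have hfa : ∀ st' : ESt d, (st'.avail n W).Finite :=
        fun st' => finite_of_reg (W := W) fun r hr => hr.1
      have dE : ∀ o, Dep (st.used n W q.2.2 o.1) (E o) := by
        rintro ⟨D, y⟩ ω ω' h ⟨e1, e2⟩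
        simp only at e1 e2
        subst e1
        obtain ⟨h3, h4⟩ := ESt.outcome_congr (dir := dir) hmn hok hq h
        exact ⟨h3, h4.trans e2⟩
      have dG : ∀ o ∈ t, Dep ((st.upd m q.2.2 o.1 o.2).avail n W) (G o) := by
        intro o ho ω ω' h h3
        have := explore_congr hmn hdir (hok' o ho) h k
        simpa only [G, Set.mem_ofPred_eq, this] using h3
      have mE : ∀ o, MeasurableSet (E o) := fun o => (dE o).measurable_of_finite (hfu _)
      have mG : ∀ o ∈ t, MeasurableSet (G o) := fun o ho => (dG o ho).measurable_of_finite (hfa _)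
      have hind : ∀ o ∈ t, (bern (lq p0 ε)).real (E o ∩ G o) =
          (bern (lq p0 ε)).real (E o) * (bern (lq p0 ε)).real (G o) := fun o ho =>
        bern_indep_real _ (ESt.used_disjoint hn st _ _ _) (dE o) (dG o ho) (mE o) (mG o ho)
      have hdisj : (Set.univ : Set (Finset (ZVec d) × Option (ZVec d))).PairwiseDisjoint E := by
        intro o _ o' _ hoo
        refine Set.disjoint_left.2 fun ω h h' => hoo ?_
        exact Prod.ext (h.1.symm.trans h'.1) (h.2.symm.trans h'.2)
      have hzf : q.2.2 ∉ st.fail := fun h => hq.2.2.2 (Or.inl h)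
      by_cases hz : q.2.2 ∈ F
      · have hsub : {ω | F ⊆ (explore m n W dir k
            (st.upd m q.2.2 (st.dd n q ω) (st.pk m n dir q ω)) ω).fail} ⊆
            ⋃ D ∈ (Bx n q.2.1).powerset, E (D, none) ∩ G (D, none) := by
          intro ω hω
          have hpk : st.pk m n dir q ω = none := by
            by_contra hne
            obtain ⟨y, hy⟩ := Option.ne_none_iff_exists'.1 hne
            have hmem : ((st.dd n q ω), st.pk m n dir q ω) ∈ t := by
              refine Finset.mem_product.2 ⟨ESt.dd_mem _ _ _, Finset.mem_insertNone.2 fun y hy => ?_⟩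
              exact (ESt.pk_mem hy).1
            refine (EOk.explore (hok' _ hmem) hdir ω k).disj _ (hω hz) y (explore_act _ _ _ ?_)
            simp only [hy]
            exact Finset.mem_insert_self _ _
          rw [Set.mem_ofPred_eq, hpk] at hω
          exact Set.mem_biUnion (ESt.dd_mem st q ω) ⟨⟨rfl, hpk⟩, hω⟩
        have hmemt : ∀ D ∈ (Bx n q.2.1).powerset, (D, (none : Option (ZVec d))) ∈ t := fun D hD =>
          Finset.mem_product.2 ⟨hD, by simp⟩
        have hcard : (F \ st.fail).card = (F \ insert q.2.2 st.fail).card + 1 := by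
          rw [Finset.sdiff_insert, Finset.card_erase_add_one (Finset.mem_sdiff.2 ⟨hz, hzf⟩)]
        refine (measureReal_mono hsub (measure_ne_top _ _)).trans ((partition_upper_mul
          (c := η ^ (F \ insert q.2.2 st.fail).card) _ _ (fun D hD => ?_) ?_ ?_).trans ?_)
        · rw [hind _ (hmemt D hD), mul_comm]
          refine mul_le_mul_of_nonneg_right ?_ measureReal_nonneg
          exact ih _ (hok' _ (hmemt D hD)) hF
        · intro D _ D' _ hDD
          exact hdisj (Set.mem_univ _) (Set.mem_univ _) (fun h => hDD (Prod.mk.inj h).1)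
        · exact fun D _ => mE _
        · rw [hcard, pow_succ]
          refine mul_le_mul_of_nonneg_left ?_ (by positivity)
          refine (measureReal_mono ?_ (measure_ne_top _ _)).trans (hstep st.S q.2.1
            (dir q.1 q.2.1 q.2.2).1 (dir q.1 q.2.1 q.2.2).2 (col q.2.2) (hok.act_mem _ _ hq.1).2.2)
          intro ω hω
          obtain ⟨D, hD, h3⟩ := Set.mem_iUnion₂.1 hω
          exact ESt.pk_none h3.2
      · have hsub : {ω | F ⊆ (explore m n W dir k
            (st.upd m q.2.2 (st.dd n q ω) (st.pk m n dir q ω)) ω).fail} ⊆ ⋃ o ∈ t, E o ∩ G o := by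
          intro ω hω
          refine Set.mem_biUnion (x := (st.dd n q ω, st.pk m n dir q ω)) (Finset.mem_product.2
            ⟨ESt.dd_mem _ _ _, Finset.mem_insertNone.2 fun y hy => ?_⟩) ⟨⟨rfl, rfl⟩, hω⟩
          exact (ESt.pk_mem hy).1
        refine (measureReal_mono hsub (measure_ne_top _ _)).trans (partition_upper _ _
          (by positivity) (fun o ho => ?_) (hdisj.subset (Set.subset_univ _)) fun o _ => mE o)
        rw [hind o ho, mul_comm]
        refine mul_le_mul_of_nonneg_right ?_ measureReal_nonneg
        have hF' : ∀ z ∈ F, ∀ x, (z, x) ∉ (st.upd m q.2.2 o.1 o.2).act := by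
          intro z hzF x hx
          obtain ⟨D, y | y⟩ := o
          · exact hF z hzF x hx
          · rcases Finset.mem_insert.1 hx with e | hx
            · obtain ⟨rfl, -⟩ := Prod.mk.inj e
              exact hz hzF
            · exact hF z hzF x hx
        refine (ih _ (hok' o ho) hF').trans (le_of_eq ?_)
        congr 2
        obtain ⟨D, y | y⟩ := o
        · ext v
          simp only [ESt.upd, Finset.mem_sdiff, Finset.mem_insert]
          constructor
          · exact fun h => ⟨h.1, fun h' => h.2 (Or.inr h')⟩
          · refine fun h => ⟨h.1, ?_⟩
            rintro (rfl | h')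
            exacts [hz h.1, h.2 h']
        · rfl

/-- An edge is open as soon as it is open in one layer. -/
def mrg (ω : LI d → Bool) : Sym2 (ZVec d) → Bool := fun e => decide (∃ l, ω (l, e) = true)

theorem Op_mrg {ω : LI d → Bool} {l : Option (Col d × Bool)} {a b : ZVec d}
    (h : Op (ly l ω) a b) : Op (mrg ω) a b :=
  ⟨h.1, decide_eq_true ⟨l, h.2⟩⟩

def Snd (m n : ℕ) (W : Finset (ZVec d)) (st : ESt d) (ω : LI d → Bool) : Prop :=
  ∀ v ∈ st.S, ∃ a ∈ Bx m (0 : ZVec d), Cn (Op (mrg ω)) (Reg n W) a v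

theorem Snd.stp (hmn : m ≤ n) {st : ESt d} {ω : LI d → Bool} (h : Snd m n W st ω)
    (hok : EOk m n W st) : Snd m n W (st.stp m n W dir ω) ω := by
  unfold ESt.stp
  split
  · exact h
  · next q hq =>
    have hq := ESt.nxt_some hq
    have hB : Bs (2 * n) q.2.1 ⊆ Reg n W := (Bx_sub_of_cand hok hq).trans (Bs_sub_Reg hq.2.1)
    have hB1 : Bs n q.2.1 ⊆ Reg n W := fun v hv => hB (Bx_mono (by omega) _ hv)
    have hSD : ∀ v ∈ st.S ∪ st.dd n q ω,
        ∃ a ∈ Bx m (0 : ZVec d), Cn (Op (mrg ω)) (Reg n W) a v := by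
      intro v hv
      rcases Finset.mem_union.1 hv with hv | hv
      · exact h v hv
      · obtain ⟨-, a, b, ha, ha', hb, hab, hc⟩ := Finset.mem_filter.1 hv
        obtain ⟨a0, ha0, hc0⟩ := h a ha
        refine ⟨a0, ha0, (hc0.tail (Op_mrg hab) (hB1 hc.1.1)).trans ?_⟩
        exact hc.mono_in (Set.sdiff_subset.trans hB1) fun _ _ _ _ => Op_mrg
    cases hy : st.pk m n dir q ω with
    | none => exact hSD
    | some y =>
      intro v hv
      rcases Finset.mem_union.1 hv with hv | hv
      · exact hSD v hv
      · obtain ⟨h1, h2, h3⟩ := ESt.pk_mem (m := m) hy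
        obtain ⟨a0, ha0, hc0⟩ := hSD y (Finset.mem_union.2 h3)
        refine ⟨a0, ha0, hc0.trans ?_⟩
        have hyy : y ∈ Bs (m : ℤ) y := Bx_self (by positivity) y
        refine (Cn_Bs hyy hv).mono_in (fun w hw => hB (Bx_subset (fun j => ?_) hw))
          fun a ha b hb hab => Op_mrg (l := some (col q.2.2, false)) ⟨hab, h2 _ ?_⟩
        · have := mem_Bx.1 (Finset.mem_filter.1 h1).1 j
          have : (m : ℤ) ≤ n := by exact_mod_cast hmn
          linarith
        · exact Finset.mk_mem_sym2_iff.2 ⟨ha, hb⟩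

theorem Snd.explore (hmn : m ≤ n) (hdir : DirOk n dir) {st : ESt d} {ω : LI d → Bool}
    (h : Snd m n W st ω) (hok : EOk m n W st) (k : ℕ) :
    Snd m n W (explore m n W dir k st ω) ω := by
  induction k generalizing st with
  | zero => exact h
  | succ k ih => exact ih (h.stp hmn hok) (hok.stp hdir ω)

theorem nxt_explore (st : ESt d) (ω : LI d → Bool) (k : ℕ)
    (hk : (W.filter fun w => ¬ st.tested w).card ≤ k) :
    (explore m n W dir k st ω).nxt W = none := by
  induction k generalizing st with
  | zero =>
    by_contra hne
    obtain ⟨q, hq⟩ := Option.ne_none_iff_exists'.1 hne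
    have hq := ESt.nxt_some hq
    rw [Nat.le_zero, Finset.card_eq_zero] at hk
    exact Finset.notMem_empty q.2.2 (hk ▸ Finset.mem_filter.2 ⟨hq.2.1, hq.2.2.2⟩)
  | succ k ih =>
    cases hq : st.nxt W with
    | none =>
      have : ∀ k, explore m n W dir k st ω = st := by
        intro k
        induction k with
        | zero => rfl
        | succ k ih2 => rw [explore, ESt.stp, hq]; exact ih2
      rw [this, hq]
    | some q =>
      rw [explore, ESt.stp, hq]
      refine ih _ ?_
      have hq := ESt.nxt_some hq
      have : (W.filter fun w => ¬ (st.upd m q.2.2 (st.dd n q ω) (st.pk m n dir q ω)).tested w) ⊂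
          W.filter fun w => ¬ st.tested w := by
        rw [Finset.ssubset_iff_of_subset]
        · refine ⟨q.2.2, Finset.mem_filter.2 ⟨hq.2.1, hq.2.2.2⟩, fun h => ?_⟩
          exact (Finset.mem_filter.1 h).2 ((ESt.upd_tested _ _ _ _ _).2 (Or.inl rfl))
        · intro w hw
          obtain ⟨h1, h2⟩ := Finset.mem_filter.1 hw
          exact Finset.mem_filter.2 ⟨h1, fun h => h2 ((ESt.upd_tested _ _ _ _ _).2 (Or.inr h))⟩
      exact Nat.le_of_lt_succ ((Finset.card_lt_card this).trans_le hk)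

end

/-- Deterministic criterion: in every coarse configuration where `z` is not reached from `0`
inside `W`, one of the sets of `𝓕` consists of failed sites. -/
def Blocks (W : Finset (ZVec d)) (z : ZVec d) (𝓕 : Finset (Finset (ZVec d))) : Prop :=
  (∀ F ∈ 𝓕, (0 : ZVec d) ∉ F) ∧ ∀ A B : Finset (ZVec d), 0 ∈ A → A ⊆ W → B ⊆ W → Disjoint A B →
    (∀ a ∈ A, ∀ b ∈ W, Adj d a b → b ∈ A ∨ b ∈ B) → z ∉ A → ∃ F ∈ 𝓕, F ⊆ B

theorem renorm_layers {m n : ℕ} (hd : 0 < d) (p0 ε : unitInterval) {η : ℝ} (h0 : 0 ≤ η)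
    (hmn : m ≤ n) (hn : 0 < n)
    (hstep : ∀ (S : Finset (ZVec d)) x i s c, Bx m x ⊆ S →
      (bern (lq p0 ε)).real {ω : LI d → Bool | ¬ ∃ y, Suc m n S x i s
      (Dset S x n (ly none ω) (ly (some (c, true)) ω)) (ly (some (c, false)) ω) y} ≤ η)
    {W : Finset (ZVec d)} (hW : 0 ∈ W) {z : ZVec d} {𝓕 : Finset (Finset (ZVec d))}
    (hF : Blocks W z 𝓕) :
    (bern (lq p0 ε)).real {ω : LI d → Bool | ¬ ∃ a ∈ Bx m (0 : ZVec d), ∃ y ∈ Bx n ((n : ℤ) • z),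
      Cn (Op (mrg ω)) (Reg n W) a y} ≤ ∑ F ∈ 𝓕, η ^ F.card := by
  obtain ⟨dir, hdir⟩ := exists_dirOk hd n
  let st0 : ESt d := ⟨Bx m 0, {(0, 0)}, ∅⟩
  have hok : EOk m n W st0 := by
    refine ⟨fun z x hz => ?_, fun z hz => ?_, Finset.empty_subset _⟩
    · obtain ⟨rfl, rfl⟩ := Prod.mk.inj (Finset.mem_singleton.1 hz)
      exact ⟨hW, by rw [smul_zero]; exact Bx_self (by positivity) _, le_rfl⟩
    · exact absurd hz (Finset.notMem_empty _)
  set k := (W.filter fun w => ¬ st0.tested w).card with hk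
  have hB0 : Bs (4 * n) (0 : ZVec d) ⊆ Reg n W := by
    have := Bs_sub_Reg (n := n) hW
    rwa [smul_zero] at this
  have hs0 : ∀ ω, Snd m n W st0 ω := fun ω v hv => ⟨v, hv, Cn.refl (hB0 (Bx_mono (by omega) _ hv))⟩
  have hsub : {ω : LI d → Bool | ¬ ∃ a ∈ Bx m (0 : ZVec d), ∃ y ∈ Bx n ((n : ℤ) • z),
      Cn (Op (mrg ω)) (Reg n W) a y} ⊆
      ⋃ F ∈ 𝓕, {ω | F ⊆ (explore m n W dir k st0 ω).fail} := by
    intro ω hω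
    set st := explore m n W dir k st0 ω with hst
    have hok' : EOk m n W st := hok.explore hdir ω k
    have hs : Snd m n W st ω := (hs0 ω).explore hmn hdir hok k
    have hnx : st.nxt W = none := nxt_explore st0 ω k le_rfl
    obtain ⟨F, hF1, hF2⟩ := hF.2 (st.act.image Prod.fst) st.fail
      (Finset.mem_image.2 ⟨(0, 0), explore_act st0 ω k (Finset.mem_singleton_self _), rfl⟩)
      (fun a ha => by
        obtain ⟨⟨a', x⟩, hax, rfl⟩ := Finset.mem_image.1 ha
        exact (hok'.act_mem _ _ hax).1)
      hok'.fail_sub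
      (Finset.disjoint_left.2 fun a ha ha' => by
        obtain ⟨⟨a', x⟩, hax, rfl⟩ := Finset.mem_image.1 ha
        exact hok'.disj _ ha' _ hax)
      (fun a ha b hb hab => by
        obtain ⟨⟨a', x⟩, hax, rfl⟩ := Finset.mem_image.1 ha
        have := ESt.nxt_none hnx (a', x, b)
        have ht : st.tested b := by
          by_contra h
          exact this ⟨hax, hb, hab, h⟩
        rcases ht with h | ⟨x', h⟩
        · exact Or.inr h
        · exact Or.inl (Finset.mem_image.2 ⟨(b, x'), h, rfl⟩))
      (fun ha => by
        obtain ⟨⟨a', x⟩, hax, rfl⟩ := Finset.mem_image.1 ha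
        obtain ⟨h2, h3, h4⟩ := hok'.act_mem _ _ hax
        obtain ⟨a, ha, hc⟩ := hs x (h4 (Bx_self (by positivity) x))
        exact hω ⟨a, ha, x, h3, hc⟩)
    exact Set.mem_biUnion hF1 hF2
  refine (measureReal_mono hsub (measure_ne_top _ _)).trans
    ((measureReal_biUnion_finset_le _ _).trans (Finset.sum_le_sum fun F hF' => ?_))
  have := prob_fail p0 ε h0 hmn hn hdir hstep k st0 hok F (fun z hz x hx => by
    obtain ⟨rfl, -⟩ := Prod.mk.inj (Finset.mem_singleton.1 hx)
    exact hF.1 F hF' hz)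
  rwa [show st0.fail = ∅ from rfl, Finset.sdiff_empty] at this

theorem dep_Cn_sets (R : Set (ZVec d)) (A B : Finset (ZVec d)) :
    Dep (inner R) {ω | ∃ a ∈ A, ∃ y ∈ B, Cn (Op ω) R a y} := by
  rintro ω ω' h ⟨a, ha, y, hy, h1⟩
  exact ⟨a, ha, y, hy, dep_Cn R a y ω ω' h h1⟩

theorem incr_Cn_sets (R : Set (ZVec d)) (A B : Finset (ZVec d)) :
    Incr {ω | ∃ a ∈ A, ∃ y ∈ B, Cn (Op ω) R a y} := by
  rintro ω ω' h ⟨a, ha, y, hy, h1⟩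
  exact ⟨a, ha, y, hy, incr_Cn R a y ω ω' h h1⟩

/-- Dynamic renormalisation. -/
theorem renorm {p : unitInterval} (hd : 0 < d) (hp : pc d < p) (hp1 : (p : ℝ) < 1) {η : ℝ}
    (h0 : 0 < η) : ∃ m n0 : ℕ, ∀ n, n0 ≤ n → m ≤ n ∧ ∀ (W : Finset (ZVec d)), 0 ∈ W →
      ∀ z 𝓕, Blocks W z 𝓕 → (bern fun _ : Sym2 (ZVec d) => p).real
        {ω | ¬ ∃ a ∈ Bx m (0 : ZVec d), ∃ y ∈ Bx n ((n : ℤ) • z), Cn (Op ω) (Reg n W) a y} ≤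
        ∑ F ∈ 𝓕, η ^ F.card := by
  have hpc : 0 ≤ pc d := Real.sSup_nonneg fun x hx => hx.1
  let p0 : unitInterval := ⟨(pc d + p) / 2, by constructor <;> linarith⟩
  have hp0 : (p0 : ℝ) = (pc d + p) / 2 := rfl
  set K := Fintype.card (Col d × Bool) with hK
  have hK0 : K ≠ 0 := Fintype.card_ne_zero
  set r : ℝ := ((1 - p) / (1 - p0)) ^ ((K : ℝ)⁻¹) with hr
  have hq1 : (1 - (p : ℝ)) / (1 - p0) < 1 := by
    rw [div_lt_one (by linarith)]
    linarith
  have hq0 : 0 ≤ (1 - (p : ℝ)) / (1 - p0) := div_nonneg (by linarith) (by linarith)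
  have hr0 : 0 ≤ r := Real.rpow_nonneg hq0 _
  have hr1 : r < 1 := Real.rpow_lt_one hq0 hq1 (by positivity)
  have hrK : r ^ K = (1 - p) / (1 - p0) := Real.rpow_inv_natCast_pow hq0 hK0
  let ε : unitInterval := ⟨1 - r, by constructor <;> linarith⟩
  have hε : (ε : ℝ) = 1 - r := rfl
  obtain ⟨m, n0, H⟩ := exists_step (ε := ε) hd (p0 := p0) (by linarith) (by linarith)
    (by linarith) h0
  refine ⟨m, max n0 (max m 1), fun n hn => ⟨le_trans (by simp) hn, fun W hW z 𝓕 hF => ?_⟩⟩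
  have hmap : (bern (lq (d := d) p0 ε)).map mrg = bern fun _ : Sym2 (ZVec d) => p := by
    refine bern_map_or _ _ fun e => ?_
    rw [Fintype.prod_option]
    have : ∀ l : Col d × Bool, (1 - (lq p0 ε (some l, e) : ℝ)) = r := fun l => by
      simp [lq, hε]
    simp only [this, Finset.prod_const, Finset.card_univ]
    rw [← hK, hrK]
    simp only [lq, if_true]
    rw [mul_div_cancel₀]
    linarith
  have hm : Measurable (mrg (d := d)) := by
    refine measurable_pi_lambda _ fun e => measurable_to_bool ?_
    have : (fun ω : LI d → Bool => mrg ω e) ⁻¹' {true} =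
        ⋃ l, (fun ω => ω (l, e)) ⁻¹' {true} := by ext; simp [mrg]
    rw [this]
    exact MeasurableSet.iUnion fun l => measurable_pi_apply _ (measurableSet_singleton _)
  rw [← hmap, map_measureReal_apply hm]
  · exact renorm_layers hd p0 ε h0.le (le_trans (by simp) hn)
      (lt_of_lt_of_le (by simp) hn) (H n (le_trans (by simp) hn)) hW hF
  · refine Dep.measurable_of_finite (inner_finite (Reg_finite n W)) (Dep.compl (dep_Cn_sets _ _ _))

end

/-! ### Connectedness of boundaries -/

section
variable {d : ℕ}

theorem Cn.self_trace {α : Type*} {O : α → α → Prop} {R : Set α} {x y : α} (h : Cn O R x y) :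
    Cn O {w | Cn O R x w} x y := by
  induction h using Cn.induct with
  | h0 hx => exact Cn.refl (Cn.refl hx)
  | h1 a b ha hab hb ih => exact ih.tail hab (ha.tail hab hb)

/-- Adjacency in the sup norm (reflexive). -/
def Star (a b : ZVec d) : Prop := ∀ i, |a i - b i| ≤ 1

theorem Star.symm {a b : ZVec d} (h : Star a b) : Star b a := fun i => by
  rw [abs_sub_comm]; exact h i

theorem Adj.star {a b : ZVec d} (h : Adj d a b) : Star a b := h.abs_le

theorem exists_integral (u : ℤ → ZMod 2) : ∃ U : ℤ → ZMod 2, ∀ n, U (n + 1) = U n + u n := by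
  refine ⟨fun n => ∑ i ∈ Finset.Ico 0 n, u i - ∑ i ∈ Finset.Ico n 0, u i, fun n => ?_⟩
  rcases le_or_gt 0 n with h | h
  · have e : Finset.Ico 0 (n + 1) = insert n (Finset.Ico 0 n) := by
      ext i; simp only [Finset.mem_Ico, Finset.mem_insert]; omega
    simp only
    rw [e, Finset.sum_insert (by simp), Finset.Ico_eq_empty (by omega : ¬ n + 1 < 0),
      Finset.Ico_eq_empty (by omega : ¬ n < 0)]
    simp only [Finset.sum_empty, sub_zero]
    ring
  · have e : Finset.Ico n 0 = insert n (Finset.Ico (n + 1) 0) := by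
      ext i; simp only [Finset.mem_Ico, Finset.mem_insert]; omega
    simp only
    rw [e, Finset.sum_insert (by simp), Finset.Ico_eq_empty (by omega : ¬ 0 < n + 1),
      Finset.Ico_eq_empty (by omega : ¬ 0 < n)]
    simp only [Finset.sum_empty, zero_sub]
    ring

/-- The `i`-th unit vector. -/
def ev (i : Fin d) : ZVec d := Pi.single i 1

theorem ev_self (i : Fin d) : ev i i = 1 := by simp [ev]

theorem ev_ne {i j : Fin d} (h : j ≠ i) : ev i j = 0 := by simp [ev, h]

theorem adj_ev (v : ZVec d) (i : Fin d) : Adj d v (v + ev i) :=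
  adj_iff.2 ⟨i, by simp [ev], fun j hj => by simp [ev, hj]⟩

theorem Adj.exists_ev {a b : ZVec d} (h : Adj d a b) : ∃ i, b = a + ev i ∨ a = b + ev i := by
  obtain ⟨i, hi, hj⟩ := adj_iff.1 h
  refine ⟨i, hi.imp (fun hi => ?_) fun hi => ?_⟩
  · ext j
    by_cases h : j = i
    · subst h; simp [ev, hi]
    · simp [ev, h, hj j h]
  · ext j
    by_cases h : j = i
    · subst h; simp [ev, hi]
    · simp [ev, h, hj j h]

/-- Closed cochains are exact. -/
theorem exists_potential (g : Fin d → ZVec d → ZMod 2)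
    (hg : ∀ v i j, g i v + g j (v + ev i) = g j v + g i (v + ev j)) :
    ∃ f : ZVec d → ZMod 2, ∀ v i, f (v + ev i) = f v + g i v := by
  suffices H : ∀ s : Finset (Fin d), ∃ f : ZVec d → ZMod 2, ∀ v, ∀ i ∈ s, f (v + ev i) = f v + g i v by
    obtain ⟨f, hf⟩ := H Finset.univ
    exact ⟨f, fun v i => hf v i (Finset.mem_univ _)⟩
  intro s
  induction s using Finset.induction_on with
  | empty => exact ⟨fun _ => 0, by simp⟩
  | insert k s hk ih =>
    obtain ⟨f, hf⟩ := ih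
    choose U hU using exists_integral
    let g' : ZVec d → ZMod 2 := fun v => g k v - (f (v + ev k) - f v)
    have hg' : ∀ v, ∀ i ∈ s, g' (v + ev i) = g' v := by
      intro v i hi
      have h1 := hg v i k
      have h2 := hf v i hi
      have h3 := hf (v + ev k) i hi
      rw [add_right_comm] at h3
      simp only [g']
      rw [h3, h2]
      linear_combination h1
    let h : ZVec d → ZMod 2 := fun v => U (fun w => g' (Function.update v k w)) (v k)
    refine ⟨fun v => f v + h v, fun v i hi => ?_⟩
    rcases Finset.mem_insert.1 hi with rfl | hi
    · have e : ∀ w, Function.update (v + ev i) i w = Function.update v i w := by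
        intro w
        ext j
        by_cases hj : j = i
        · subst hj; simp
        · simp [ev, hj]
      simp only [h, e, Pi.add_apply, ev_self]
      rw [hU, Function.update_eq_self]
      simp only [g']
      ring
    · have hik : k ≠ i := fun h => hk (h ▸ hi)
      have e : ∀ w, Function.update (v + ev i) k w = Function.update v k w + ev i := by
        intro w
        ext j
        by_cases hj : j = k
        · subst hj; simp [ev_ne hik]
        · simp [Function.update_of_ne hj]
      simp only [h, e, Pi.add_apply, ev_ne hik, add_zero, hf v i hi]
      simp only [hg' _ i hi]
      ring

theorem exists_star_boundary {A : Set (ZVec d)} {x y : ZVec d} (hx : x ∈ A) (hy : y ∉ A) :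
    ∃ B : Set (ZVec d), (∀ b ∈ B, b ∉ A ∧ ∃ a ∈ A, Adj d a b) ∧
      (∀ b ∈ B, ∀ b' ∈ B, Cn Star B b b') ∧
      ∀ R x' y', Cn (Adj d) A x x' → Cn (Adj d) Aᶜ y y' → Cn (Adj d) R x' y' → ∃ b ∈ B, b ∈ R := by
  have asym : ∀ a b : ZVec d, Adj d a b → Adj d b a := fun _ _ => Adj.symm
  set Ax : Set (ZVec d) := {v | Cn (Adj d) A x v} with hAx
  set D : Set (ZVec d) := {v | Cn (Adj d) Axᶜ y v} with hD
  have hyAx : y ∉ Ax := fun h => hy h.right_mem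
  have hDAx : ∀ v ∈ D, v ∉ Ax := fun v hv => hv.right_mem
  have hyD : y ∈ D := Cn.refl hyAx
  have hxD : x ∉ D := fun h => hDAx x h (Cn.refl hx)
  have F1 : ∀ a b, a ∉ D → b ∈ D → Adj d a b → a ∈ Ax := by
    intro a b ha hb hab
    by_contra h
    exact ha (hb.tail hab.symm h)
  have F2 : ∀ a b, a ∈ Ax → b ∈ D → Adj d a b → b ∉ A := fun a b ha hb hab hbA =>
    hDAx b hb (ha.tail hab hbA)
  have F3 : ∀ v ∉ D, Cn (Adj d) Dᶜ x v := by
    have hAxD : ∀ v ∈ Ax, Cn (Adj d) Dᶜ x v := fun v hv =>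
      hv.self_trace.mono fun w hw hwD => hDAx w hwD hw
    intro v hv
    by_cases hvA : v ∈ Ax
    · exact hAxD v hvA
    · have hxv : Cn (Adj d) Set.univ x v :=
        Cn_star (fun _ _ _ _ => Set.mem_univ _) (Set.mem_univ _)
      obtain ⟨a, b, -, ha, hb, hab, hbv⟩ := hxv.last_exit (S := Ax) (Cn.refl hx) hvA
      have hbv' : Cn (Adj d) Axᶜ b v := hbv.mono fun w hw => hw.2
      have hvb := hbv'.symm asym
      have h1 : ∀ w, Cn (Adj d) Axᶜ v w → w ∉ D := fun w hw hwD => hv (hwD.trans (hw.symm asym))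
      have h2 : Cn (Adj d) Dᶜ v b := hvb.self_trace.mono h1
      exact ((hAxD a ha).tail hab (h1 b hvb)).trans (h2.symm asym)
  let Bd : Set (Sym2 (ZVec d)) := {e | ∃ a b, a ∉ D ∧ b ∈ D ∧ Adj d a b ∧ e = s(a, b)}
  let Pq : Sym2 (ZVec d) → Sym2 (ZVec d) → Prop := fun e e' => ∀ v ∈ e, ∀ w ∈ e', Star v w
  let B : Set (ZVec d) := {b | b ∈ D ∧ ∃ a, a ∉ D ∧ Adj d a b}
  refine ⟨B, fun b hb => ?_, fun b hb b' hb' => ?_,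
    fun R x' y' hx' hy' hR => ?_⟩
  · obtain ⟨hbD, a, ha, hab⟩ := hb
    have := F1 a b ha hbD hab
    exact ⟨F2 a b this hbD hab, a, this.right_mem, hab⟩
  · obtain ⟨hbD, a, ha, hab⟩ := hb
    obtain ⟨hbD', a', ha', hab'⟩ := hb'
    have he : s(a, b) ∈ Bd := ⟨a, b, ha, hbD, hab, rfl⟩
    have he' : s(a', b') ∈ Bd := ⟨a', b', ha', hbD', hab', rfl⟩
    have huniq : ∀ {a b a' b' : ZVec d}, a ∉ D → b ∈ D → a' ∉ D → b' ∈ D → s(a, b) = s(a', b') →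
        b = b' := by
      intro a b a' b' ha hb ha' hb' h
      rcases Sym2.eq_iff.1 h with ⟨-, h⟩ | ⟨-, h⟩
      · exact h
      · exact absurd hb (h ▸ ha')
    obtain ⟨T, hT⟩ : ∃ T : Set (Sym2 (ZVec d)), ∀ e, e ∈ T ↔ Cn Pq Bd s(a, b) e :=
      ⟨{e | Cn Pq Bd s(a, b) e}, fun e => Iff.rfl⟩
    suffices hmem : s(a', b') ∈ T by
      have key : ∀ e ∈ T, ∀ a1 b1, a1 ∉ D → b1 ∈ D → Adj d a1 b1 → e = s(a1, b1) →
          Cn Star B b b1 := by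
        intro e he1
        have he1 : Cn Pq Bd s(a, b) e := (hT e).1 he1
        induction he1 using Cn.induct with
        | h0 h =>
          intro a1 b1 h1 h2 h3 h4
          obtain rfl := huniq ha hbD h1 h2 h4
          exact Cn.refl ⟨hbD, a, ha, hab⟩
        | h1 e1 e2 he1' he12 he2 ih =>
          intro a2 b2 h1 h2 h3 h4
          obtain ⟨a1, b1, k1, k2, k3, k4⟩ := he1'.right_mem
          refine (ih ((hT _).2 he1') a1 b1 k1 k2 k3 k4).tail (he12 _ (by simp [k4]) _ (by simp [h4]))
            ⟨h2, a2, h1, h3⟩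
      exact key _ hmem a' b' ha' hbD' hab' rfl
    have hBd : ∀ u w, Adj d u w → (s(u, w) ∈ Bd ↔ (u ∈ D ↔ w ∉ D)) := by
      intro u w huw
      constructor
      · rintro ⟨a, b, ha, hb, -, h⟩
        rcases Sym2.eq_iff.1 h with ⟨rfl, rfl⟩ | ⟨rfl, rfl⟩
        · simp [ha, hb]
        · simp [ha, hb]
      · intro h
        by_cases hu : u ∈ D
        · exact ⟨w, u, h.1 hu, hu, huw.symm, Sym2.eq_swap⟩
        · exact ⟨u, w, hu, by by_contra hw; exact hu (h.2 hw), huw, rfl⟩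
    have hTBd : T ⊆ Bd := fun e he => ((hT e).1 he).right_mem
    let g : Fin d → ZVec d → ZMod 2 := fun i v => if s(v, v + ev i) ∈ T then 1 else 0
    have hg : ∀ v i j, g i v + g j (v + ev i) = g j v + g i (v + ev j) := by
      intro v i j
      by_cases hij : i = j
      · subst hij; rfl
      have hcomm : v + ev j + ev i = v + ev i + ev j := add_right_comm _ _ _
      simp only [g]
      rw [hcomm]
      set P : Set (ZVec d) := {u | ∀ l, v l ≤ u l ∧ u l ≤ v l + ev i l + ev j l} with hP
      have hev : ∀ l, ev i l + ev j l ≤ 1 := by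
        intro l
        by_cases h1 : l = i
        · subst h1; rw [ev_self, ev_ne hij]; norm_num
        · rw [ev_ne h1, zero_add]
          by_cases h2 : l = j
          · subst h2; rw [ev_self]
          · rw [ev_ne h2]; norm_num
      have hev0 : ∀ (i l : Fin d), 0 ≤ ev i l := by
        intro i l
        by_cases h1 : l = i
        · subst h1; rw [ev_self]; norm_num
        · rw [ev_ne h1]
      have hPq : ∀ a ∈ P, ∀ b ∈ P, ∀ a' ∈ P, ∀ b' ∈ P, Pq s(a, b) s(a', b') := by
        intro a ha b hb a' ha' b' hb' u hu w hw l
        have hu' : u ∈ P := by rcases Sym2.mem_iff.1 hu with rfl | rfl <;> assumption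
        have hw' : w ∈ P := by rcases Sym2.mem_iff.1 hw with rfl | rfl <;> assumption
        have h1 := hu' l
        have h2 := hw' l
        have h3 := hev l
        rw [abs_le]
        constructor <;> linarith
      have p0 : v ∈ P := fun l => ⟨le_rfl, by have := hev0 i l; have := hev0 j l; linarith⟩
      have p1 : v + ev i ∈ P := fun l => by
        have := hev0 i l; have := hev0 j l; simp only [Pi.add_apply]; constructor <;> linarith
      have p2 : v + ev j ∈ P := fun l => by
        have := hev0 i l; have := hev0 j l; simp only [Pi.add_apply]; constructor <;> linarith
      have p3 : v + ev i + ev j ∈ P := fun l => by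
        have := hev0 i l; have := hev0 j l; simp only [Pi.add_apply]; constructor <;> linarith
      by_cases hnone : ∃ a ∈ P, ∃ b ∈ P, s(a, b) ∈ T
      · obtain ⟨a1, ha1, b1, hb1, h1⟩ := hnone
        have hiff : ∀ u ∈ P, ∀ w ∈ P, Adj d u w → (s(u, w) ∈ T ↔ (u ∈ D ↔ w ∉ D)) := by
          intro u hu w hw huw
          rw [← hBd u w huw]
          exact ⟨fun h => hTBd h, fun h => (hT _).2 (Cn.tail ((hT _).1 h1) (hPq _ ha1 _ hb1 _ hu _ hw) h)⟩
        simp only [hiff v p0 _ p1 (adj_ev _ _), hiff _ p1 _ p3 (adj_ev _ _), hiff v p0 _ p2 (adj_ev _ _),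
          hiff _ p2 _ p3 (hcomm ▸ adj_ev _ _)]
        by_cases c0 : v ∈ D <;> by_cases c1 : v + ev i ∈ D <;> by_cases c2 : v + ev j ∈ D <;>
          by_cases c3 : v + ev i + ev j ∈ D <;> simp [c0, c1, c2, c3] <;> decide
      · push Not at hnone
        rw [if_neg (hnone _ p0 _ p1), if_neg (hnone _ p1 _ p3), if_neg (hnone _ p0 _ p2),
          if_neg (hnone _ p2 _ p3)]
    obtain ⟨f, hf⟩ := exists_potential g hg
    have hfadj : ∀ u w, Adj d u w → f w = f u + if s(u, w) ∈ T then 1 else 0 := by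
      intro u w huw
      obtain ⟨i, rfl | rfl⟩ := huw.exists_ev
      · exact hf u i
      · rw [hf w i]
        simp only [g]
        rw [Sym2.eq_swap, add_assoc, CharTwo.add_self_eq_zero, add_zero]
    have hconst : ∀ (R : Set (ZVec d)), (∀ u ∈ R, ∀ w ∈ R, Adj d u w → s(u, w) ∉ Bd) →
        ∀ u w, Cn (Adj d) R u w → f w = f u := by
      intro R hR u w h
      induction h using Cn.induct with
      | h0 _ => rfl
      | h1 a b ha hab hb ih =>
        rw [hfadj a b hab, if_neg (fun h => hR _ ha.right_mem _ hb hab (hTBd h)), add_zero, ih]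
    have c1 : ∀ w ∈ D, f w = f y := fun w hw => hconst D
      (fun u hu w hw huw h => ((hBd u w huw).1 h).1 hu hw) y w hw.self_trace
    have c2 : ∀ w ∉ D, f w = f x := fun w hw => hconst Dᶜ
      (fun u hu w hw huw h => hu (((hBd u w huw).1 h).2 hw)) x w (F3 w hw)
    by_contra hne
    have e1 := hfadj a b hab
    have e2 := hfadj a' b' hab'
    rw [if_pos ((hT _).2 (Cn.refl he)), c1 b hbD, c2 a ha] at e1
    rw [if_neg hne, c1 b' hbD', c2 a' ha', e1] at e2
    simp at e2
  · obtain ⟨a, b, h1, h2, h3, h4⟩ := hR.first_exit (S := Dᶜ) (fun h => hDAx x' h hx')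
      (fun h => h (hy'.mono fun v hv hvA => hv hvA.right_mem))
    exact ⟨b, ⟨by simpa using h2, a, h1.right_mem.2, h3⟩, h4.right_mem⟩

end

section
variable {d : ℕ}

/-! ### Self-avoiding paths and their number -/

theorem Cn.exists_nodup {α : Type*} {O : α → α → Prop} {R : Set α} {x y : α} (h : Cn O R x y) :
    ∃ γ : List α, γ.IsChain O ∧ γ.head? = some x ∧ γ.getLast? = some y ∧ γ.Nodup ∧
      ∀ v ∈ γ, v ∈ R := by
  induction h using Cn.induct with
  | h0 hx => exact ⟨[x], by simp, by simp, by simp, by simp, by simpa using hx⟩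
  | h1 a b ha hab hb ih =>
    obtain ⟨γ, h1, h2, h3, h4, h5⟩ := ih
    by_cases hbγ : b ∈ γ
    · obtain ⟨l1, l2, rfl⟩ := List.append_of_mem hbγ
      have e : l1 ++ b :: l2 = (l1 ++ [b]) ++ l2 := by simp
      rw [e] at h1 h2 h4 h5
      refine ⟨l1 ++ [b], h1.left_of_append, ?_, by simp, h4.of_append_left,
        fun v hv => h5 v (List.mem_append_left _ hv)⟩
      rw [List.head?_append] at h2
      cases l1 <;> simpa using h2
    · refine ⟨γ ++ [b], ?_, ?_, by simp, ?_, ?_⟩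
      · rw [List.isChain_append]
        refine ⟨h1, by simp, ?_⟩
        intro u hu v hv
        rw [h3] at hu
        simp at hu hv
        subst hu hv
        exact hab
      · rw [List.head?_append, h2]; rfl
      · rw [List.nodup_append]
        refine ⟨h4, by simp, ?_⟩
        rintro u hu v hv rfl
        simp at hv
        exact hbγ (hv ▸ hu)
      · intro v hv
        rcases List.mem_append.1 hv with hv | hv
        · exact h5 v hv
        · simp at hv; subst hv; exact hb

theorem star_chain_dist {γ : List (ZVec d)} (h : γ.IsChain Star) {x y : ZVec d}
    (hx : γ.head? = some x) (hy : y ∈ γ) (i : Fin d) : |y i - x i| + 1 ≤ γ.length := by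
  induction γ generalizing x with
  | nil => simp at hx
  | cons a γ ih =>
    simp at hx
    subst hx
    rcases List.mem_cons.1 hy with rfl | hy
    · simp
    · rw [List.isChain_cons] at h
      obtain ⟨b, hb⟩ : ∃ b, γ.head? = some b := by
        cases γ with
        | nil => simp at hy
        | cons b _ => exact ⟨b, rfl⟩
      have h1 := ih h.2 hb hy
      have h2 := h.1 b (by simp [hb]) i
      have h3 := abs_sub_le (y i) (b i) (a i)
      rw [abs_sub_comm] at h2
      simp only [List.length_cons]
      push_cast
      linarith

/-- Star-paths with `k + 1` vertices starting from `y`. -/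
def spaths : ℕ → ZVec d → Finset (List (ZVec d))
  | 0, y => {[y]}
  | k + 1, y => (Bx 1 y).biUnion fun y' => (spaths k y').image (y :: ·)

theorem card_spaths (k : ℕ) (y : ZVec d) : (spaths k y).card ≤ (3 ^ d) ^ k := by
  induction k generalizing y with
  | zero => simp [spaths]
  | succ k ih =>
    refine Finset.card_biUnion_le.trans ?_
    refine (Finset.sum_le_card_nsmul _ _ ((3 ^ d) ^ k) fun y' _ =>
      Finset.card_image_le.trans (ih y')).trans ?_
    have := card_Bx 1 y
    simp only [Nat.cast_one] at this
    rw [this, pow_succ, smul_eq_mul, mul_comm]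

theorem mem_spaths {k : ℕ} {y : ZVec d} {γ : List (ZVec d)} (h : γ.IsChain Star)
    (hy : γ.head? = some y) (hk : γ.length = k + 1) : γ ∈ spaths k y := by
  induction k generalizing y γ with
  | zero =>
    cases γ with
    | nil => simp at hk
    | cons a γ => simp at hk hy; simp [spaths, hk, hy]
  | succ k ih =>
    cases γ with
    | nil => simp at hk
    | cons a γ =>
      simp at hk hy
      subst hy
      rw [List.isChain_cons] at h
      cases γ with
      | nil => simp at hk
      | cons b γ =>
        simp only [spaths, Finset.mem_biUnion, Finset.mem_image]
        exact ⟨b, mem_Bx.2 fun i => Star.symm (h.1 b (by simp)) i, b :: γ, ih h.2 rfl hk, rfl⟩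

theorem length_of_mem_spaths {k : ℕ} {y : ZVec d} {γ : List (ZVec d)} (h : γ ∈ spaths k y) :
    γ.length = k + 1 := by
  induction k generalizing y γ with
  | zero => simp [spaths] at h; simp [h]
  | succ k ih =>
    simp only [spaths, Finset.mem_biUnion, Finset.mem_image] at h
    obtain ⟨y', -, γ', h1, rfl⟩ := h
    simp [ih h1]

/-! ### Connections along a connected coarse set -/

theorem blocks_singletons {W : Finset (ZVec d)} {z : ZVec d} (hW : Cn (Adj d) (↑W) 0 z) :
    Blocks W z ((W.erase 0).image fun w => {w}) := by
  refine ⟨?_, fun A B hA hAW hBW hAB hcl hz => ?_⟩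
  · intro F hF
    obtain ⟨w, hw, rfl⟩ := Finset.mem_image.1 hF
    rw [Finset.mem_singleton]
    exact (Finset.ne_of_mem_erase hw).symm
  · obtain ⟨a, b, -, ha, hb, hab, hbz⟩ := hW.last_exit (S := (A : Set (ZVec d))) hA hz
    have hbW : b ∈ W := hbz.1.1
    have hbB := (hcl a ha b hbW hab).resolve_left hb
    refine ⟨{b}, Finset.mem_image.2 ⟨b, Finset.mem_erase.2 ⟨?_, hbW⟩, rfl⟩, by simpa using hbB⟩
    rintro rfl
    exact hb hA

/-- Blocks joined by a connected coarse set `W` of bounded size are connected with high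
probability. -/
theorem connect_along {p : unitInterval} (hd : 0 < d) (hp : pc d < p) (hp1 : (p : ℝ) < 1) {η : ℝ}
    (h0 : 0 < η) (L : ℕ) : ∃ n0 : ℕ, ∀ n, n0 ≤ n → ∀ (W : Finset (ZVec d)), W.card ≤ L →
      ∀ z, Cn (Adj d) (↑W) 0 z → (bern fun _ : Sym2 (ZVec d) => p).real
        {ω | ¬ ∃ a ∈ Bx n (0 : ZVec d), ∃ y ∈ Bx n ((n : ℤ) • z), Cn (Op ω) (Reg n W) a y} ≤ η := by
  have hη : 0 < min 1 (η / (L + 1)) := lt_min one_pos (by positivity)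
  obtain ⟨m, n0, h⟩ := renorm hd hp hp1 hη
  refine ⟨n0, fun n hn W hW z hz => ?_⟩
  obtain ⟨hmn, h⟩ := h n hn
  have h1 := h W hz.1 z _ (blocks_singletons hz)
  have h2 : (bern fun _ : Sym2 (ZVec d) => p).real
      {ω | ¬ ∃ a ∈ Bx n (0 : ZVec d), ∃ y ∈ Bx n ((n : ℤ) • z), Cn (Op ω) (Reg n W) a y} ≤
      (bern fun _ : Sym2 (ZVec d) => p).real
        {ω | ¬ ∃ a ∈ Bx m (0 : ZVec d), ∃ y ∈ Bx n ((n : ℤ) • z), Cn (Op ω) (Reg n W) a y} := by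
    refine measureReal_mono ?_ (measure_ne_top _ _)
    rintro ω hω ⟨a, ha, h⟩
    exact hω ⟨a, Bx_mono (by exact_mod_cast hmn) _ ha, h⟩
  refine h2.trans (h1.trans ?_)
  rw [Finset.sum_image (by intro a _ b _ h; simpa using h)]
  simp only [Finset.card_singleton, pow_one, Finset.sum_const, nsmul_eq_mul]
  have h3 : ((W.erase 0).card : ℝ) ≤ L := by
    exact_mod_cast (Finset.card_erase_le).trans hW
  have h4 : ((W.erase 0).card : ℝ) * min 1 (η / (L + 1)) ≤ L * (η / (L + 1)) :=
    mul_le_mul h3 (min_le_right _ _) hη.le (Nat.cast_nonneg _)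
  refine h4.trans ?_
  rw [mul_div_assoc', div_le_iff₀ (by positivity)]
  nlinarith

/-! ### Connections inside a coarse plane -/

theorem sum_biUnion_le {ι κ : Type*} [DecidableEq κ] (s : Finset ι) (t : ι → Finset κ) (f : κ → ℝ)
    (hf : ∀ x, 0 ≤ f x) : ∑ x ∈ s.biUnion t, f x ≤ ∑ i ∈ s, ∑ x ∈ t i, f x := by
  classical
  induction s using Finset.induction_on with
  | empty => simp
  | insert a s ha ih =>
    rw [Finset.biUnion_insert, Finset.sum_insert ha]
    have := Finset.sum_union_inter (s₁ := t a) (s₂ := s.biUnion t) (f := f)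
    have h2 : 0 ≤ ∑ x ∈ t a ∩ s.biUnion t, f x := Finset.sum_nonneg fun x _ => hf x
    linarith

/-- The part of the ball of radius `r` in the coordinate plane `(j, k)`. -/
def Pl (j k : Fin d) (r : ℤ) : Finset (ZVec d) :=
  (Bx r 0).filter fun w => ∀ l, l ≠ j → l ≠ k → w l = 0

theorem mem_Pl {j k : Fin d} {r : ℤ} {w : ZVec d} :
    w ∈ Pl j k r ↔ (∀ l, |w l| ≤ r) ∧ ∀ l, l ≠ j → l ≠ k → w l = 0 := by
  simp [Pl, mem_Bx]

/-- Projection to the coordinate plane `(j, k)`. -/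
def pr (j k : Fin d) (v : ZVec d) : ZVec d := fun l => if l = j ∨ l = k then v l else 0

theorem pr_star {j k : Fin d} {v w : ZVec d} (h : Star v w) : Star (pr j k v) (pr j k w) := by
  intro l
  unfold pr
  split_ifs
  · exact h l
  · simp

theorem pr_adj {j k : Fin d} {v w : ZVec d} (h : Adj d v w) :
    pr j k v = pr j k w ∨ Adj d (pr j k v) (pr j k w) := by
  obtain ⟨i, hi, hi'⟩ := adj_iff.1 h
  by_cases hij : i = j ∨ i = k
  · refine Or.inr (adj_iff.2 ⟨i, by simpa [pr, hij] using hi, fun l hl => ?_⟩)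
    unfold pr; rw [hi' l hl]
  · refine Or.inl (funext fun l => ?_)
    unfold pr
    by_cases hl : l = j ∨ l = k
    · rw [if_pos hl, if_pos hl, hi' l (by rintro rfl; exact hij hl)]
    · rw [if_neg hl, if_neg hl]

theorem pr_eq {j k : Fin d} {v : ZVec d} (h : ∀ l, l ≠ j → l ≠ k → v l = 0) : pr j k v = v := by
  funext l
  unfold pr
  split_ifs with hl
  · rfl
  · push Not at hl; exact (h l hl.1 hl.2).symm

theorem exists_plane_path {j k : Fin d} (hjk : j ≠ k) {s : ℕ} {A B : Finset (ZVec d)}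
    (h0 : 0 ∈ A)
    (hcl : ∀ a ∈ A, ∀ b ∈ Pl j k (3 * s), Adj d a b → b ∈ A ∨ b ∈ B)
    (hz : (s : ℤ) • ev j ∉ A) : ∃ i < s, ∃ γ ∈ spaths (max 1 (min i (s - 1 - i)) - 1)
      (((i : ℤ) + 1) • ev j : ZVec d), γ.Nodup ∧ ∀ v ∈ γ, v ∈ B := by
  have evz : ∀ (c : ℤ) (l : Fin d), (c • ev j : ZVec d) l = if l = j then c else 0 := by
    intro c l
    split_ifs with h
    · subst h; simp [ev_self]
    · simp [ev_ne h]
  have evk : ∀ (c : ℤ) (l : Fin d), (c • ev k : ZVec d) l = if l = k then c else 0 := by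
    intro c l
    split_ifs with h
    · subst h; simp [ev_self]
    · simp [ev_ne h]
  have h0' : (0 : ZVec d) ∈ {v | pr j k v ∈ A} := by
    rw [Set.mem_ofPred_eq, pr_eq (by simp)]; exact h0
  have hz' : (s : ℤ) • ev j ∉ {v | pr j k v ∈ A} := by
    rw [Set.mem_ofPred_eq, pr_eq (by intro l h1 _; simp [ev_ne h1])]; exact hz
  obtain ⟨B', hB1, hB2, hB3'⟩ := exists_star_boundary h0' hz'
  have hB3 : ∀ R, Cn (Adj d) R 0 ((s : ℤ) • ev j) → ∃ b ∈ B', b ∈ R :=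
    fun R => hB3' R _ _ (Cn.refl h0') (Cn.refl hz')
  have hB4 : ∀ b ∈ B', (∀ l, |pr j k b l| ≤ 3 * s) → pr j k b ∈ B := by
    intro b hb hb'
    obtain ⟨h1, a, ha, hab⟩ := hB1 b hb
    rcases pr_adj (j := j) (k := k) hab with h | h
    · exact absurd (h ▸ ha : pr j k b ∈ A) h1
    · refine (hcl _ ha _ (mem_Pl.2 ⟨hb', fun l h1 h2 => by simp [pr, h1, h2]⟩) h).resolve_left h1
  obtain ⟨y0, hy0, hy0'⟩ := hB3 (Set.Icc 0 ((s : ℤ) • ev j))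
    (Cn_Icc ⟨le_rfl, fun l => by rw [evz]; split_ifs <;> simp⟩
      ⟨fun l => by rw [evz]; split_ifs <;> simp, le_rfl⟩)
  have hyl : ∀ l, l ≠ j → y0 l = 0 := fun l hl => by
    have h1 := hy0'.1 l
    have h2 := hy0'.2 l
    rw [evz, if_neg hl] at h2
    exact le_antisymm h2 h1
  have hyj : 0 ≤ y0 j ∧ y0 j ≤ s := ⟨hy0'.1 j, by simpa [evz] using hy0'.2 j⟩
  have hpy : pr j k y0 = y0 := pr_eq fun l h _ => hyl l h
  have hy1 : y0 j ≠ 0 := by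
    intro h
    apply (hB1 y0 hy0).1
    rw [Set.mem_ofPred_eq, hpy]
    have : y0 = 0 := funext fun l => by
      by_cases hl : l = j
      · subst hl; exact h
      · exact hyl l hl
    rwa [this]
  have hyB : y0 ∈ B := by
    have := hB4 y0 hy0 (fun l => by
      rw [hpy]
      by_cases hl : l = j
      · subst hl; rw [abs_le]; constructor <;> linarith
      · rw [hyl l hl]; simp)
    rwa [hpy] at this
  refine ⟨(y0 j).toNat - 1, by omega, ?_⟩
  set i := (y0 j).toNat - 1 with hi
  have hij : (i : ℤ) + 1 = y0 j := by omega
  have hye : (((i : ℤ) + 1) • ev j : ZVec d) = y0 := funext fun l => by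
    rw [evz]
    split_ifs with h
    · subst h; exact hij
    · exact (hyl l h).symm
  rw [hye]
  set ℓ := max 1 (min i (s - 1 - i)) with hℓ
  by_cases hℓ1 : ℓ = 1
  · rw [hℓ1]
    exact ⟨[y0], by simp [spaths], by simp, by simpa using hyB⟩
  have hℓi : ℓ ≤ i ∧ ℓ ≤ s - 1 - i ∧ 2 ≤ ℓ := by omega
  obtain ⟨b, hb, hbR⟩ := hB3 {v | (∀ l, l ≠ j → l ≠ k → v l = 0) ∧
      ¬ ∀ l, |v l - y0 l| ≤ (ℓ : ℤ) - 1} (by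
    have seg : ∀ u w : ZVec d, u ≤ w → (∀ l, l ≠ j → l ≠ k → u l = 0 ∧ w l = 0) →
        (∀ v ∈ Set.Icc u w, ¬ ∀ l, |v l - y0 l| ≤ (ℓ : ℤ) - 1) →
        Cn (Adj d) {v | (∀ l, l ≠ j → l ≠ k → v l = 0) ∧
          ¬ ∀ l, |v l - y0 l| ≤ (ℓ : ℤ) - 1} u w := by
      intro u w huw h1 h2
      refine (Cn_Icc (u := u) (w := w) ⟨le_rfl, huw⟩ ⟨huw, le_rfl⟩).mono fun v hv => ⟨?_, h2 v hv⟩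
      intro l l1 l2
      have e1 := hv.1 l
      have e2 := hv.2 l
      rw [(h1 l l1 l2).1] at e1
      rw [(h1 l l1 l2).2] at e2
      exact le_antisymm e2 e1
    have hkj : k ≠ j := hjk.symm
    have g1 : (0 : ZVec d) ≤ (ℓ : ℤ) • ev k := fun l => by rw [evk]; split_ifs <;> simp
    have g2 : (0 : ZVec d) ≤ (s : ℤ) • ev j := fun l => by rw [evz]; split_ifs <;> simp
    have s1 := seg 0 ((ℓ : ℤ) • ev k) g1 (fun l h1 h2 => by simp [ev_ne h2]) (by
      intro v hv hc
      have h2 : v j ≤ ((ℓ : ℤ) • ev k : ZVec d) j := hv.2 j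
      rw [evk, if_neg hjk] at h2
      have h3 := abs_le.1 (hc j)
      omega)
    have s2 := seg ((ℓ : ℤ) • ev k) ((ℓ : ℤ) • ev k + (s : ℤ) • ev j)
      (le_add_of_nonneg_right g2) (fun l h1 h2 => by simp [ev_ne h2, ev_ne h1]) (by
      intro v hv hc
      have h1 : ((ℓ : ℤ) • ev k : ZVec d) k ≤ v k := hv.1 k
      rw [evk, if_pos rfl] at h1
      have h3 := abs_le.1 (hc k)
      rw [hyl k hkj] at h3
      omega)
    have s3 := seg ((s : ℤ) • ev j) ((ℓ : ℤ) • ev k + (s : ℤ) • ev j)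
      (le_add_of_nonneg_left g1) (fun l h1 h2 => by simp [ev_ne h2, ev_ne h1]) (by
      intro v hv hc
      have h1 : ((s : ℤ) • ev j : ZVec d) j ≤ v j := hv.1 j
      rw [evz, if_pos rfl] at h1
      have h3 := abs_le.1 (hc j)
      omega)
    exact (s1.trans s2).trans (s3.symm fun _ _ => Adj.symm))
  obtain ⟨a, b1, h1, h2, h3, h4⟩ := (hB2 y0 hy0 b hb).first_exit
    (S := {v | ∀ l, |pr j k v l - y0 l| ≤ (ℓ : ℤ) - 1})
    (by rw [Set.mem_ofPred_eq, hpy]; intro l; simp; omega)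
    (by rw [Set.mem_ofPred_eq, pr_eq hbR.1]; exact hbR.2)
  have h5 : Cn Star (↑B : Set (ZVec d)) y0 (pr j k a) := by
    have := h1.map (pr j k) (O' := Star) (R' := (↑B : Set (ZVec d))) (fun v hv => by
      refine hB4 v hv.1 fun l => ?_
      have e1 := hv.2 l
      have e2 : |y0 l| ≤ s := by
        by_cases hl : l = j
        · subst hl; rw [abs_le]; constructor <;> linarith
        · rw [hyl l hl]; simp
      rw [abs_le] at e1 e2 ⊢
      omega) (fun _ _ _ _ h => pr_star h)
    rwa [hpy] at this
  obtain ⟨γ, k1, k2, k3, k4, k5⟩ := h5.exists_nodup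
  have h6 : ∃ l, (ℓ : ℤ) - 1 ≤ |pr j k a l - y0 l| := by
    rw [Set.mem_ofPred_eq] at h2
    push Not at h2
    obtain ⟨l, hl⟩ := h2
    refine ⟨l, ?_⟩
    have e1 := pr_star (j := j) (k := k) h3 l
    have e2 := abs_sub_le (pr j k b1 l) (pr j k a l) (y0 l)
    rw [abs_sub_comm] at e1
    omega
  obtain ⟨l, hl⟩ := h6
  have hlen : (ℓ : ℤ) ≤ γ.length := by
    have := star_chain_dist k1 k2 (y := pr j k a) (List.mem_of_getLast? k3) l
    omega
  have hlen' : ℓ ≤ γ.length := by exact_mod_cast hlen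
  refine ⟨γ.take ℓ, mem_spaths (k1.take ℓ) ?_ ?_, k4.sublist (List.take_sublist _ _),
    fun v hv => k5 v (List.mem_of_mem_take hv)⟩
  · rw [List.head?_take, if_neg (by omega)]; exact k2
  · rw [List.length_take]; omega

theorem sum_pow_plane {q : ℝ} (h0 : 0 ≤ q) (hq : q ≤ 1 / 16) (s : ℕ) :
    ∑ i ∈ Finset.range s, q ^ max 1 (min i (s - 1 - i)) ≤ 1 / 2 := by
  have hg : ∀ i : ℕ, q ^ max 1 i ≤ 1 / 8 * (1 / 2 : ℝ) ^ i := by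
    intro i
    refine (pow_le_pow_left₀ h0 hq _).trans ?_
    rcases Nat.eq_zero_or_pos i with rfl | hi
    · norm_num
    · rw [max_eq_right hi]
      obtain ⟨k, rfl⟩ := Nat.exists_eq_add_of_le' hi
      have h1 : (1 / 8 : ℝ) ^ k ≤ 1 := pow_le_one₀ (by norm_num) (by norm_num)
      have h2 : (1 / 16 : ℝ) ^ k = (1 / 8) ^ k * (1 / 2) ^ k := by
        rw [← mul_pow]; norm_num
      rw [pow_succ, pow_succ, h2]
      nlinarith [mul_le_mul_of_nonneg_right h1 (pow_nonneg (by norm_num : (0 : ℝ) ≤ 1 / 2) k)]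
  have hs : ∑ i ∈ Finset.range s, 1 / 8 * (1 / 2 : ℝ) ^ i ≤ 1 / 4 := by
    rw [← Finset.mul_sum, geom_sum_eq (by norm_num)]
    have : (0 : ℝ) ≤ (1 / 2) ^ s := by positivity
    norm_num
    nlinarith
  have h1 : ∀ i ∈ Finset.range s, q ^ max 1 (min i (s - 1 - i)) ≤
      1 / 8 * (1 / 2 : ℝ) ^ i + 1 / 8 * (1 / 2 : ℝ) ^ (s - 1 - i) := by
    intro i _
    have e1 : (0 : ℝ) ≤ 1 / 8 * (1 / 2) ^ i := by positivity
    have e2 : (0 : ℝ) ≤ 1 / 8 * (1 / 2) ^ (s - 1 - i) := by positivity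
    rcases min_choice i (s - 1 - i) with h | h <;> rw [h]
    · linarith [hg i]
    · linarith [hg (s - 1 - i)]
  refine (Finset.sum_le_sum h1).trans ?_
  rw [Finset.sum_add_distrib, Finset.sum_range_reflect (fun i => 1 / 8 * (1 / 2 : ℝ) ^ i)]
  linarith

/-- Blocks on a coordinate axis are connected inside a coarse plane with probability at least
one half, whatever their distance. -/
theorem connect_plane {p : unitInterval} (hd : 0 < d) (hp : pc d < p) (hp1 : (p : ℝ) < 1) :
    ∃ n : ℕ, 0 < n ∧ ∀ j k : Fin d, j ≠ k → ∀ s : ℕ,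
      (bern fun _ : Sym2 (ZVec d) => p).real {ω | ¬ ∃ a ∈ Bx n (0 : ZVec d),
        ∃ y ∈ Bx n ((n : ℤ) • ((s : ℤ) • ev j)), Cn (Op ω) (Reg n (Pl j k (3 * s))) a y} ≤
        1 / 2 := by
  set η : ℝ := 1 / (16 * 3 ^ d) with hη
  have h3 : (1 : ℝ) ≤ 3 ^ d := one_le_pow₀ (by norm_num)
  have hη0 : 0 < η := by positivity
  obtain ⟨m, n0, h⟩ := renorm hd hp hp1 hη0
  obtain ⟨hmn, h⟩ := h (max n0 1) (le_max_left _ _)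
  set n := max n0 1 with hn
  refine ⟨n, lt_max_of_lt_right one_pos, fun j k hjk s => ?_⟩
  set ℓ : ℕ → ℕ := fun i => max 1 (min i (s - 1 - i)) with hℓ
  set 𝓕 : Finset (Finset (ZVec d)) := (Finset.range s).biUnion fun i =>
    ((spaths (ℓ i - 1) (((i : ℤ) + 1) • ev j : ZVec d)).filter
      fun γ => γ.Nodup ∧ 0 ∉ γ).image List.toFinset with h𝓕
  have hB : Blocks (Pl j k (3 * s)) ((s : ℤ) • ev j) 𝓕 := by
    refine ⟨?_, fun A B hA hAW hBW hAB hcl hz => ?_⟩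
    · intro F hF
      simp only [h𝓕, Finset.mem_biUnion, Finset.mem_image, Finset.mem_filter] at hF
      obtain ⟨i, -, γ, ⟨-, -, h⟩, rfl⟩ := hF
      simpa using h
    · obtain ⟨i, hi, γ, hγ, h1, h2⟩ := exists_plane_path hjk hA hcl hz
      refine ⟨γ.toFinset, ?_, fun v hv => h2 v (List.mem_toFinset.1 hv)⟩
      simp only [h𝓕, Finset.mem_biUnion, Finset.mem_image, Finset.mem_filter, Finset.mem_range]
      exact ⟨i, hi, γ, ⟨hγ, h1, fun h => Finset.disjoint_left.1 hAB hA (h2 0 h)⟩, rfl⟩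
  have h1 := h _ (mem_Pl.2 ⟨fun l => by simp, fun l _ _ => rfl⟩) _ _ hB
  have h2 : (bern fun _ : Sym2 (ZVec d) => p).real {ω | ¬ ∃ a ∈ Bx n (0 : ZVec d),
        ∃ y ∈ Bx n ((n : ℤ) • ((s : ℤ) • ev j)), Cn (Op ω) (Reg n (Pl j k (3 * s))) a y} ≤
      (bern fun _ : Sym2 (ZVec d) => p).real {ω | ¬ ∃ a ∈ Bx m (0 : ZVec d),
        ∃ y ∈ Bx n ((n : ℤ) • ((s : ℤ) • ev j)), Cn (Op ω) (Reg n (Pl j k (3 * s))) a y} := by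
    refine measureReal_mono ?_ (measure_ne_top _ _)
    rintro ω hω ⟨a, ha, h⟩
    exact hω ⟨a, Bx_mono (by exact_mod_cast hmn) _ ha, h⟩
  refine h2.trans (h1.trans ((sum_biUnion_le _ _ _ fun F => by positivity).trans
    (le_trans (Finset.sum_le_sum fun i _ => ?_)
      (sum_pow_plane (q := 3 ^ d * η) (by positivity) (by rw [hη]; field_simp; norm_num) s))))
  have hℓ1 : 1 ≤ ℓ i := le_max_left _ _
  have h4 : ∀ F ∈ ((spaths (ℓ i - 1) (((i : ℤ) + 1) • ev j : ZVec d)).filter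
      fun γ => γ.Nodup ∧ 0 ∉ γ).image List.toFinset, η ^ F.card ≤ η ^ ℓ i := by
    intro F hF
    simp only [Finset.mem_image, Finset.mem_filter] at hF
    obtain ⟨γ, ⟨h5, h6, -⟩, rfl⟩ := hF
    rw [List.toFinset_card_of_nodup h6, length_of_mem_spaths h5, Nat.sub_add_cancel hℓ1]
  refine (Finset.sum_le_card_nsmul _ _ _ h4).trans ?_
  rw [nsmul_eq_mul, mul_pow]
  refine mul_le_mul_of_nonneg_right ?_ (by positivity)
  have h5 : (((spaths (ℓ i - 1) (((i : ℤ) + 1) • ev j : ZVec d)).filter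
      fun γ => γ.Nodup ∧ 0 ∉ γ).image List.toFinset).card ≤ (3 ^ d) ^ (ℓ i - 1) :=
    Finset.card_image_le.trans ((Finset.card_filter_le _ _).trans (card_spaths _ _))
  refine (Nat.cast_le (α := ℝ).2 h5).trans ?_
  push_cast
  exact pow_le_pow_right₀ h3 (Nat.sub_le _ _)

end

section
variable {d : ℕ}

/-! ### Connections in slabs -/

theorem bern_connect_translate (p : unitInterval) {R : Set (ZVec d)} (hR : R.Finite) (c x x' : ZVec d)
    (r r' : ℤ) :
    (bern fun _ : Sym2 (ZVec d) => p).real {ω | ¬ ∃ a ∈ Bx r (x + c), ∃ y ∈ Bx r' (x' + c),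
      Cn (Op ω) {v | v - c ∈ R} a y} =
    (bern fun _ : Sym2 (ZVec d) => p).real {ω | ¬ ∃ a ∈ Bx r x, ∃ y ∈ Bx r' x',
      Cn (Op ω) R a y} := by
  have hm : MeasurableSet {ω | ¬ ∃ a ∈ Bx r x, ∃ y ∈ Bx r' x', Cn (Op ω) R a y} :=
    (dep_Cn_sets R _ _).compl.measurable_of_finite (inner_finite hR)
  rw [← bern_aut p (Equiv.addRight c) hm]
  congr 1
  ext ω
  simp only [Set.mem_ofPred_eq, not_iff_not]
  have hC : ∀ a y, Cn (Op fun e => ω (Sym2.map (Equiv.addRight c) e)) R a y ↔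
      Cn (Op ω) {v | v - c ∈ R} (a + c) (y + c) := fun a y =>
    Cn_aut (τ := Equiv.addRight c) (fun a b => adj_add_right c a b)
      (fun a => by simp)
  constructor
  · rintro ⟨a, ha, y, hy, h⟩
    refine ⟨a - c, ?_, y - c, ?_, ?_⟩
    · rw [mem_Bx] at *
      intro i; have := ha i; simp only [Pi.add_apply, Pi.sub_apply] at *
      rwa [sub_sub, add_comm (c i)]
    · rw [mem_Bx] at *
      intro i; have := hy i; simp only [Pi.add_apply, Pi.sub_apply] at *
      rwa [sub_sub, add_comm (c i)]
    · rw [hC, sub_add_cancel, sub_add_cancel]; exact h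
  · rintro ⟨a, ha, y, hy, h⟩
    refine ⟨a + c, ?_, y + c, ?_, (hC _ _).1 h⟩
    · rw [mem_Bx] at *
      intro i; have := ha i; simpa using this
    · rw [mem_Bx] at *
      intro i; have := hy i; simpa using this

theorem harris_Cn (p : unitInterval) {U : Set (ZVec d)} (hU : U.Finite) (x y z : ZVec d) :
    (bern fun _ : Sym2 (ZVec d) => p).real {ω | Cn (Op ω) U x y} *
      (bern fun _ : Sym2 (ZVec d) => p).real {ω | Cn (Op ω) U y z} ≤
      (bern fun _ : Sym2 (ZVec d) => p).real {ω | Cn (Op ω) U x z} :=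
  (bern_harris _ (inner_finite hU) (dep_Cn U x y) (dep_Cn U y z) (incr_Cn U x y)
    (incr_Cn U y z)).trans (measureReal_mono (fun _ h => h.1.trans h.2) (measure_ne_top _ _))

/-- The pairs of vertices of a ball. -/
def prs (r : ℤ) (z : ZVec d) : Finset (Sym2 (ZVec d)) :=
  (Bx r z ×ˢ Bx r z).image fun q => s(q.1, q.2)

theorem card_prs (r : ℕ) (z : ZVec d) : (prs r z).card ≤ (2 * r + 1) ^ d * (2 * r + 1) ^ d := by
  refine Finset.card_image_le.trans ?_
  rw [Finset.card_product, card_Bx]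

theorem mem_prs {r : ℤ} {z a b : ZVec d} (ha : a ∈ Bx r z) (hb : b ∈ Bx r z) : s(a, b) ∈ prs r z :=
  Finset.mem_image.2 ⟨(a, b), Finset.mem_product.2 ⟨ha, hb⟩, rfl⟩

theorem prs_sub {r : ℤ} {z : ZVec d} {U : Set (ZVec d)} (h : Bs r z ⊆ U) :
    (↑(prs r z) : Set (Sym2 (ZVec d))) ⊆ inner U := by
  intro e he
  obtain ⟨q, hq, rfl⟩ := Finset.mem_image.1 (Finset.mem_coe.1 he)
  have := Finset.mem_product.1 hq
  exact mem_inner.2 ⟨h this.1, h this.2⟩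

theorem Cn_of_full {r : ℤ} {z : ZVec d} {ω : Sym2 (ZVec d) → Bool}
    (h : ∀ e ∈ prs r z, ω e = true) {a b : ZVec d} (ha : a ∈ Bs r z) (hb : b ∈ Bs r z) :
    Cn (Op ω) (Bs r z) a b :=
  (Cn_Bs ha hb).mono_in le_rfl fun _ hu _ hv huv => ⟨huv, h _ (mem_prs hu hv)⟩

theorem prob_prs {p : unitInterval} {N : ℕ} (r : ℕ) (z : ZVec d)
    (hN : (2 * r + 1) ^ d * (2 * r + 1) ^ d ≤ N) : (p : ℝ) ^ N ≤
    (bern fun _ : Sym2 (ZVec d) => p).real {ω | ∀ e ∈ prs r z, ω e = true} := by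
  rw [bern_full_real, Finset.prod_const]
  exact pow_le_pow_of_le_one p.2.1 p.2.2 ((card_prs r z).trans hN)

theorem line_connect {p : unitInterval} (hd : 0 < d) (hp : pc d < p) (hp1 : (p : ℝ) < 1) :
    ∃ n : ℕ, ∃ c : ℝ, 0 < c ∧ c ≤ 1 ∧ ∀ j k : Fin d, j ≠ k → ∀ (u : ZVec d) (s : ℕ)
      (U : Set (ZVec d)), U.Finite →
      (∀ v : ZVec d, (∀ l, |v l - u l| ≤ 4 * n + if l = j ∨ l = k then 3 * (s : ℤ) else 0) → v ∈ U) →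
      ∀ x ∈ Bs (4 * n) u, c ≤ (bern fun _ : Sym2 (ZVec d) => p).real
        {ω | Cn (Op ω) U x (x + (s : ℤ) • ev j)} := by
  have hp0 : (0 : ℝ) < p := (Real.sSup_nonneg fun x hx => hx.1 : (0 : ℝ) ≤ pc d).trans_lt hp
  obtain ⟨n, hn, h⟩ := connect_plane hd hp hp1
  set N := (2 * (4 * n) + 1) ^ d * (2 * (4 * n) + 1) ^ d with hN
  refine ⟨n, (p : ℝ) ^ N * ((p : ℝ) ^ N * (1 / 2)), by positivity, ?_, ?_⟩
  · have := pow_le_one₀ (n := N) p.2.1 p.2.2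
    have h2 : (0 : ℝ) < (p : ℝ) ^ N := by positivity
    nlinarith
  intro j k hjk u s U hU hUs x hx
  set q := s / n with hq
  have hsq : n * q ≤ s ∧ s < n * q + n := by
    have := Nat.div_add_mod s n
    have := Nat.mod_lt s hn
    constructor <;> rw [hq] <;> omega
  have hsq1 : (n : ℤ) * q ≤ s ∧ (s : ℤ) < n * q + n := by exact_mod_cast hsq
  set u' : ZVec d := u + (s : ℤ) • ev j with hu'
  have evz : ∀ (c : ℤ) (l : Fin d), (c • ev j : ZVec d) l = if l = j then c else 0 := by
    intro c l
    split_ifs with h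
    · subst h; simp [ev_self]
    · simp [ev_ne h]
  have b1 : Bs (4 * n) u ⊆ U := fun v hv => hUs v fun l => by
    have := mem_Bs.1 hv l
    split_ifs <;> linarith
  have b2 : Bs (4 * n) u' ⊆ U := fun v hv => hUs v fun l => by
    have h1 := mem_Bs.1 hv l
    simp only [hu', Pi.add_apply, evz] at h1
    rw [abs_le] at h1 ⊢
    by_cases hl : l = j
    · simp only [hl, if_true, true_or] at h1 ⊢; constructor <;> linarith
    · rw [if_neg hl] at h1; split_ifs <;> constructor <;> linarith
  have b3 : {v : ZVec d | v - u ∈ Reg n (Pl j k (3 * q))} ⊆ U := by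
    intro v hv
    obtain ⟨w, hw, hv⟩ := Set.mem_iUnion₂.1 hv
    refine hUs v fun l => ?_
    have h1 := mem_Bs.1 hv l
    have h2 := mem_Pl.1 hw
    simp only [Pi.sub_apply, Pi.smul_apply, smul_eq_mul] at h1
    split_ifs with hl
    · have h3 := h2.1 l
      rw [abs_le] at h1 h3 ⊢
      have h4 : (n : ℤ) * w l ≤ n * (3 * q) := mul_le_mul_of_nonneg_left h3.2 (by positivity)
      have h5 : (n : ℤ) * -(3 * q) ≤ n * w l := mul_le_mul_of_nonneg_left h3.1 (by positivity)
      constructor <;> linarith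
    · push Not at hl
      rw [h2.2 l hl.1 hl.2, mul_zero, sub_zero] at h1
      simpa using h1
  have hA := prob_prs (p := p) (4 * n) u hN.le
  have hB := prob_prs (p := p) (4 * n) u' hN.le
  set A : Set (Sym2 (ZVec d) → Bool) := {ω | ∀ e ∈ prs ((4 * n : ℕ) : ℤ) u, ω e = true} with hAd
  set B : Set (Sym2 (ZVec d) → Bool) := {ω | ∀ e ∈ prs ((4 * n : ℕ) : ℤ) u', ω e = true} with hBd
  set F : Set (Sym2 (ZVec d) → Bool) := {ω | ∃ a ∈ Bx n u, ∃ y ∈ Bx n ((n : ℤ) • ((q : ℤ) • ev j) + u),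
    Cn (Op ω) {v | v - u ∈ Reg n (Pl j k (3 * q))} a y} with hFd
  have hRf : {v : ZVec d | v - u ∈ Reg n (Pl j k (3 * q))}.Finite := hU.subset b3
  have dF : Dep (inner U) F := (dep_Cn_sets _ _ _).mono (inner_mono b3)
  have dA : Dep (inner U) A := (dep_full _).mono (prs_sub (by simpa using b1))
  have dB : Dep (inner U) B := (dep_full _).mono (prs_sub (by simpa using b2))
  have iA : Incr A := fun ω ω' h h1 e he => top_le_iff.1 ((h1 e he).symm.le.trans (h e))
  have iB : Incr B := fun ω ω' h h1 e he => top_le_iff.1 ((h1 e he).symm.le.trans (h e))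
  have hF : 1 / 2 ≤ (bern fun _ : Sym2 (ZVec d) => p).real F := by
    have h1 := bern_connect_translate p (Reg_finite n (Pl j k (3 * q))) u 0
      ((n : ℤ) • ((q : ℤ) • ev j)) n n
    have h2 := h j k hjk q
    rw [← h1, zero_add] at h2
    have h3 : {ω : Sym2 (ZVec d) → Bool | ¬ ∃ a ∈ Bx n u, ∃ y ∈ Bx n ((n : ℤ) • ((q : ℤ) • ev j) + u),
      Cn (Op ω) {v | v - u ∈ Reg n (Pl j k (3 * q))} a y} = Fᶜ := rfl
    rw [h3, probReal_compl_eq_one_sub (dF.measurable_of_finite (inner_finite hU))] at h2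
    linarith
  have h1 := bern_harris (fun _ : Sym2 (ZVec d) => p) (inner_finite hU) dB dF iB
    (incr_Cn_sets _ _ _)
  have h2 := bern_harris (fun _ : Sym2 (ZVec d) => p) (inner_finite hU) dA (dB.inter dF) iA
    (iB.inter (incr_Cn_sets _ _ _))
  have h3 : A ∩ (B ∩ F) ⊆ {ω | Cn (Op ω) U x (x + (s : ℤ) • ev j)} := by
    rintro ω ⟨hωA, hωB, a, ha, y, hy, hay⟩
    have ha' : a ∈ Bs ((4 * n : ℕ) : ℤ) u := Bx_mono (by push_cast; linarith) _ ha
    have hy' : y ∈ Bs ((4 * n : ℕ) : ℤ) u' := by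
      refine mem_Bs.2 fun l => ?_
      have e1 := mem_Bx.1 hy l
      simp only [hu', Pi.add_apply, evz, Pi.smul_apply, smul_eq_mul] at e1 ⊢
      push_cast
      rw [abs_le] at e1 ⊢
      by_cases hl : l = j
      · simp only [hl, if_true] at e1 ⊢; constructor <;> linarith
      · simp only [if_neg hl, mul_zero] at e1 ⊢; constructor <;> linarith
    have hx' : x + (s : ℤ) • ev j ∈ Bs ((4 * n : ℕ) : ℤ) u' := by
      refine mem_Bs.2 fun l => ?_
      have e1 := mem_Bs.1 hx l
      simp only [hu', Pi.add_apply]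
      push_cast
      rwa [add_sub_add_right_eq_sub]
    refine (((Cn_of_full hωA (by simpa using hx) ha').mono (by simpa using b1)).trans
      (hay.mono b3)).trans ((Cn_of_full hωB hy' hx').mono (by simpa using b2))
  have h4 := measureReal_mono (μ := bern fun _ : Sym2 (ZVec d) => p) h3 (measure_ne_top _ _)
  have hpN : (0 : ℝ) < (p : ℝ) ^ N := by positivity
  refine le_trans ?_ (h2.trans h4)
  refine mul_le_mul hA (le_trans ?_ h1) (by positivity) measureReal_nonneg
  exact mul_le_mul hB hF (by norm_num) measureReal_nonneg

/-- The slab between the levels `α` and `β` in direction `i`, of lateral size `M`. -/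
def Sl (i : Fin d) (α β M : ℤ) : Set (ZVec d) :=
  {v | α ≤ v i ∧ v i ≤ β ∧ ∀ l, l ≠ i → |v l| ≤ M}

theorem Sl_finite (i : Fin d) (α β M : ℤ) : (Sl i α β M).Finite := by
  refine (Set.finite_Icc (fun l => if l = i then α else -M) (fun l => if l = i then β else M)).subset
    fun v hv => ⟨fun l => ?_, fun l => ?_⟩
  · by_cases hl : l = i
    · subst hl; simpa using hv.1
    · simpa [hl] using (abs_le.1 (hv.2.2 l hl)).1
  · by_cases hl : l = i
    · subst hl; simpa using hv.2.1
    · simpa [hl] using (abs_le.1 (hv.2.2 l hl)).2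

theorem Sl_mono {i : Fin d} {α β M α' β' M' : ℤ} (h1 : α' ≤ α) (h2 : β ≤ β') (h3 : M ≤ M') :
    Sl i α β M ⊆ Sl i α' β' M' :=
  fun _ hv => ⟨h1.trans hv.1, hv.2.1.trans h2, fun l hl => (hv.2.2 l hl).trans h3⟩

theorem slab_connect {p : unitInterval} (hd : 3 ≤ d) (hp : pc d < p) (hp1 : (p : ℝ) < 1) :
    ∃ h : ℕ, ∃ c : ℝ, 0 < c ∧ c ≤ 1 ∧ ∀ (i : Fin d) (α : ℤ) (M : ℤ) (u v : ZVec d),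
      u i = α → v i = α → (∀ l, l ≠ i → |u l| ≤ M) → (∀ l, l ≠ i → |v l| ≤ M) →
      c ≤ (bern fun _ : Sym2 (ZVec d) => p).real
        {ω | Cn (Op ω) (Sl i α (α + h) (7 * M + h)) u v} := by
  obtain ⟨n, c, hc0, hc1, H⟩ := line_connect (by omega) hp hp1
  refine ⟨8 * n, c ^ d, by positivity, pow_le_one₀ hc0.le hc1, fun i α M u v hu hv huM hvM => ?_⟩
  set U := Sl i α (α + (8 * n : ℕ)) (7 * M + (8 * n : ℕ)) with hU
  have hUf : U.Finite := Sl_finite _ _ _ _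
  have step : ∀ (j : Fin d), j ≠ i → ∀ x : ZVec d, x i = α → (∀ l, l ≠ i → |x l| ≤ M) →
      ∀ s : ℕ, (s : ℤ) ≤ 2 * M → c ≤ (bern fun _ : Sym2 (ZVec d) => p).real
        {ω | Cn (Op ω) U x (x + (s : ℤ) • ev j)} := by
    intro j hji x hxi hxM s hs
    obtain ⟨k, hk⟩ : ∃ k : Fin d, k ≠ i ∧ k ≠ j := by
      by_contra! hcon
      have h1 : (Finset.univ : Finset (Fin d)) ⊆ {i, j} := by
        intro l _
        by_cases hl : l = i
        · simp [hl]
        · simp [hcon l hl]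
      have h2 := (Finset.card_le_card h1).trans Finset.card_le_two
      rw [Finset.card_univ, Fintype.card_fin] at h2
      omega
    refine H j k hk.2.symm (x + (4 * n : ℤ) • ev i) s U hUf (fun w hw => ?_) x ?_
    · have h1 : ∀ l, l ≠ i → (x + (4 * n : ℤ) • ev i) l = x l := fun l hl => by simp [ev_ne hl]
      have h2 : (x + (4 * n : ℤ) • ev i) i = α + 4 * n := by simp [ev_self, hxi]
      have h3 := hw i
      rw [h2, if_neg (by push Not; exact ⟨hji.symm, hk.1.symm⟩), abs_le] at h3
      refine ⟨by linarith, by push_cast; linarith, fun l hl => ?_⟩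
      have h4 := hw l
      rw [h1 l hl] at h4
      have h5 : |w l - x l| ≤ 4 * n + 3 * s := by
        refine h4.trans ?_
        split_ifs <;> omega
      have h6 := hxM l hl
      rw [abs_le] at h5 h6 ⊢
      push_cast
      constructor <;> linarith
    · refine mem_Bs.2 fun l => ?_
      by_cases hl : l = i
      · subst hl; simp [ev_self, abs_mul]
      · simp [ev_ne hl]
  have step2 : ∀ (j : Fin d), j ≠ i → ∀ x : ZVec d, x i = α → (∀ l, l ≠ i → |x l| ≤ M) →
      ∀ b : ℤ, |b| ≤ M → c ≤ (bern fun _ : Sym2 (ZVec d) => p).real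
        {ω | Cn (Op ω) U x (Function.update x j b)} := by
    intro j hji x hxi hxM b hb
    have hxj := abs_le.1 (hxM j hji)
    have hb' := abs_le.1 hb
    rcases le_total (x j) b with h | h
    · have h1 := step j hji x hxi hxM (b - x j).toNat (by omega)
      have h2 : x + ((b - x j).toNat : ℤ) • ev j = Function.update x j b := by
        funext l
        by_cases hl : l = j
        · subst hl; simp [ev_self]; omega
        · simp [ev_ne hl, hl]
      rwa [h2] at h1
    · have h1 := step j hji (Function.update x j b) (by rw [Function.update_of_ne hji.symm, hxi])
        (fun l hl => by
          by_cases hlj : l = j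
          · subst hlj; simpa using hb
          · rw [Function.update_of_ne hlj]; exact hxM l hl) (x j - b).toNat (by omega)
      have h2 : Function.update x j b + ((x j - b).toNat : ℤ) • ev j = x := by
        funext l
        by_cases hl : l = j
        · subst hl; simp [ev_self]; omega
        · simp [ev_ne hl, hl]
      rw [h2] at h1
      refine h1.trans (measureReal_mono ?_ (measure_ne_top _ _))
      exact fun ω h => Cn.symm (fun _ _ => Op.symm) h
  have hu0 : u ∈ U := ⟨hu.ge, by rw [hu]; simp, fun l hl => by
    have := abs_nonneg (u l)
    have := huM l hl
    push_cast
    linarith⟩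
  have key : ∀ T : Finset (Fin d), i ∉ T → c ^ T.card ≤ (bern fun _ : Sym2 (ZVec d) => p).real
      {ω | Cn (Op ω) U u (fun l => if l ∈ T then v l else u l)} := by
    intro T
    induction T using Finset.induction_on with
    | empty =>
      intro _
      have : {ω : Sym2 (ZVec d) → Bool | Cn (Op ω) U u
          (fun l => if l ∈ (∅ : Finset (Fin d)) then v l else u l)} = Set.univ := by
        ext ω; simpa using Cn.refl hu0
      rw [this]; simp
    | insert j T hj ih =>
      intro hi
      rw [Finset.mem_insert, not_or] at hi
      have h1 := ih hi.2
      have h2 := step2 j (Ne.symm hi.1) (fun l => if l ∈ T then v l else u l)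
        (by simp [hi.2, hu]) (fun l hl => by
          show |if l ∈ T then v l else u l| ≤ M
          split_ifs
          exacts [hvM l hl, huM l hl]) (v j) (hvM j (Ne.symm hi.1))
      have h3 : Function.update (fun l => if l ∈ T then v l else u l) j (v j) =
          fun l => if l ∈ insert j T then v l else u l := by
        funext l
        by_cases hl : l = j
        · subst hl; simp
        · simp [hl]
      rw [h3] at h2
      rw [Finset.card_insert_of_notMem hj, pow_succ]
      exact (mul_le_mul h1 h2 hc0.le measureReal_nonneg).trans (harris_Cn p hUf _ _ _)
  have h1 := key (Finset.univ.erase i) (by simp)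
  have h2 : (fun l => if l ∈ Finset.univ.erase i then v l else u l) = v := by
    funext l
    by_cases hl : l = i
    · subst hl; simp [hu, hv]
    · simp [hl]
  rw [h2] at h1
  refine le_trans (pow_le_pow_of_le_one hc0.le hc1 ?_) h1
  exact (Finset.card_le_univ _).trans (by simp)

end

section
variable {d : ℕ}

/-! ### Uniqueness of slab crossings in dimension at least three -/

/-- The failure of local uniqueness: `a` and `b` reach the top of a slab but are not connected. -/
def SlFail (i : Fin d) (α β M M' : ℤ) (a b : ZVec d) : Set (Sym2 (ZVec d) → Bool) :=
  {ω | (∃ x, x i = β ∧ Cn (Op ω) (Sl i α β M) a x) ∧ (∃ y, y i = β ∧ Cn (Op ω) (Sl i α β M) b y) ∧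
    ¬ Cn (Op ω) (Sl i α β M') a b}

theorem dep_SlFail {i : Fin d} {α β M M' : ℤ} (hM : M ≤ M') (a b : ZVec d) :
    Dep (inner (Sl i α β M')) (SlFail i α β M M' a b) := by
  rintro ω ω' h ⟨⟨x, hx, h1⟩, ⟨y, hy, h2⟩, h3⟩
  have e : ∀ u v, Cn (Op ω) (Sl i α β M) u v → Cn (Op ω') (Sl i α β M) u v := fun u v h4 =>
    (dep_Cn _ u v).mono (inner_mono (Sl_mono le_rfl le_rfl hM)) ω ω' h h4
  exact ⟨⟨x, hx, e _ _ h1⟩, ⟨y, hy, e _ _ h2⟩, fun h4 =>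
    h3 (dep_Cn _ a b ω' ω (fun q hq => (h q hq).symm) h4)⟩

theorem prob_edge (p : unitInterval) (e : Sym2 (ZVec d)) :
    (bern fun _ : Sym2 (ZVec d) => p).real {ω | ω e = true} = p := by
  have := bern_full_real (fun _ : Sym2 (ZVec d) => p) {e}
  simpa using this

theorem SlFail_climb {i : Fin d} {α β β' M : ℤ} (hβ : β < β') {ω : Sym2 (ZVec d) → Bool}
    {a : ZVec d} (ha : a i ≤ β) (h : ∃ x, x i = β' ∧ Cn (Op ω) (Sl i α β' M) a x) :
    ∃ x, x i = β ∧ Cn (Op ω) (Sl i α β M) a x := by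
  obtain ⟨x, hx, h⟩ := h
  obtain ⟨u, v, h1, h2, h3, -⟩ := h.first_exit (S := {v | v i ≤ β})
    (by simpa using ha)
    (by simp only [Set.mem_ofPred_eq]; omega)
  have h4 := h1.right_mem.2
  have h5 := abs_le.1 (h3.1.abs_le i)
  simp only [Set.mem_ofPred_eq] at h2 h4
  exact ⟨u, by omega, h1.mono fun w hw => ⟨hw.1.1, hw.2, hw.1.2.2⟩⟩

theorem slab_step {p : unitInterval} {h : ℕ} {c : ℝ} (hc0 : 0 < c)
    (H : ∀ (i : Fin d) (α : ℤ) (M : ℤ) (u v : ZVec d),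
      u i = α → v i = α → (∀ l, l ≠ i → |u l| ≤ M) → (∀ l, l ≠ i → |v l| ≤ M) →
      c ≤ (bern fun _ : Sym2 (ZVec d) => p).real
        {ω | Cn (Op ω) (Sl i α (α + h) (7 * M + h)) u v})
    (i : Fin d) {α β M : ℤ} (hM : 0 ≤ M) (a b : ZVec d) (ha : a i ≤ β) (hb : b i ≤ β) :
    (bern fun _ : Sym2 (ZVec d) => p).real (SlFail i α (β + 1 + h) M (7 * M + h) a b) ≤
      (1 - p * (p * c)) * (bern fun _ : Sym2 (ZVec d) => p).real
        (SlFail i α β M (7 * M + h) a b) := by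
  set P := bern fun _ : Sym2 (ZVec d) => p with hP
  set S := Sl i α β M with hS
  set R := Sl i α β (7 * M + h) with hR
  set U := Sl i (β + 1) (β + 1 + h) (7 * M + h) with hU
  have hSR : S ⊆ R := Sl_mono le_rfl le_rfl (by omega)
  let pick : Set (ZVec d) → ZVec d := fun s => if hs : s.Nonempty then hs.some else 0
  have pick_mem : ∀ s : Set (ZVec d), s.Nonempty → pick s ∈ s := fun s hs => by
    simp only [pick, dif_pos hs]; exact hs.some_mem
  let A : ZVec d → (Sym2 (ZVec d) → Bool) → Set (ZVec d) := fun a ω => {x | x i = β ∧ Cn (Op ω) S a x}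
  have hA : ∀ a ω ω', (∀ e ∈ inner R, ω e = ω' e) → A a ω = A a ω' := by
    intro a ω ω' h
    ext x
    simp only [A, Set.mem_ofPred_eq]
    have := ((dep_Cn S a x).mono (inner_mono hSR)).iff h
    simp only [Set.mem_ofPred_eq] at this
    rw [this]
  let E : ZVec d × ZVec d → Set (Sym2 (ZVec d) → Bool) := fun q =>
    SlFail i α β M (7 * M + h) a b ∩ {ω | pick (A a ω) = q.1 ∧ pick (A b ω) = q.2}
  let G : ZVec d × ZVec d → Set (Sym2 (ZVec d) → Bool) := fun q =>
    {ω | ω s(q.1, q.1 + ev i) = true} ∩ ({ω | ω s(q.2, q.2 + ev i) = true} ∩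
      {ω | Cn (Op ω) U (q.1 + ev i) (q.2 + ev i)})
  let V : ZVec d × ZVec d → Set (Sym2 (ZVec d)) := fun q =>
    {s(q.1, q.1 + ev i)} ∪ {s(q.2, q.2 + ev i)} ∪ inner U
  have hUf : U.Finite := Sl_finite _ _ _ _
  have hRf : R.Finite := Sl_finite _ _ _ _
  have hSf : S.Finite := Sl_finite _ _ _ _
  have hVf : ∀ q, (V q).Finite := fun q =>
    ((Set.finite_singleton _).union (Set.finite_singleton _)).union (inner_finite hUf)
  have dEd : ∀ (e : Sym2 (ZVec d)) (W : Set (Sym2 (ZVec d))), e ∈ W →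
      Dep W {ω : Sym2 (ZVec d) → Bool | ω e = true} := fun e W he ω ω' h h1 => by
    have := h e he
    simp only [Set.mem_ofPred_eq] at h1 ⊢
    rw [← this]; exact h1
  have iEd : ∀ e : Sym2 (ZVec d), Incr {ω : Sym2 (ZVec d) → Bool | ω e = true} :=
    fun e ω ω' h h1 => top_le_iff.1 ((show ω e = true from h1).symm.le.trans (h e))
  have dG2 : ∀ q, Dep (V q) {ω | Cn (Op ω) U (q.1 + ev i) (q.2 + ev i)} := fun q =>
    (dep_Cn _ _ _).mono Set.subset_union_right
  have dGe1 : ∀ q, Dep (V q) {ω : Sym2 (ZVec d) → Bool | ω s(q.1, q.1 + ev i) = true} := fun q =>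
    dEd _ _ (Or.inl (Or.inl rfl))
  have dGe2 : ∀ q, Dep (V q) {ω : Sym2 (ZVec d) → Bool | ω s(q.2, q.2 + ev i) = true} := fun q =>
    dEd _ _ (Or.inl (Or.inr rfl))
  have dG : ∀ q, Dep (V q) (G q) := fun q => (dGe1 q).inter ((dGe2 q).inter (dG2 q))
  have dE : ∀ q, Dep (inner R) (E q) := by
    intro q
    refine (dep_SlFail (by omega) a b).inter ?_
    intro ω ω' h h1
    simp only [Set.mem_ofPred_eq] at h1 ⊢
    rwa [← hA a ω ω' h, ← hA b ω ω' h]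
  have hp0 : (0 : ℝ) ≤ p := p.2.1
  set T : Finset (ZVec d × ZVec d) := (hSf.toFinset ×ˢ hSf.toFinset).filter
    fun q => q.1 i = β ∧ q.2 i = β with hT
  have hTm : ∀ q, q ∈ T ↔ (q.1 ∈ S ∧ q.2 ∈ S) ∧ q.1 i = β ∧ q.2 i = β := fun q => by
    simp [hT]
  have hG : ∀ q ∈ T, p * (p * c) ≤ P.real (G q) := by
    intro q hq
    obtain ⟨⟨h1, h2⟩, h3, h4⟩ := (hTm q).1 hq
    have e1 : ∀ x : ZVec d, x i = β → (x + ev i) i = β + 1 := fun x hx => by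
      simp [ev_self, hx]
    have e2 : ∀ x : ZVec d, ∀ l, l ≠ i → (x + ev i) l = x l := fun x l hl => by simp [ev_ne hl]
    have h5 := H i (β + 1) M (q.1 + ev i) (q.2 + ev i) (e1 _ h3) (e1 _ h4)
      (fun l hl => by rw [e2 _ _ hl]; exact h1.2.2 l hl)
      (fun l hl => by rw [e2 _ _ hl]; exact h2.2.2 l hl)
    have h6 := bern_harris (fun _ : Sym2 (ZVec d) => p) (hVf q) (dGe2 q) (dG2 q) (iEd _)
      (incr_Cn _ _ _)
    have h7 := bern_harris (fun _ : Sym2 (ZVec d) => p) (hVf q) (dGe1 q) ((dGe2 q).inter (dG2 q))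
      (iEd _) ((iEd _).inter (incr_Cn _ _ _))
    rw [prob_edge] at h6 h7
    refine le_trans ?_ h7
    exact mul_le_mul_of_nonneg_left ((mul_le_mul_of_nonneg_left h5 hp0).trans h6) hp0
  have hdisj : ∀ q ∈ T, Disjoint (inner R) (V q) := by
    intro q hq
    obtain ⟨⟨h1, h2⟩, h3, h4⟩ := (hTm q).1 hq
    have e1 : ∀ x : ZVec d, x i = β → s(x, x + ev i) ∉ inner R := fun x hx hmem => by
      have h6 : (x + ev i) i ≤ β := (mem_inner.1 hmem).2.2.1
      simp [ev_self, hx] at h6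
    rw [Set.disjoint_left]
    intro e he hV
    rcases hV with (rfl | rfl) | hV
    · exact e1 _ h3 he
    · exact e1 _ h4 he
    · induction e using Sym2.ind with
      | _ u v =>
        have h6 : u i ≤ β := (mem_inner.1 he).1.2.1
        have h7 : β + 1 ≤ u i := (mem_inner.1 hV).1.1
        omega
  have hsub : SlFail i α (β + 1 + h) M (7 * M + h) a b ⊆ ⋃ q ∈ T, E q ∩ (G q)ᶜ := by
    intro ω hω
    obtain ⟨hω1, hω2, hω3⟩ := hω
    obtain ⟨x, hx⟩ := SlFail_climb (β := β) (by omega) ha hω1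
    obtain ⟨y, hy⟩ := SlFail_climb (β := β) (by omega) hb hω2
    have hx' : pick (A a ω) ∈ A a ω := pick_mem _ ⟨x, hx⟩
    have hy' : pick (A b ω) ∈ A b ω := pick_mem _ ⟨y, hy⟩
    have hR' : R ⊆ Sl i α (β + 1 + h) (7 * M + h) := Sl_mono le_rfl (by omega) le_rfl
    refine Set.mem_iUnion₂.2 ⟨(pick (A a ω), pick (A b ω)), (hTm _).2
      ⟨⟨hx'.2.right_mem, hy'.2.right_mem⟩, hx'.1, hy'.1⟩, ⟨⟨⟨x, hx⟩, ⟨y, hy⟩, fun h1 =>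
        hω3 (h1.mono hR')⟩, rfl, rfl⟩, ?_⟩
    rintro ⟨g1, g2, g3⟩
    simp only [Set.mem_ofPred_eq] at g1 g2 g3
    refine hω3 ?_
    have hS' : S ⊆ Sl i α (β + 1 + h) (7 * M + h) := hSR.trans hR'
    have hα : α ≤ β + 1 := by have := hx'.2.right_mem; linarith [this.1, this.2.1]
    have k1 := hx'.2.mono hS'
    have k2 := (hy'.2.mono hS').symm fun _ _ => Op.symm
    have k3 := g3.mono (Sl_mono (i := i) hα le_rfl le_rfl)
    exact ((k1.tail ⟨adj_ev _ _, g1⟩ k3.1).trans k3).trans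
      (Cn.head k3.right_mem ⟨(adj_ev _ _).symm, by rw [Sym2.eq_swap]; exact g2⟩ k2)
  have hE : (⋃ q ∈ T, E q) ⊆ SlFail i α β M (7 * M + h) a b :=
    Set.iUnion₂_subset fun q _ => Set.inter_subset_left
  have hc : p * (p * c) ≤ 1 := by
    have hc1 : c ≤ 1 := (H i 0 0 0 0 rfl rfl (by simp) (by simp)).trans measureReal_le_one
    have := p.2.2
    have h1 : (p : ℝ) * c ≤ 1 := mul_le_one₀ this hc0.le hc1
    exact mul_le_one₀ this (by positivity) h1
  refine (measureReal_mono hsub (measure_ne_top _ _)).trans ?_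
  refine (partition_upper_mul P T (c := 1 - p * (p * c)) ?_ ?_ ?_).trans
    (mul_le_mul_of_nonneg_left (measureReal_mono hE (measure_ne_top _ _)) (by linarith))
  · intro q hq
    have mG := (dG q).measurable_of_finite (hVf q)
    rw [hP, bern_indep_real _ (hdisj q hq) (dE q) (dG q).compl
      ((dE q).measurable_of_finite (inner_finite hRf)) mG.compl, mul_comm]
    refine mul_le_mul_of_nonneg_right ?_ measureReal_nonneg
    rw [probReal_compl_eq_one_sub mG]
    linarith [hG q hq]
  · intro q _ q' _ hqq
    refine Set.disjoint_left.2 fun ω h1 h2 => hqq ?_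
    exact Prod.ext (h1.2.1.symm.trans h2.2.1) (h1.2.2.symm.trans h2.2.2)
  · exact fun q _ => (dE q).measurable_of_finite (inner_finite hRf)

theorem slab_unique {p : unitInterval} (hd : 3 ≤ d) (hp : pc d < p) (hp1 : (p : ℝ) < 1) :
    ∃ h : ℕ, ∃ θ : ℝ, 0 ≤ θ ∧ θ < 1 ∧ ∀ (i : Fin d) (α M : ℤ) (k : ℕ) (a b : ZVec d), 0 ≤ M →
      a i = α → b i = α → (bern fun _ : Sym2 (ZVec d) => p).real
        (SlFail i α (α + k * (h + 1)) M (7 * M + h) a b) ≤ θ ^ k := by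
  have hp0 : (0 : ℝ) < p := (Real.sSup_nonneg fun x hx => hx.1 : (0 : ℝ) ≤ pc d).trans_lt hp
  obtain ⟨h, c, hc0, hc1, H⟩ := slab_connect hd hp hp1
  have hc : p * (p * c) ≤ 1 := mul_le_one₀ p.2.2 (by positivity) (mul_le_one₀ p.2.2 hc0.le hc1)
  have hc' : 0 < p * (p * c) := by positivity
  refine ⟨h, 1 - p * (p * c), by linarith, by linarith, fun i α M k a b hM ha hb => ?_⟩
  induction k with
  | zero => simp
  | succ k ih =>
    have h1 := slab_step hc0 H i (α := α) (β := α + k * (h + 1)) hM a b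
      (by rw [ha]; nlinarith [Int.natCast_nonneg k, Int.natCast_nonneg h])
      (by rw [hb]; nlinarith [Int.natCast_nonneg k, Int.natCast_nonneg h])
    have h2 : α + ((k + 1 : ℕ) : ℤ) * (h + 1) = α + k * (h + 1) + 1 + h := by push_cast; ring
    rw [h2, pow_succ']
    exact h1.trans (mul_le_mul_of_nonneg_left ih (by linarith))

end

section
variable {d : ℕ}

/-! ### Crossing paths in the plane -/

theorem Cn.level_cross {O : ZVec d → ZVec d → Prop} {R : Set (ZVec d)} {i : Fin d}
    (hO : ∀ a b, O a b → |a i - b i| ≤ 1) {u w : ZVec d} (h : Cn O R u w) {α β : ℤ} (hαβ : α < β)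
    (hu : u i ≤ α) (hw : β ≤ w i) : ∃ a b, Cn O R u a ∧ a i = α ∧ b i = β ∧
      Cn O (R ∩ {v | α ≤ v i ∧ v i ≤ β}) a b := by
  obtain ⟨a, b, h1, h2, h3, h4, h5⟩ := h.last_exit (S := {v | v i ≤ α}) (by simpa using hu)
    (by simp only [Set.mem_ofPred_eq]; omega)
  have h6 := abs_le.1 (hO _ _ h4)
  simp only [Set.mem_ofPred_eq] at h2 h3
  have h7 : Cn O (R ∩ {v | α ≤ v i}) a w := by
    refine Cn.head ⟨h1.right_mem, ?_⟩ h4 (h5.mono ?_)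
    · simp only [Set.mem_ofPred_eq]; omega
    · rintro v ⟨hv1, hv2⟩
      simp only [Set.mem_ofPred_eq] at hv2
      exact ⟨hv1, by simp only [Set.mem_ofPred_eq]; omega⟩
  obtain ⟨a', b', k1, k2, k3, k4⟩ := h7.first_exit (S := {v | v i < β})
    (by simp only [Set.mem_ofPred_eq]; omega) (by simp only [Set.mem_ofPred_eq]; omega)
  have k5 := abs_le.1 (hO _ _ k3)
  have k6 := k1.right_mem.2
  have k7 := k4.right_mem
  simp only [Set.mem_ofPred_eq] at k2 k6
  refine ⟨a, b', h1, by omega, by omega, (k1.mono ?_).tail k3 ⟨k7.1, k7.2, by omega⟩⟩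
  rintro v ⟨⟨hv1, hv2⟩, hv3⟩
  simp only [Set.mem_ofPred_eq] at hv2 hv3
  exact ⟨hv1, hv2, hv3.le⟩

theorem exists_side {i j : Fin d} (hij : i ≠ j) (hl : ∀ l, l = i ∨ l = j) {R : Set (ZVec d)}
    {B₁ B₂ : ℤ} (hR : ∀ v ∈ R, B₁ ≤ v i ∧ v i ≤ B₂) {a b : ZVec d} (h : Cn (Adj d) R a b) :
    ∃ f : ZVec d → ZMod 2,
      (∀ v, v + ev i ∉ R → f (v + ev i) = f v + (if v i + 1 = b i ∧ b j ≤ v j then 1 else 0) +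
        (if v i + 1 = a i ∧ v j < a j then 1 else 0)) ∧
      (∀ v, v + ev j ∉ R → f (v + ev j) = f v) ∧
      (∀ v, v i < B₁ → f v = 0) ∧ ∀ v, B₂ ≤ v i → f v = 1 := by
  have hext : ∀ v w : ZVec d, v i = w i → v j = w j → v = w := fun v w h1 h2 => by
    funext l
    rcases hl l with rfl | rfl <;> assumption
  have eii : ∀ v : ZVec d, (v + ev i) i = v i + 1 := fun v => by simp [ev_self]
  have eij : ∀ v : ZVec d, (v + ev i) j = v j := fun v => by simp [ev_ne hij.symm]
  have eji : ∀ v : ZVec d, (v + ev j) i = v i := fun v => by simp [ev_ne hij]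
  have ejj : ∀ v : ZVec d, (v + ev j) j = v j + 1 := fun v => by simp [ev_self]
  have h2 : ∀ x : ZMod 2, x + x = 0 := CharTwo.add_self_eq_zero
  induction h using Cn.induct with
  | h0 ha =>
    refine ⟨fun v => if a i ≤ v i then 1 else 0, fun v hv => ?_, fun v hv => ?_, fun v hv => ?_,
      fun v hv => ?_⟩
    · simp only [eii]
      have := hR a ha
      split_ifs <;> first | omega | simp
    · simp only [eji]
    · have := hR a ha
      exact if_neg (by omega)
    · have := hR a ha
      exact if_pos (by omega)
  | h1 b b' hb hbb hb' ih =>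
    obtain ⟨f, f1, f2, f3, f4⟩ := ih
    have hbR := hR b hb.right_mem
    have hbR' := hR b' hb'
    obtain ⟨l, hbl⟩ := hbb.exists_ev
    rcases hl l with rfl | rfl
    · set β := min (b l) (b' l) with hβ
      have hj : b' j = b j := by
        rcases hbl with rfl | rfl <;> simp [ev_ne hij.symm]
      have hi : (β = b l ∧ b' l = b l + 1) ∨ (β = b' l ∧ b l = b' l + 1) := by
        rcases hbl with rfl | rfl
        · left; simp [ev_self, hβ]
        · right; simp [ev_self, hβ]
      refine ⟨fun v => f v + if v l = β ∧ b j ≤ v j then 1 else 0, fun v hv => ?_, fun v hv => ?_,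
        fun v hv => ?_, fun v hv => ?_⟩
      · simp only [eii, eij, f1 v hv, hj]
        generalize f v = x
        generalize (if v l + 1 = a l ∧ v j < a j then (1 : ZMod 2) else 0) = y
        rcases hi with ⟨hi, hi'⟩ | ⟨hi, hi'⟩
        · rw [hi, hi']
          simp only [add_left_inj]
          linear_combination h2 (if v l + 1 = b l ∧ b j ≤ v j then 1 else 0) -
            h2 (if v l = b l ∧ b j ≤ v j then 1 else 0)
        · rw [hi, hi']
          simp only [add_left_inj]
          ring
      · simp only [eji, ejj, f2 v hv]
        congr 1
        have hne : ¬ (v l = β ∧ v j + 1 = b j) := by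
          rintro ⟨k1, k2⟩
          refine hv ?_
          rcases hi with ⟨hi, hi'⟩ | ⟨hi, hi'⟩
          · rw [hext (v + ev j) b (by rw [eji]; omega) (by rw [ejj]; omega)]; exact hb.right_mem
          · rw [hext (v + ev j) b' (by rw [eji]; omega) (by rw [ejj]; omega)]; exact hb'
        split_ifs <;> first | rfl | omega
      · simp only [f3 v hv]
        rw [if_neg (by omega), add_zero]
      · simp only [f4 v hv]
        rw [if_neg (by omega), add_zero]
    · refine ⟨f, fun v hv => ?_, f2, f3, f4⟩
      rw [f1 v hv]
      congr 2
      have hi : b' i = b i := by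
        rcases hbl with rfl | rfl <;> simp [ev_ne hij]
      have hne : ∀ w ∈ R, ¬ (v i + 1 = w i ∧ v l = w l) := by
        rintro w hw ⟨k1, k2⟩
        exact hv ((hext (v + ev i) w (by rw [eii]; omega) (by rw [eij]; omega)) ▸ hw)
      have n1 := hne b hb.right_mem
      have n2 := hne b' hb'
      have hj : b' l = b l + 1 ∨ b l = b' l + 1 := by
        rcases hbl with rfl | rfl <;> simp [ev_self]
      split_ifs <;> first | rfl | omega

/-- A path crossing a planar strip lengthwise meets every path crossing it transversally. -/
theorem exists_meet {i j : Fin d} (hij : i ≠ j) (hl : ∀ l, l = i ∨ l = j) {R S : Set (ZVec d)}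
    {A₁ A₂ B₁ B₂ : ℤ} (hR : ∀ v ∈ R, B₁ ≤ v i ∧ v i ≤ B₂) (hS : ∀ v ∈ S, A₁ ≤ v j ∧ v j < A₂)
    {a b x y : ZVec d} (h : Cn (Adj d) R a b) (ha : a j ≤ A₁) (hb : A₂ ≤ b j)
    (h' : Cn (Adj d) S x y) (hx : x i < B₁) (hy : B₂ ≤ y i) : ∃ v ∈ R, v ∈ S := by
  by_contra! hcon
  obtain ⟨f, f1, f2, f3, f4⟩ := exists_side hij hl hR h
  have key : f y = f x := by
    clear hy
    induction h' using Cn.induct with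
    | h0 _ => rfl
    | h1 u w hu huw hw ih =>
      rw [← ih]
      have e : ∀ v, v + ev i ∉ R → v ∈ S → f (v + ev i) = f v := fun v hv hvS => by
        have := hS v hvS
        rw [f1 v hv, if_neg (by omega), if_neg (by omega), add_zero, add_zero]
      obtain ⟨l, h | h⟩ := huw.exists_ev
      · rcases hl l with rfl | rfl
        · rw [h]; exact e u (fun h1 => hcon _ h1 (h ▸ hw)) hu.right_mem
        · rw [h]; exact f2 u fun h1 => hcon _ h1 (h ▸ hw)
      · have hu' := hu.right_mem
        rcases hl l with rfl | rfl
        · rw [h]; exact (e w (fun h1 => hcon _ h1 (h ▸ hu')) hw).symm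
        · rw [h]; exact (f2 w fun h1 => hcon _ h1 (h ▸ hu')).symm
  rw [f3 x hx, f4 y hy] at key
  exact one_ne_zero key

end

section
variable {d : ℕ}

/-! ### Good boxes -/

/-- The cluster of `u` in the ball of radius `4K` around `z` is wide. -/
def Big (ω : Sym2 (ZVec d) → Bool) (K : ℤ) (z u : ZVec d) : Prop :=
  ∃ w i, Cn (Op ω) (Bs (4 * K) z) u w ∧ K ≤ |u i - w i|

/-- There is a wide cluster and it is locally unique. -/
def Good (ω : Sym2 (ZVec d) → Bool) (K : ℤ) (z : ZVec d) : Prop :=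
  (∃ u w i, Cn (Op ω) (Bs (2 * K) z) u w ∧ K ≤ |u i - w i|) ∧
    ∀ u u', Big ω K z u → Big ω K z u' → Cn (Op ω) (Bs (50 * K) z) u u'

theorem Good.congr {ω ω' : Sym2 (ZVec d) → Bool} {K : ℤ} {z z' : ZVec d} (c : ZVec d)
    (h : ∀ r x y, Cn (Op ω) (Bs (r * K) z) x y ↔ Cn (Op ω') (Bs (r * K) z') (x + c) (y + c)) :
    Good ω K z ↔ Good ω' K z' := by
  have hB : ∀ u, Big ω K z u ↔ Big ω' K z' (u + c) := by
    intro u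
    constructor
    · rintro ⟨w, i, h1, h2⟩
      exact ⟨w + c, i, (h _ _ _).1 h1, by simpa using h2⟩
    · rintro ⟨w, i, h1, h2⟩
      refine ⟨w - c, i, (h _ _ _).2 (by simpa using h1), ?_⟩
      rw [show u i - (w - c) i = (u + c) i - w i by simp; ring]
      exact h2
  constructor
  · rintro ⟨⟨u, w, i, h1, h2⟩, h3⟩
    refine ⟨⟨u + c, w + c, i, (h _ _ _).1 h1, by simpa using h2⟩, fun u u' hu hu' => ?_⟩
    have := (h _ _ _).1 (h3 (u - c) (u' - c) ((hB _).2 (by simpa using hu))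
      ((hB _).2 (by simpa using hu')))
    simpa using this
  · rintro ⟨⟨u, w, i, h1, h2⟩, h3⟩
    refine ⟨⟨u - c, w - c, i, (h _ _ _).2 (by simpa using h1), by simpa using h2⟩,
      fun u u' hu hu' => ?_⟩
    exact (h _ _ _).2 (h3 _ _ ((hB _).1 hu) ((hB _).1 hu'))

theorem dep_Good {K : ℤ} (hK : 0 ≤ K) (z : ZVec d) :
    Dep (inner (Bs (50 * K) z)) {ω | Good ω K z} := by
  intro ω ω' h hG
  refine ⟨?_, ?_⟩
  · obtain ⟨⟨u, w, i, h1, h2⟩, -⟩ := hG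
    refine ⟨u, w, i, dep_Cn _ _ _ ω ω' (fun e he => h e ?_) h1, h2⟩
    exact inner_mono (Finset.coe_subset.2 (Bx_mono (by linarith) _)) he
  · obtain ⟨-, h3⟩ := hG
    have hB : ∀ u, Big ω' K z u → Big ω K z u := fun u ⟨w, i, h1, h2⟩ =>
      ⟨w, i, dep_Cn _ _ _ ω' ω (fun e he => (h e
        (inner_mono (Finset.coe_subset.2 (Bx_mono (by linarith) _)) he)).symm) h1, h2⟩
    exact fun u u' hu hu' => dep_Cn _ _ _ ω ω' h (h3 u u' (hB _ hu) (hB _ hu'))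

theorem measurableSet_Good {K : ℤ} (hK : 0 ≤ K) (z : ZVec d) : MeasurableSet {ω | Good ω K z} :=
  (dep_Good hK z).measurable_of_finite (inner_finite (Finset.finite_toSet _))

theorem prob_Good_translate (p : unitInterval) {K : ℤ} (hK : 0 ≤ K) (z : ZVec d) :
    (bern fun _ : Sym2 (ZVec d) => p).real {ω | ¬ Good ω K z} =
      (bern fun _ : Sym2 (ZVec d) => p).real {ω | ¬ Good ω K 0} := by
  refine Eq.trans ?_ (bern_aut p (Equiv.addRight z) (measurableSet_Good hK 0).compl)
  congr 1
  ext ω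
  refine not_congr (Good.congr (ω := fun e => ω (Sym2.map (Equiv.addRight z) e)) (z := 0) z
    fun r x y => ?_).symm
  exact Cn_aut (τ := Equiv.addRight z) (fun a b => adj_add_right z a b)
    (fun a => by simp [mem_Bx])

theorem connect_box {p : unitInterval} (hd : 0 < d) (hp : pc d < p) (hp1 : (p : ℝ) < 1) {η : ℝ}
    (h0 : 0 < η) : ∃ n0 : ℕ, ∀ n, n0 ≤ n → ∀ z c : ZVec d, (∀ l, 0 ≤ z l ∧ z l ≤ 200) →
      (bern fun _ : Sym2 (ZVec d) => p).real {ω | ¬ ∃ a ∈ Bx n c, ∃ y ∈ Bx n ((n : ℤ) • z + c),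
        Cn (Op ω) {v | v - c ∈ Reg n (Finset.Icc 0 z)} a y} ≤ η := by
  obtain ⟨n0, h⟩ := connect_along hd hp hp1 h0 (Finset.Icc (0 : ZVec d) fun _ => 200).card
  refine ⟨n0, fun n hn z c hz => ?_⟩
  have h1 := h n hn (Finset.Icc 0 z)
    (Finset.card_le_card (Finset.Icc_subset_Icc_right fun l => (hz l).2)) z (by
      rw [Finset.coe_Icc]
      exact Cn_Icc (Set.left_mem_Icc.2 fun l => (hz l).1) (Set.right_mem_Icc.2 fun l => (hz l).1))
  rw [← bern_connect_translate p (Reg_finite n _) c, zero_add] at h1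
  exact h1

theorem mem_Reg_Icc {n : ℕ} {z v : ZVec d} (h : v ∈ Reg n (Finset.Icc 0 z)) (l : Fin d) :
    -(4 * n) ≤ v l ∧ v l ≤ n * z l + 4 * n := by
  obtain ⟨w, hw, hv⟩ := Set.mem_iUnion₂.1 h
  have h1 := abs_le.1 (mem_Bs.1 hv l)
  have h2 := Finset.mem_Icc.1 hw
  have h3 : 0 ≤ w l := h2.1 l
  have h4 : w l ≤ z l := h2.2 l
  simp only [Pi.smul_apply, smul_eq_mul] at h1
  have h5 : (n : ℤ) * w l ≤ n * z l := mul_le_mul_of_nonneg_left h4 (by positivity)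
  have h6 : 0 ≤ (n : ℤ) * w l := by positivity
  constructor <;> linarith

/-- A long path in direction `i` in a thin tube. -/
def Tube (ω : Sym2 (ZVec d) → Bool) (n : ℕ) (i : Fin d) (c a y : ZVec d) : Prop :=
  a i ≤ c i - 99 * n ∧ c i + 99 * n ≤ y i ∧
    Cn (Op ω) {v | (∀ l, l ≠ i → |v l - c l| ≤ 4 * n) ∧ |v i - c i| ≤ 104 * n} a y

theorem prob_Tube {p : unitInterval} (hd : 0 < d) (hp : pc d < p) (hp1 : (p : ℝ) < 1) {η : ℝ}
    (h0 : 0 < η) : ∃ n0 : ℕ, ∀ n, n0 ≤ n → ∀ i c,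
      (bern fun _ : Sym2 (ZVec d) => p).real {ω | ¬ ∃ a y, Tube ω n i c a y} ≤ η := by
  obtain ⟨n0, h⟩ := connect_box hd hp hp1 h0
  refine ⟨n0, fun n hn i c => ?_⟩
  have ei : ∀ k : ℤ, (k • ev i : ZVec d) i = k := fun k => by simp [ev_self]
  have el : ∀ (k : ℤ) (l : Fin d), l ≠ i → (k • ev i : ZVec d) l = 0 := fun k l hl => by
    simp [ev_ne hl]
  refine (measureReal_mono ?_ (measure_ne_top _ _)).trans
    (h n hn ((200 : ℤ) • ev i) (c - (100 * n : ℤ) • ev i) fun l => ?_)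
  · refine fun ω hω h1 => hω ?_
    obtain ⟨a, ha, y, hy, h1⟩ := h1
    have ha := abs_le.1 (mem_Bx.1 ha i)
    have hy := abs_le.1 (mem_Bx.1 hy i)
    simp only [Pi.sub_apply, Pi.add_apply, Pi.smul_apply, smul_eq_mul, ev_self] at ha hy
    refine ⟨a, y, by linarith, by linarith, h1.mono fun v hv => ⟨fun l hl => ?_, ?_⟩⟩
    · have h2 := mem_Reg_Icc hv l
      rw [el _ _ hl, Pi.sub_apply, Pi.sub_apply, el _ _ hl] at h2
      rw [abs_le]; constructor <;> linarith
    · have h2 := mem_Reg_Icc hv i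
      rw [ei, Pi.sub_apply, Pi.sub_apply, ei] at h2
      rw [abs_le]; constructor <;> linarith
  · by_cases hl : l = i
    · subst hl; rw [ei]; omega
    · rw [el _ _ hl]; omega

theorem prob_diag {p : unitInterval} (hd : 0 < d) (hp : pc d < p) (hp1 : (p : ℝ) < 1) {η : ℝ}
    (h0 : 0 < η) : ∃ n0 : ℕ, ∀ n : ℕ, n0 ≤ n → (bern fun _ : Sym2 (ZVec d) => p).real
      {ω | ¬ ∃ a y : ZVec d, (∀ i, a i ≤ - (99 * n)) ∧ (∀ i, 99 * n ≤ y i) ∧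
        Cn (Op ω) (Bs (104 * n) 0) a y} ≤ η := by
  obtain ⟨n0, h⟩ := connect_box hd hp hp1 h0
  refine ⟨n0, fun n hn => ?_⟩
  refine (measureReal_mono ?_ (measure_ne_top _ _)).trans
    (h n hn (fun _ => 200) (fun _ => - (100 * n)) fun l => by simp)
  refine fun ω hω h1 => hω ?_
  obtain ⟨a, ha, y, hy, h1⟩ := h1
  refine ⟨a, y, fun i => ?_, fun i => ?_, h1.mono fun v hv => mem_Bs.2 fun l => ?_⟩
  · have ha := abs_le.1 (mem_Bx.1 ha i)
    linarith
  · have hy := abs_le.1 (mem_Bx.1 hy i)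
    simp only [Pi.add_apply, Pi.smul_apply, smul_eq_mul] at hy
    linarith
  · have h2 := mem_Reg_Icc hv l
    rw [Pi.sub_apply] at h2
    rw [abs_le, Pi.zero_apply]; constructor <;> linarith

theorem Op.abs_le {ω : Sym2 (ZVec d) → Bool} {a b : ZVec d} (h : Op ω a b) (i : Fin d) :
    |a i - b i| ≤ 1 := h.1.abs_le i

theorem Tube.wide {ω : Sym2 (ZVec d) → Bool} {n : ℕ} (hn : 0 < n) {i : Fin d} {a y : ZVec d}
    (h : Tube ω n i 0 a y) : ∃ u w i, Cn (Op ω) (Bs (2 * (20 * (n : ℤ))) 0) u w ∧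
      20 * (n : ℤ) ≤ |u i - w i| := by
  obtain ⟨h1, h2, h3⟩ := h
  simp only [Pi.zero_apply] at h1 h2
  obtain ⟨u, w, -, hu, hw, h4⟩ := h3.level_cross (fun _ _ h => h.abs_le i) (α := -(20 * n))
    (β := 20 * n) (by omega) (by linarith) (by linarith)
  refine ⟨u, w, i, h4.mono ?_, ?_⟩
  · rintro v ⟨⟨hv1, -⟩, hv2⟩
    refine mem_Bs.2 fun l => ?_
    by_cases hl : l = i
    · subst hl; simp only [Set.mem_ofPred_eq] at hv2
      rw [_root_.abs_le, Pi.zero_apply]; constructor <;> linarith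
    · exact (hv1 l hl).trans (by linarith)
  · rw [hu, hw, abs_sub_comm]; exact (le_abs_self _).trans' (by linarith)

theorem Big.cross {ω : Sym2 (ZVec d) → Bool} {n : ℕ} {u : ZVec d} (h : Big ω (20 * (n : ℤ)) 0 u) :
    ∃ i s, -(80 * (n : ℤ)) ≤ s ∧ s + 20 * n ≤ 80 * n ∧ ∃ x y, x i ≤ s ∧ s + 20 * n ≤ y i ∧
      Cn (Op ω) (Bs (80 * n) 0) x y ∧ Cn (Op ω) (Bs (80 * n) 0) u x := by
  obtain ⟨w, i, h1, h2⟩ := h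
  have e : (4 * (20 * (n : ℤ))) = 80 * n := by ring
  rw [e] at h1
  have hu := _root_.abs_le.1 (mem_Bs.1 h1.1 i)
  have hw := _root_.abs_le.1 (mem_Bs.1 h1.right_mem i)
  simp only [Pi.zero_apply, sub_zero] at hu hw
  rcases le_abs'.1 h2 with h3 | h3
  · exact ⟨i, u i, hu.1, by linarith, u, w, le_rfl, by linarith, h1, Cn.refl h1.1⟩
  · exact ⟨i, w i, hw.1, by linarith, w, u, le_rfl, by linarith, h1.symm fun _ _ => Op.symm, h1⟩

end

section
variable {d : ℕ}

theorem meet_Cn {ω : Sym2 (ZVec d) → Bool} {i j : Fin d} (hij : i ≠ j) (hl : ∀ l, l = i ∨ l = j)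
    {R S U : Set (ZVec d)} {A₁ A₂ B₁ B₂ : ℤ} (hR : ∀ v ∈ R, B₁ ≤ v i ∧ v i ≤ B₂)
    (hS : ∀ v ∈ S, A₁ ≤ v j ∧ v j < A₂) {a b x y : ZVec d} (h : Cn (Op ω) R a b) (ha : a j ≤ A₁)
    (hb : A₂ ≤ b j) (h' : Cn (Op ω) S x y) (hx : x i < B₁) (hy : B₂ ≤ y i) (hRU : R ⊆ U)
    (hSU : S ⊆ U) : Cn (Op ω) U x a := by
  obtain ⟨v, hv1, hv2⟩ := exists_meet hij hl (R := {w | Cn (Op ω) R a w})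
    (S := {w | Cn (Op ω) S x w}) (fun v hv => hR v hv.right_mem) (fun v hv => hS v hv.right_mem)
    (h.self_trace.mono_in le_rfl fun _ _ _ _ h => h.1) ha hb
    (h'.self_trace.mono_in le_rfl fun _ _ _ _ h => h.1) hx hy
  exact (Cn.mono hv2 hSU).trans ((Cn.mono hv1 hRU).symm fun _ _ => Op.symm)

theorem unique_of_tubes {ω : Sym2 (ZVec d) → Bool} {n : ℕ} (hn : 0 < n) {i₀ j₀ : Fin d}
    (hl₀ : ∀ l, l = i₀ ∨ l = j₀) (hij₀ : i₀ ≠ j₀)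
    (h : ∀ i j : Fin d, i ≠ j → ∀ m : ℤ, |m| ≤ 9 → ∃ a y, Tube ω n j ((10 * n * m) • ev i) a y)
    {u u' : ZVec d} (hu : Big ω (20 * (n : ℤ)) 0 u) (hu' : Big ω (20 * (n : ℤ)) 0 u') :
    Cn (Op ω) (Bs (50 * (20 * (n : ℤ))) 0) u u' := by
  have hn' : (1 : ℤ) ≤ n := by exact_mod_cast hn
  choose! a y hay using h
  have hl : ∀ i j : Fin d, i ≠ j → ∀ l, l = i ∨ l = j := by
    intro i j hij l
    rcases hl₀ i with rfl | rfl <;> rcases hl₀ j with rfl | rfl <;> rcases hl₀ l with rfl | rfl <;>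
      simp_all
  have hmn : ∀ m : ℤ, |m| ≤ 9 → -(90 * (n : ℤ)) ≤ 10 * n * m ∧ 10 * n * m ≤ 90 * n := by
    intro m hm
    have := abs_le.1 hm
    constructor <;> nlinarith
  let R : Fin d → Fin d → ℤ → Set (ZVec d) := fun i j m =>
    {v | |v i - 10 * n * m| ≤ 4 * n ∧ |v j| ≤ 104 * n}
  have hT : ∀ i j : Fin d, i ≠ j → ∀ m : ℤ, |m| ≤ 9 → a i j m j ≤ -(99 * n) ∧ 99 * n ≤ y i j m j ∧
      Cn (Op ω) (R i j m) (a i j m) (y i j m) := by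
    intro i j hij m hm
    obtain ⟨h1, h2, h3⟩ := hay i j hij m hm
    have e1 : ((10 * (n : ℤ) * m) • ev i : ZVec d) j = 0 := by simp [ev_ne hij.symm]
    have e2 : ((10 * (n : ℤ) * m) • ev i : ZVec d) i = 10 * n * m := by simp [ev_self]
    rw [e1] at h1 h2
    refine ⟨by linarith, by linarith, h3.mono fun v hv => ⟨?_, ?_⟩⟩
    · have := hv.1 i hij
      rwa [e2] at this
    · have := hv.2
      rwa [e1, sub_zero] at this
  set U := Bs (50 * (20 * (n : ℤ))) (0 : ZVec d) with hU
  have hRU : ∀ i j : Fin d, i ≠ j → ∀ m : ℤ, |m| ≤ 9 → R i j m ⊆ U := by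
    rintro i j hij m hm v ⟨hv1, hv2⟩
    have := hmn m hm
    refine mem_Bs.2 fun l => ?_
    rw [Pi.zero_apply, sub_zero]
    rw [abs_le] at hv1 hv2 ⊢
    rcases hl i j hij l with rfl | rfl <;> constructor <;> linarith
  have hperp : ∀ i j : Fin d, i ≠ j → ∀ m m' : ℤ, |m| ≤ 9 → |m'| ≤ 9 →
      Cn (Op ω) U (a j i m') (a i j m) := by
    intro i j hij m m' hm hm'
    obtain ⟨h1, h2, h3⟩ := hT i j hij m hm
    obtain ⟨k1, k2, k3⟩ := hT j i hij.symm m' hm'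
    have b1 := hmn m hm
    have b2 := hmn m' hm'
    refine meet_Cn hij (hl i j hij) (A₁ := -(99 * n)) (A₂ := 99 * n) (B₁ := 10 * n * m - 4 * n)
      (B₂ := 10 * n * m + 4 * n) (fun v hv => ?_) (fun v hv => ?_) h3 h1 h2 k3
      (by linarith) (by linarith) (hRU i j hij m hm) (hRU j i hij.symm m' hm')
    · have := abs_le.1 hv.1
      constructor <;> linarith
    · have := abs_le.1 hv.1
      constructor <;> linarith
  have hbig : ∀ u, Big ω (20 * (n : ℤ)) 0 u → ∃ i j : Fin d, i ≠ j ∧ ∃ m : ℤ, |m| ≤ 9 ∧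
      Cn (Op ω) U u (a i j m) := by
    intro u hu
    obtain ⟨i, s, hs1, hs2, x, x', hx, hx', h1, h2⟩ := hu.cross
    obtain ⟨j, hij⟩ : ∃ j, i ≠ j := by
      rcases hl₀ i with rfl | rfl
      exacts [⟨_, hij₀⟩, ⟨_, hij₀.symm⟩]
    set m := (s + 15 * n) / (10 * n) with hm
    have e1 := Int.ediv_mul_add_emod (s + 15 * n) (10 * n)
    have e2 := Int.emod_nonneg (s + 15 * n) (b := 10 * (n : ℤ)) (by omega)
    have e3 := Int.emod_lt_of_pos (s + 15 * n) (b := 10 * (n : ℤ)) (by omega)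
    rw [← hm] at e1
    have m1 : 10 * n * m ≤ s + 15 * n := by linarith
    have m2 : s + 5 * n < 10 * n * m := by linarith
    have hm9 : |m| ≤ 9 := by
      rw [abs_le]
      constructor
      · by_contra! hcon
        have : m ≤ -10 := by omega
        nlinarith
      · by_contra! hcon
        have : 10 ≤ m := by omega
        nlinarith
    have hmb := hmn m hm9
    obtain ⟨v, w, k1, k2, k3, k4⟩ := h1.level_cross (fun _ _ h => h.abs_le i)
      (α := 10 * n * m - 5 * n) (β := 10 * n * m + 5 * n) (by linarith) (by linarith) (by linarith)
    obtain ⟨t1, t2, t3⟩ := hT i j hij m hm9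
    have h80 : Bs (80 * (n : ℤ)) (0 : ZVec d) ⊆ U :=
      Finset.coe_subset.2 (Bx_mono (by linarith) _)
    refine ⟨i, j, hij, m, hm9, ((h2.mono h80).trans (k1.mono h80)).trans
      (meet_Cn hij (hl i j hij) (A₁ := -(99 * n)) (A₂ := 99 * n) (B₁ := 10 * n * m - 4 * n)
      (B₂ := 10 * n * m + 4 * n) (fun v hv => ?_) (fun v hv => ?_) t3 t1 t2 k4
      (by linarith) (by linarith) (hRU i j hij m hm9) (Set.inter_subset_left.trans h80))⟩
    · have := abs_le.1 hv.1
      constructor <;> linarith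
    · have := abs_le.1 (mem_Bs.1 hv.1 j)
      rw [Pi.zero_apply, sub_zero] at this
      constructor <;> linarith
  obtain ⟨i, j, hij, m, hm, h1⟩ := hbig u hu
  obtain ⟨i', j', hij', m', hm', h2⟩ := hbig u' hu'
  have h3 : Cn (Op ω) U (a i j m) (a i' j' m') := by
    by_cases hii : i' = i
    · subst hii
      have hjj : j' = j := by
        rcases hl i' j hij j' with h | h
        exacts [absurd h hij'.symm, h]
      subst hjj
      exact ((hperp i' j' hij m 0 hm (by simp)).symm fun _ _ => Op.symm).trans
        (hperp i' j' hij m' 0 hm' (by simp))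
    · have h4 : i' = j := (hl i j hij i').resolve_left hii
      have h5 : j' = i := (hl i' j' hij' i).resolve_left (Ne.symm hii) |>.symm
      subst h4 h5
      exact hperp i' j' hij' m' m hm' hm
  exact (h1.trans h3).trans (h2.symm fun _ _ => Op.symm)

theorem unique_of_diag {ω : Sym2 (ZVec d) → Bool} {n h : ℕ} (hn : 0 < n) (hhn : h ≤ n)
    {a₀ y₀ : ZVec d} (h1 : ∀ i, a₀ i ≤ - (99 * n)) (h2 : ∀ i, 99 * n ≤ y₀ i)
    (h3 : Cn (Op ω) (Bs (104 * n) 0) a₀ y₀)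
    (hf : ∀ (i : Fin d) (s : ℤ), s ∈ Finset.Icc (-(80 * (n : ℤ))) (80 * n) →
      ∀ a ∈ Bx (104 * n) (0 : ZVec d), ∀ b ∈ Bx (104 * n) (0 : ZVec d), a i = s → b i = s →
      ω ∉ SlFail i s (s + 20 * n) (104 * n) (7 * (104 * n) + h) a b)
    {u u' : ZVec d} (hu : Big ω (20 * (n : ℤ)) 0 u) (hu' : Big ω (20 * (n : ℤ)) 0 u') :
    Cn (Op ω) (Bs (50 * (20 * (n : ℤ))) 0) u u' := by
  have hn' : (1 : ℤ) ≤ n := by exact_mod_cast hn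
  have hhn' : (h : ℤ) ≤ n := by exact_mod_cast hhn
  set U := Bs (50 * (20 * (n : ℤ))) (0 : ZVec d) with hU
  have hUm : ∀ r : ℤ, r ≤ 1000 * n → Bs r (0 : ZVec d) ⊆ U := fun r hr =>
    Finset.coe_subset.2 (Bx_mono (by linarith) _)
  have key : ∀ u, Big ω (20 * (n : ℤ)) 0 u → Cn (Op ω) U u a₀ := by
    intro u hu
    obtain ⟨i, s, hs1, hs2, x, x', hx, hx', k1, k2⟩ := hu.cross
    obtain ⟨v, w, v1, v2, v3, v4⟩ := k1.level_cross (fun _ _ h => h.abs_le i) (α := s)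
      (β := s + 20 * n) (by linarith) hx hx'
    obtain ⟨a, b, a1, a2, a3, a4⟩ := h3.level_cross (fun _ _ h => h.abs_le i) (α := s)
      (β := s + 20 * n) (by linarith) (by linarith [h1 i]) (by linarith [h2 i])
    have hsl : ∀ r : ℤ, r ≤ 104 * n → Bs r (0 : ZVec d) ∩ {v | s ≤ v i ∧ v i ≤ s + 20 * n} ⊆
        Sl i s (s + 20 * n) (104 * n) := by
      rintro r hr z ⟨hz1, hz2, hz3⟩
      refine ⟨hz2, hz3, fun l _ => ?_⟩
      have := mem_Bs.1 hz1 l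
      rw [Pi.zero_apply, sub_zero] at this
      exact this.trans hr
    have h5 := hf i s (Finset.mem_Icc.2 ⟨hs1, by linarith⟩) v
      (Bx_mono (by linarith) _ v1.right_mem) a a1.right_mem v2 a2
    have h6 : Cn (Op ω) (Sl i s (s + 20 * n) (7 * (104 * n) + h)) v a := by
      by_contra hcon
      exact h5 ⟨⟨w, v3, v4.mono (hsl _ (by linarith))⟩, ⟨b, a3, a4.mono (hsl _ le_rfl)⟩, hcon⟩
    have h7 : Sl i s (s + 20 * n) (7 * (104 * n) + h) ⊆ U := by
      rintro z ⟨z1, z2, z3⟩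
      refine mem_Bs.2 fun l => ?_
      rw [Pi.zero_apply, sub_zero]
      by_cases hl : l = i
      · subst hl; rw [abs_le]; constructor <;> linarith
      · exact (z3 l hl).trans (by linarith)
    exact (((k2.mono (hUm _ (by linarith))).trans (v1.mono (hUm _ (by linarith)))).trans
      (h6.mono h7)).trans ((a1.mono (hUm _ (by linarith))).symm fun _ _ => Op.symm)
  exact (key u hu).trans ((key u' hu').symm fun _ _ => Op.symm)

end

section
variable {d : ℕ}

theorem good_of_two {p : unitInterval} (hd : d = 2) (hp : pc d < p) (hp1 : (p : ℝ) < 1) {ε : ℝ}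
    (h0 : 0 < ε) : ∃ n0 : ℕ, ∀ n : ℕ, n0 ≤ n → 0 < n →
      (bern fun _ : Sym2 (ZVec d) => p).real {ω | ¬ Good ω (20 * (n : ℤ)) 0} ≤ ε := by
  have hi : ∃ i₀ j₀ : Fin d, i₀ ≠ j₀ ∧ ∀ l, l = i₀ ∨ l = j₀ := by
    subst hd
    exact ⟨0, 1, by decide, by decide⟩
  obtain ⟨i₀, j₀, hij, hl⟩ := hi
  set T : Finset (Fin d × Fin d × ℤ) := Finset.univ ×ˢ Finset.univ ×ˢ Finset.Icc (-9) 9 with hT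
  have hTm : ∀ i j m, |m| ≤ 9 → (i, j, m) ∈ T := fun i j m hm => by
    simp [hT, ← abs_le, hm]
  obtain ⟨n0, h⟩ := prob_Tube (η := ε / (T.card + 1)) (by omega) hp hp1 (by positivity)
  refine ⟨n0, fun n hn hn0 => ?_⟩
  set P := bern fun _ : Sym2 (ZVec d) => p with hP
  have hsub : {ω | ¬ Good ω (20 * (n : ℤ)) 0} ⊆ ⋃ q ∈ T,
      {ω : Sym2 (ZVec d) → Bool | ¬ ∃ a y, Tube ω n q.2.1 ((10 * n * q.2.2 : ℤ) • ev q.1) a y} := by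
    intro ω hω
    by_contra hcon
    simp only [Set.mem_iUnion, not_exists, Set.mem_ofPred_eq] at hcon
    have hcon' : ∀ i j : Fin d, ∀ m : ℤ, |m| ≤ 9 → ∃ a y, Tube ω n j ((10 * n * m) • ev i) a y :=
      fun i j m hm => by
        have := hcon (i, j, m) (hTm i j m hm)
        push Not at this
        exact this
    refine hω ⟨?_, fun u u' hu hu' => unique_of_tubes hn0 hl hij
      (fun i j _ m hm => hcon' i j m hm) hu hu'⟩
    obtain ⟨a, y, h1⟩ := hcon' i₀ j₀ 0 (by simp)
    rw [mul_zero, zero_smul] at h1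
    exact h1.wide hn0
  refine (measureReal_mono hsub (measure_ne_top _ _)).trans ((measureReal_biUnion_finset_le T _).trans
    ((Finset.sum_le_card_nsmul T _ _ fun q _ => h n hn q.2.1 _).trans ?_))
  rw [nsmul_eq_mul, mul_div_assoc', div_le_iff₀ (by positivity)]
  nlinarith

theorem good_of_three {p : unitInterval} (hd : 3 ≤ d) (hp : pc d < p) (hp1 : (p : ℝ) < 1) {ε : ℝ}
    (h0 : 0 < ε) : ∃ h q0 : ℕ, ∀ q : ℕ, q0 ≤ q → 0 < q → (bern fun _ : Sym2 (ZVec d) => p).real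
      {ω | ¬ Good ω (20 * (((h + 1) * q : ℕ) : ℤ)) 0} ≤ ε := by
  obtain ⟨h, θ, hθ0, hθ1, H⟩ := slab_unique hd hp hp1
  obtain ⟨n1, h1⟩ := prob_Tube (η := ε / 3) (by omega) hp hp1 (by positivity)
  obtain ⟨n2, h2⟩ := prob_diag (η := ε / 3) (by omega) hp hp1 (by positivity)
  set C : ℝ := d * (209 * (h + 1)) ^ (2 * d + 1) with hC
  have hlim : Filter.Tendsto (fun q : ℕ => C * ((q : ℝ) ^ (2 * d + 1) * θ ^ q)) Filter.atTop
      (nhds (C * 0)) :=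
    (tendsto_pow_const_mul_const_pow_of_abs_lt_one _ (by rwa [abs_of_nonneg hθ0])).const_mul C
  rw [mul_zero] at hlim
  obtain ⟨q1, hq1⟩ := Filter.eventually_atTop.1 (hlim.eventually (gt_mem_nhds (by positivity : 0 < ε / 3)))
  refine ⟨h, max (max n1 n2) q1, fun q hq hq0 => ?_⟩
  set n := (h + 1) * q with hn
  have hqn : q ≤ n := Nat.le_mul_of_pos_left q (by omega)
  have hn0 : 0 < n := by omega
  have hhn : h ≤ n := by
    have : h + 1 ≤ n := Nat.le_mul_of_pos_right (h + 1) hq0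
    omega
  simp only [max_le_iff] at hq
  set P := bern fun _ : Sym2 (ZVec d) => p with hP
  obtain ⟨i₀⟩ : Nonempty (Fin d) := ⟨⟨0, by omega⟩⟩
  set T : Finset (Fin d × ℤ × ZVec d × ZVec d) := Finset.univ ×ˢ
    Finset.Icc (-(80 * (n : ℤ))) (80 * n) ×ˢ Bx (104 * n) 0 ×ˢ Bx (104 * n) 0 with hT
  let F : Fin d × ℤ × ZVec d × ZVec d → Set (Sym2 (ZVec d) → Bool) := fun t =>
    {ω | t.2.2.1 t.1 = t.2.1 ∧ t.2.2.2 t.1 = t.2.1 ∧ ω ∈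
      SlFail t.1 t.2.1 (t.2.1 + 20 * n) (104 * n) (7 * (104 * n) + h) t.2.2.1 t.2.2.2}
  have hF : ∀ t ∈ T, P.real (F t) ≤ θ ^ q := by
    intro t _
    by_cases ht : t.2.2.1 t.1 = t.2.1 ∧ t.2.2.2 t.1 = t.2.1
    · have h3 := H t.1 t.2.1 (104 * n) (20 * q) t.2.2.1 t.2.2.2 (by positivity) ht.1 ht.2
      have e : ((20 * q : ℕ) : ℤ) * (h + 1) = 20 * n := by rw [hn]; push_cast; ring
      rw [e] at h3
      refine (measureReal_mono (fun ω hω => hω.2.2) (measure_ne_top _ _)).trans (h3.trans ?_)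
      exact pow_le_pow_of_le_one hθ0 hθ1.le (by omega)
    · have : F t = ∅ := by
        ext ω
        simp only [F, Set.mem_ofPred_eq, Set.mem_empty_iff_false, iff_false]
        exact fun h3 => ht ⟨h3.1, h3.2.1⟩
      rw [this]
      simpa using pow_nonneg hθ0 q
  have hTc : (T.card : ℝ) ≤ C * (q : ℝ) ^ (2 * d + 1) := by
    have e1 : T.card = d * ((160 * n + 1) * (((2 * (104 * n) + 1) ^ d) * ((2 * (104 * n) + 1) ^ d))) := by
      have e2 : (Bx (104 * (n : ℤ)) (0 : ZVec d)).card = (2 * (104 * n) + 1) ^ d := by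
        have := card_Bx (104 * n) (0 : ZVec d)
        push_cast at this
        exact_mod_cast this
      rw [hT, Finset.card_product, Finset.card_product, Finset.card_product, e2, Int.card_Icc,
        Finset.card_univ, Fintype.card_fin]
      congr 2
      omega
    have e3 : T.card ≤ d * (209 * n) ^ (2 * d + 1) := by
      rw [e1]
      refine Nat.mul_le_mul_left _ ?_
      have e4 : (2 * (104 * n) + 1) ^ d ≤ (209 * n) ^ d := Nat.pow_le_pow_left (by omega) d
      calc _ ≤ (209 * n) * ((209 * n) ^ d * (209 * n) ^ d) :=
            Nat.mul_le_mul (by omega) (Nat.mul_le_mul e4 e4)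
        _ = _ := by ring
    have e5 : (T.card : ℝ) ≤ d * (209 * n) ^ (2 * d + 1) := by exact_mod_cast e3
    refine e5.trans (le_of_eq ?_)
    rw [hC, hn]
    push_cast
    rw [mul_assoc (d : ℝ), ← mul_pow]
    ring_nf
  have hsub : {ω | ¬ Good ω (20 * (n : ℤ)) 0} ⊆
      ({ω : Sym2 (ZVec d) → Bool | ¬ ∃ a y, Tube ω n i₀ 0 a y} ∪
      {ω | ¬ ∃ a y : ZVec d, (∀ i, a i ≤ - (99 * n)) ∧ (∀ i, 99 * n ≤ y i) ∧
        Cn (Op ω) (Bs (104 * n) 0) a y}) ∪ ⋃ t ∈ T, F t := by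
    intro ω hω
    by_contra hcon
    rw [Set.mem_union, Set.mem_union, not_or, not_or] at hcon
    obtain ⟨⟨k1, k2⟩, k3⟩ := hcon
    simp only [Set.mem_ofPred_eq, not_not] at k1 k2
    simp only [Set.mem_iUnion, not_exists] at k3
    obtain ⟨a, y, k1⟩ := k1
    obtain ⟨a₀, y₀, k4, k5, k6⟩ := k2
    refine hω ⟨k1.wide hn0, fun u u' hu hu' => unique_of_diag hn0 hhn k4 k5 k6
      (fun i s hs a ha b hb has hbs hf => ?_) hu hu'⟩
    exact k3 (i, s, a, b) (Finset.mem_product.2 ⟨Finset.mem_univ _, Finset.mem_product.2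
      ⟨hs, Finset.mem_product.2 ⟨ha, hb⟩⟩⟩) ⟨has, hbs, hf⟩
  refine (measureReal_mono hsub (measure_ne_top _ _)).trans ((measureReal_union_le _ _).trans
    ((add_le_add (measureReal_union_le _ _) (measureReal_biUnion_finset_le T _)).trans ?_))
  have h3 := (Finset.sum_le_card_nsmul T _ _ hF)
  rw [nsmul_eq_mul] at h3
  have h4 : (T.card : ℝ) * θ ^ q ≤ ε / 3 :=
    (mul_le_mul_of_nonneg_right hTc (pow_nonneg hθ0 q)).trans
      ((mul_assoc _ _ _).trans_le (hq1 q hq.2).le)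
  linarith [h1 n (by omega) i₀ 0, h2 n (by omega)]

theorem exists_good {p : unitInterval} (hd : 2 ≤ d) (hp : pc d < p) (hp1 : (p : ℝ) < 1) {ε : ℝ}
    (h0 : 0 < ε) (K0 : ℕ) : ∃ K : ℕ, K0 ≤ K ∧ 0 < K ∧ ∀ z : ZVec d,
      (bern fun _ : Sym2 (ZVec d) => p).real {ω | ¬ Good ω K z} ≤ ε := by
  rcases hd.eq_or_lt with hd | hd
  · obtain ⟨n0, h⟩ := good_of_two hd.symm hp hp1 h0
    refine ⟨20 * (n0 + K0 + 1), by omega, by omega, fun z => ?_⟩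
    rw [prob_Good_translate p (by positivity)]
    exact_mod_cast h (n0 + K0 + 1) (by omega) (by omega)
  · obtain ⟨m, q0, h⟩ := good_of_three hd hp hp1 h0
    refine ⟨20 * ((m + 1) * (q0 + K0 + 1)), ?_, by positivity, fun z => ?_⟩
    · have : q0 + K0 + 1 ≤ (m + 1) * (q0 + K0 + 1) := Nat.le_mul_of_pos_left _ (by omega)
      omega
    · rw [prob_Good_translate p (by positivity)]
      exact_mod_cast h (q0 + K0 + 1) (by omega) (by omega)

end

section
variable {d : ℕ}

/-! ### Counting bad coarse sites along star chains -/

theorem disjoint_inner_coarse {K : ℕ} (hK : 0 < K) {y z : ZVec d}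
    (h : ∀ v, ¬ (v ∈ Bx 50 y ∧ v ∈ Bx 50 z)) :
    Disjoint (inner (Bs (50 * (K : ℤ)) ((K : ℤ) • y))) (inner (Bs (50 * (K : ℤ)) ((K : ℤ) • z))) := by
  rw [Set.disjoint_left]
  intro e he he'
  induction e using Sym2.ind with
  | _ a b =>
    rw [mem_inner] at he he'
    have h1 := mem_Bs.1 he.1
    have h2 := mem_Bs.1 he'.1
    refine h (fun i => (y i + z i) / 2) ⟨mem_Bx.2 fun i => ?_, mem_Bx.2 fun i => ?_⟩
    all_goals
      have h3 := abs_le.1 (h1 i)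
      have h4 := abs_le.1 (h2 i)
      simp only [Pi.smul_apply, smul_eq_mul] at h3 h4
      have hK' : (0 : ℤ) < K := by exact_mod_cast hK
      have h5 : y i - z i ≤ 100 := by nlinarith
      have h6 : z i - y i ≤ 100 := by nlinarith
      rw [abs_le]
      constructor <;> omega

theorem prob_spread_bad {p : unitInterval} {K : ℕ} (hK : 0 < K) {ε : ℝ}
    (h : ∀ z : ZVec d, (bern fun _ : Sym2 (ZVec d) => p).real {ω | ¬ Good ω K z} ≤ ε)
    (S : Finset (ZVec d))
    (hS : ∀ y ∈ S, ∀ z ∈ S, y ≠ z → ∀ v, ¬ (v ∈ Bx 50 y ∧ v ∈ Bx 50 z)) :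
    (bern fun _ : Sym2 (ZVec d) => p).real {ω | ∀ z ∈ S, ¬ Good ω K ((K : ℤ) • z)} ≤ ε ^ S.card := by
  have hK0 : (0 : ℤ) ≤ K := by positivity
  have key : ∀ S : Finset (ZVec d),
      Dep (⋃ z ∈ S, inner (Bs (50 * (K : ℤ)) ((K : ℤ) • z)))
        {ω | ∀ z ∈ S, ¬ Good ω K ((K : ℤ) • z)} := by
    intro S ω ω' hω h1 z hz h2
    exact h1 z hz (dep_Good hK0 _ ω' ω (fun e he => (hω e (Set.mem_biUnion hz he)).symm) h2)
  have hfin : ∀ S : Finset (ZVec d),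
      (⋃ z ∈ S, inner (Bs (50 * (K : ℤ)) ((K : ℤ) • z))).Finite := fun S =>
    S.finite_toSet.biUnion fun z _ => inner_finite (Finset.finite_toSet _)
  induction S using Finset.induction_on with
  | empty => simp
  | insert a S ha ih =>
    have h1 := bern_indep_real (fun _ : Sym2 (ZVec d) => p)
      (U := inner (Bs (50 * (K : ℤ)) ((K : ℤ) • a)))
      (V := ⋃ z ∈ S, inner (Bs (50 * (K : ℤ)) ((K : ℤ) • z))) (by
        rw [Set.disjoint_iUnion₂_right]
        intro z hz
        exact disjoint_inner_coarse hK (hS a (Finset.mem_insert_self _ _) z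
          (Finset.mem_insert_of_mem hz) (fun e => ha (e ▸ hz))))
      (dep_Good hK0 _).compl (key S) (measurableSet_Good hK0 _).compl
      ((key S).measurable_of_finite (hfin S))
    rw [Finset.card_insert_of_notMem ha, pow_succ']
    have h2 : {ω : Sym2 (ZVec d) → Bool | ∀ z ∈ insert a S, ¬ Good ω K ((K : ℤ) • z)} =
        {ω | Good ω K ((K : ℤ) • a)}ᶜ ∩ {ω | ∀ z ∈ S, ¬ Good ω K ((K : ℤ) • z)} := by
      ext ω
      simp
    rw [h2, h1]
    exact mul_le_mul (h _) (ih fun y hy z hz => hS y (Finset.mem_insert_of_mem hy) z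
      (Finset.mem_insert_of_mem hz)) measureReal_nonneg (measureReal_nonneg.trans (h 0))

/-- Every star chain of at most `M + 1` coarse sites starting in the coarse box of radius `r`
contains at most `101 ^ d * s` bad sites. -/
def FewBad (ω : Sym2 (ZVec d) → Bool) (K r M s : ℕ) : Prop :=
  ∀ L : List (ZVec d), L.IsChain Star → L.length ≤ M + 1 → ∀ y ∈ Bx r (0 : ZVec d),
    L.head? = some y → (L.toFinset.filter fun z => ¬ Good ω K ((K : ℤ) • z)).card ≤ s * 101 ^ d

theorem measurableSet_bad {K : ℕ} (S : Finset (ZVec d)) :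
    MeasurableSet {ω : Sym2 (ZVec d) → Bool | ∀ z ∈ S, ¬ Good ω K ((K : ℤ) • z)} := by
  have : {ω : Sym2 (ZVec d) → Bool | ∀ z ∈ S, ¬ Good ω K ((K : ℤ) • z)} =
      ⋂ z ∈ S, {ω | Good ω K ((K : ℤ) • z)}ᶜ := by ext; simp
  rw [this]
  exact Finset.measurableSet_biInter _ fun z _ => (measurableSet_Good (by positivity) _).compl

/-- The spread subsets of size `s` of star chains. -/
def spreads (r M s : ℕ) : Finset (Finset (ZVec d)) :=
  (Finset.range (M + 1)).biUnion fun k => (Bx r (0 : ZVec d)).biUnion fun y =>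
    (spaths k y).biUnion fun L => (L.toFinset.powersetCard s).filter fun S =>
      ∀ y ∈ S, ∀ z ∈ S, y ≠ z → ∀ v, ¬ (v ∈ Bx 50 y ∧ v ∈ Bx 50 z)

theorem card_spreads (r M s : ℕ) : (spreads (d := d) r M s).card ≤
    (M + 1) * ((2 * r + 1) ^ d * ((3 ^ d) ^ M * 2 ^ (M + 1))) := by
  refine Finset.card_biUnion_le.trans ((Finset.sum_le_card_nsmul _ _
    ((2 * r + 1) ^ d * ((3 ^ d) ^ M * 2 ^ (M + 1))) fun k hk => ?_).trans (by simp))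
  refine Finset.card_biUnion_le.trans ((Finset.sum_le_card_nsmul _ _
    ((3 ^ d) ^ M * 2 ^ (M + 1)) fun y _ => ?_).trans (by simp [card_Bx]))
  have hk' : k ≤ M := by simpa [Nat.lt_succ_iff] using hk
  refine Finset.card_biUnion_le.trans ((Finset.sum_le_card_nsmul _ _
    (2 ^ (M + 1)) fun L hL => ?_).trans ?_)
  · refine (Finset.card_filter_le _ _).trans ?_
    rw [Finset.card_powersetCard]
    refine (Nat.choose_le_two_pow _ _).trans (Nat.pow_le_pow_right (by norm_num) ?_)
    have := L.toFinset_card_le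
    have := length_of_mem_spaths hL
    omega
  · rw [smul_eq_mul]
    exact Nat.mul_le_mul_right _ ((card_spaths k y).trans
      (Nat.pow_le_pow_right (by positivity) hk'))

theorem not_FewBad {ω : Sym2 (ZVec d) → Bool} {K r M s : ℕ} (h : ¬ FewBad ω K r M s) :
    ∃ S ∈ spreads (d := d) r M s, ∀ z ∈ S, ¬ Good ω K ((K : ℤ) • z) := by
  unfold FewBad at h
  push Not at h
  obtain ⟨L, h1, h2, y, h3, h4, h5⟩ := h
  obtain ⟨Y, h6, h7, h8⟩ := exists_spread 50 s _ h5
  obtain ⟨S, hSY, hS⟩ := Finset.exists_subset_card_eq h7.le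
  have hL : 0 < L.length := by
    rcases L with _ | ⟨a, L⟩
    · simp at h4
    · simp
  refine ⟨S, ?_, fun z hz => (Finset.mem_filter.1 (h6 (hSY hz))).2⟩
  rw [spreads, Finset.mem_biUnion]
  refine ⟨L.length - 1, by simp; omega, Finset.mem_biUnion.2 ⟨y, h3, Finset.mem_biUnion.2
    ⟨L, mem_spaths h1 h4 (by omega), Finset.mem_filter.2 ⟨Finset.mem_powersetCard.2
      ⟨fun z hz => (Finset.mem_filter.1 (h6 (hSY hz))).1, hS⟩, ?_⟩⟩⟩⟩
  exact fun y hy z hz => h8 y (hSY hy) z (hSY hz)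

theorem prob_FewBad {p : unitInterval} {K : ℕ} (hK : 0 < K) {ε : ℝ}
    (h : ∀ z : ZVec d, (bern fun _ : Sym2 (ZVec d) => p).real {ω | ¬ Good ω K z} ≤ ε) (r M s : ℕ) :
    ∃ A : Set (Sym2 (ZVec d) → Bool), MeasurableSet A ∧ (∀ ω, ω ∉ A → FewBad ω K r M s) ∧
      (∀ ω ω', Op ω = Op ω' → ω ∈ A → ω' ∈ A) ∧ (bern fun _ : Sym2 (ZVec d) => p).real A ≤
        (M + 1) * ((2 * r + 1) ^ d * ((3 ^ d) ^ M * 2 ^ (M + 1))) * ε ^ s := by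
  refine ⟨⋃ S ∈ spreads (d := d) r M s, {ω | ∀ z ∈ S, ¬ Good ω K ((K : ℤ) • z)},
    Finset.measurableSet_biUnion _ fun S _ => measurableSet_bad S, fun ω hω => ?_,
    fun ω ω' h hω => ?_, ?_⟩
  · by_contra hcon
    obtain ⟨S, h1, h2⟩ := not_FewBad hcon
    exact hω (Set.mem_biUnion h1 h2)
  · simpa only [Set.mem_iUnion, Set.mem_ofPred_eq, Good, Big, h] using hω
  · refine (measureReal_biUnion_finset_le _ _).trans ((Finset.sum_le_card_nsmul _ _ (ε ^ s)
      fun S hS => ?_).trans ?_)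
    · simp only [spreads, Finset.mem_biUnion, Finset.mem_filter, Finset.mem_powersetCard] at hS
      obtain ⟨k, -, y, -, L, -, ⟨-, h1⟩, h2⟩ := hS
      rw [← h1]
      exact prob_spread_bad hK h S h2
    · rw [nsmul_eq_mul]
      refine mul_le_mul_of_nonneg_right ?_ (pow_nonneg (measureReal_nonneg.trans (h 0)) s)
      exact_mod_cast card_spreads r M s

end

section
variable {d : ℕ}

/-! ### Coarse graining -/

/-- The coarse site containing a vertex. -/
def coarse (K : ℕ) (x : ZVec d) : ZVec d := fun i => x i / K

theorem coarse_bounds {K : ℕ} (hK : 0 < K) (x : ZVec d) (i : Fin d) :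
    K * coarse K x i ≤ x i ∧ x i < K * coarse K x i + K := by
  have hK' : (0 : ℤ) < K := by exact_mod_cast hK
  have h1 := Int.mul_ediv_add_emod (x i) K
  have h2 := Int.emod_nonneg (x i) hK'.ne'
  have h3 := Int.emod_lt_of_pos (x i) hK'
  simp only [coarse]
  omega

theorem mem_Bs_coarse {K : ℕ} (hK : 0 < K) (x : ZVec d) : x ∈ Bs K ((K : ℤ) • coarse K x) :=
  mem_Bs.2 fun i => by
    have := coarse_bounds hK x i
    rw [abs_le]
    simp only [Pi.smul_apply, smul_eq_mul]
    constructor <;> linarith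

theorem coarse_star {K : ℕ} (hK : 0 < K) {x y : ZVec d} (h : Star x y) :
    Star (coarse K x) (coarse K y) := by
  intro i
  have hK' : (0 : ℤ) < K := by exact_mod_cast hK
  have h1 := coarse_bounds hK x i
  have h2 := coarse_bounds hK y i
  have h3 := abs_le.1 (h i)
  have h4 : coarse K x i - coarse K y i < 2 := by nlinarith
  have h5 : coarse K y i - coarse K x i < 2 := by nlinarith
  rw [abs_le]
  constructor <;> omega

theorem Star.smul_abs {K : ℕ} {z z' : ZVec d} (h : Star z z') (i : Fin d) :
    |((K : ℤ) • z) i - ((K : ℤ) • z') i| ≤ K := by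
  simp only [Pi.smul_apply, smul_eq_mul]
  rw [← mul_sub, abs_mul, Nat.abs_cast]
  exact mul_le_of_le_one_right (by positivity) (h i)

theorem abs_coarse_le {K : ℕ} (hK : 0 < K) (x : ZVec d) (i : Fin d) : |coarse K x i| ≤ |x i| := by
  have hK' : (1 : ℤ) ≤ K := by exact_mod_cast hK
  have h1 := coarse_bounds hK x i
  rcases le_total 0 (x i) with h | h
  · have h2 : 0 ≤ coarse K x i := Int.ediv_nonneg h (by omega)
    rw [abs_of_nonneg h, abs_of_nonneg h2]
    nlinarith
  · have h2 : coarse K x i < 1 := by nlinarith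
    rw [abs_of_nonpos h, abs_of_nonpos (by omega)]
    by_contra h3
    push Not at h3
    have h4 : coarse K x i + 1 ≤ x i := by omega
    rcases (show coarse K x i + 1 ≤ 0 by omega).eq_or_lt with h5 | h5
    · nlinarith
    · nlinarith

/-- A vertex lying on a path that leaves the ball of radius `4K`, and whose edges in the ball are
open, has a wide cluster. -/
theorem big_of_leave {ω : Sym2 (ZVec d) → Bool} {K : ℕ} (hK : 0 < K) {z x y : ZVec d}
    {O : ZVec d → ZVec d → Prop} {R : Set (ZVec d)} (hO : ∀ a b, O a b → Adj d a b)
    (hx : x ∈ Bs (K + 1) z) (h : Cn O R x y) (hy : y ∉ Bs (4 * K) z)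
    (hop : ∀ a ∈ Bs (4 * K) z, ∀ b ∈ Bs (4 * K) z, O a b → Op ω a b) : Big ω K z x := by
  have hK' : (1 : ℤ) ≤ K := by exact_mod_cast hK
  obtain ⟨a, b, h1, h2, h3, -⟩ := h.first_exit (S := Bs (4 * K) z)
    (Bx_mono (by linarith) z hx) hy
  rw [mem_Bs] at h2
  push Not at h2
  obtain ⟨i, hi⟩ := h2
  refine ⟨a, i, h1.mono_in (fun v hv => hv.2) fun a ha b hb hab => hop a ha.2 b hb.2 hab, ?_⟩
  have h4 := (hO _ _ h3).abs_le i
  have h5 := mem_Bs.1 hx i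
  have e1 := abs_sub_abs_le_abs_sub (b i - z i) (a i - z i)
  have e2 := abs_sub_abs_le_abs_sub (a i - z i) (x i - z i)
  rw [show b i - z i - (a i - z i) = -(a i - b i) by ring, abs_neg] at e1
  rw [show a i - z i - (x i - z i) = -(x i - a i) by ring, abs_neg] at e2
  linarith

/-- The coarse site `z` is good, and its wide cluster lies in `C`. -/
def Linked (ω : Sym2 (ZVec d) → Bool) (K : ℕ) (C : Set (ZVec d)) (z : ZVec d) : Prop :=
  Good ω K ((K : ℤ) • z) ∧ ∀ u, Big ω K ((K : ℤ) • z) u → u ∈ C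

theorem mem_of_Cn {ω : Sym2 (ZVec d) → Bool} {C R : Set (ZVec d)}
    (hC : ∀ a b, a ∈ C → Op ω a b → b ∈ C) {x y : ZVec d} (h : Cn (Op ω) R x y) (hx : x ∈ C) :
    y ∈ C := by
  induction h using Cn.induct with
  | h0 _ => exact hx
  | h1 a b ha hab hb ih => exact hC a b ih hab

theorem Linked.of_mem {ω : Sym2 (ZVec d) → Bool} {K : ℕ} {C : Set (ZVec d)}
    (hC : ∀ a b, a ∈ C → Op ω a b → b ∈ C) {z u : ZVec d} (hz : Good ω K ((K : ℤ) • z))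
    (hu : Big ω K ((K : ℤ) • z) u) (huC : u ∈ C) : Linked ω K C z :=
  ⟨hz, fun v hv => mem_of_Cn hC (hz.2 u v hu hv) huC⟩

theorem Good.exists_big {ω : Sym2 (ZVec d) → Bool} {K : ℕ} {z : ZVec d}
    (hz : Good ω K ((K : ℤ) • z)) : ∃ u ∈ Bs (2 * K) ((K : ℤ) • z), ∀ z', Star z z' →
      Big ω K ((K : ℤ) • z') u := by
  obtain ⟨⟨u, w, i, h1, h2⟩, -⟩ := hz
  exact ⟨u, h1.1, fun z' hz' => ⟨w, i, h1.mono (Finset.coe_subset.2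
    (Bx_subset fun j => by have := hz'.smul_abs (K := K) j; linarith)), h2⟩⟩

theorem Linked.step {ω : Sym2 (ZVec d) → Bool} {K : ℕ} {C : Set (ZVec d)}
    (hC : ∀ a b, a ∈ C → Op ω a b → b ∈ C) {z z' : ZVec d} (h : Linked ω K C z)
    (hzz : Star z z') (hz' : Good ω K ((K : ℤ) • z')) : Linked ω K C z' := by
  obtain ⟨u, -, hu⟩ := h.1.exists_big
  exact Linked.of_mem hC hz' (hu z' hzz) (h.2 u (hu z fun i => by simp))

/-- A self-avoiding path avoiding a crossing cluster passes near a linear number of well-separated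
closed edges. -/
theorem exists_closed_edges {ω : Sym2 (ZVec d) → Bool} {K N s : ℕ} (hK : 0 < K) (hN : 20 * K ≤ N)
    (hs : 4 * K * (2 * 101 ^ d * s) ≤ N) {C : Set (ZVec d)}
    (hC : ∀ a b, a ∈ C → Op ω a b → b ∈ C) {i : Fin d} {u w : ZVec d}
    (hΓ : Cn (Op ω) (C ∩ Bs (2 * N) 0) u w) (hu : u i = -(2 * N)) (hw : w i = 2 * N)
    {Q : ZVec d → ZVec d → Prop} {P : Set (ZVec d)} (hQ : ∀ a b, Q a b → Adj d a b)
    (hPN : P ⊆ Bs N 0) (hPC : ∀ x ∈ P, x ∉ C) (hPQ : ∀ x ∈ P, ∀ y ∈ P, Cn Q P x y)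
    {xα xβ : ZVec d} (hα : xα ∈ P) (hβ : xβ ∈ P) (hαβ : (N : ℤ) ≤ 2 * (xβ i - xα i))
    (hgood : FewBad ω K (2 * N) (2 * 101 ^ d * s) s) :
    ∃ Y : Finset (ZVec d), s ≤ Y.card ∧
      (∀ y ∈ Y, ∀ z ∈ Y, y ≠ z → ∀ v, ¬ (v ∈ Bx 50 y ∧ v ∈ Bx 50 z)) ∧
      ∀ z ∈ Y, ∃ a ∈ Bs (4 * K) ((K : ℤ) • z), ∃ b, a ∈ P ∧ b ∈ P ∧ Q a b ∧ ¬ Op ω a b := by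
  have hK' : (1 : ℤ) ≤ K := by exact_mod_cast hK
  have hN' : 20 * (K : ℤ) ≤ N := by exact_mod_cast hN
  obtain ⟨a, b, h1, ha, hb, h2⟩ := hΓ.level_cross (i := i) (fun a b hab => hab.abs_le i)
    (α := xα i) (β := xβ i) (by omega)
    (by have := abs_le.1 (mem_Bs.1 (hPN hα) i); simp at this; omega)
    (by have := abs_le.1 (mem_Bs.1 (hPN hβ) i); simp at this; omega)
  set G : Set (ZVec d) := {v | Cn (Op ω) (C ∩ Bs (2 * N) 0) u v} with hG
  have hGC : ∀ v ∈ G, v ∈ C := fun v hv => hv.right_mem.1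
  have huG : u ∈ G := Cn.refl hΓ.1
  have haG : a ∈ G := h1
  have hbG : b ∈ G := h1.trans (h2.mono fun v hv => hv.1)
  have hGG : ∀ x ∈ G, ∀ y ∈ G, Cn (Op ω) G x y := by
    have h : ∀ x ∈ G, Cn (Op ω) G u x := fun x hx => Cn.self_trace hx
    exact fun x hx y hy => ((h x hx).symm fun _ _ => Op.symm).trans (h y hy)
  set A : Set (ZVec d) := {v | v ∉ P ∧ (v ∈ G ∨ Linked ω K C (coarse K v))} with hA
  have hGA : G ⊆ A := fun v hv => ⟨fun h => hPC v h (hGC v hv), Or.inl hv⟩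
  have hPA : P ⊆ Aᶜ := fun v hv h => h.1 hv
  obtain ⟨B, hB1, hB2, hB3⟩ := exists_star_boundary (hGA haG) (hPA hα)
  have hB4 : ∀ v ∈ B, ¬ Good ω K ((K : ℤ) • coarse K v) ∨ v ∈ P ∧ Linked ω K C (coarse K v) := by
    intro v hv
    obtain ⟨hvA, a', ha', hav⟩ := hB1 v hv
    by_cases hg : Good ω K ((K : ℤ) • coarse K v)
    · have hlk : Linked ω K C (coarse K v) := by
        rcases ha'.2 with h | h
        · refine Linked.of_mem hC hg (u := a') ?_ (hGC _ h)
          have hfar : ∃ y ∈ G, y ∉ Bs (4 * (K : ℤ)) ((K : ℤ) • coarse K v) := by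
            by_contra hcon
            push Not at hcon
            have e1 := abs_le.1 (mem_Bs.1 (hcon u huG) i)
            have e2 := abs_le.1 (mem_Bs.1 (hcon w hΓ) i)
            omega
          obtain ⟨y, hy, hyn⟩ := hfar
          refine big_of_leave hK (fun a b hab => hab.1) (mem_Bs.2 fun j => ?_) (hGG a' h y hy) hyn
            (fun _ _ _ _ => id)
          have e1 := mem_Bs.1 (mem_Bs_coarse hK v) j
          have e2 := hav.abs_le j
          have e3 := abs_add_le (a' j - v j) (v j - ((K : ℤ) • coarse K v) j)
          rw [sub_add_sub_cancel] at e3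
          linarith
        · exact h.step hC (coarse_star hK hav.star) hg
      refine Or.inr ⟨?_, hlk⟩
      by_contra hvP
      exact hvA ⟨hvP, Or.inr hlk⟩
    · exact Or.inl hg
  have level : ∀ g ∈ G, ∀ x ∈ P, g i = x i → ∃ v ∈ B, v i = x i ∧ v ∈ Bs (2 * N) 0 := by
    intro g hg x hx hgx
    have hg2 : g ∈ Bs (2 * N) 0 := (show Cn _ _ _ _ from hg).right_mem.2
    have hx2 : x ∈ Bs (2 * N) 0 := Bx_mono (by linarith) 0 (hPN hx)
    obtain ⟨v, hv, hv2⟩ := hB3 (Set.Icc (fun j => min (g j) (x j)) (fun j => max (g j) (x j))) g x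
      (((hGG a haG g hg).mono_in hGA fun _ _ _ _ h => h.1))
      (((hPQ xα hα x hx).mono_in hPA fun _ _ _ _ h => hQ _ _ h))
      (Cn_Icc ⟨fun j => min_le_left _ _, fun j => le_max_left _ _⟩
        ⟨fun j => min_le_right _ _, fun j => le_max_right _ _⟩)
    have e : ∀ j, min (g j) (x j) ≤ v j ∧ v j ≤ max (g j) (x j) := fun j => ⟨hv2.1 j, hv2.2 j⟩
    refine ⟨v, hv, ?_, mem_Bs.2 fun j => ?_⟩
    · have := e i; omega
    · have e1 := e j
      have e2 := abs_le.1 (mem_Bs.1 hg2 j)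
      have e3 := abs_le.1 (mem_Bs.1 hx2 j)
      rw [abs_le]
      omega
  obtain ⟨vα, hvα, hvα1, hvα2⟩ := level a haG xα hα ha
  obtain ⟨vβ, hvβ, hvβ1, -⟩ := level b hbG xβ hβ hb
  obtain ⟨L, hL1, hL2, hL3, hL4, hL5⟩ := ((hB2 vα hvα vβ hvβ).map (coarse K) (O' := Star)
    (R' := coarse K '' B) (fun v hv => ⟨v, hv, rfl⟩) fun x _ y _ h => coarse_star hK h).exists_nodup
  set M := 2 * 101 ^ d * s with hM
  have hlen : M + 1 ≤ L.length := by
    have e1 := star_chain_dist hL1 hL2 (List.mem_of_getLast? hL3) i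
    have e2 := coarse_bounds hK vα i
    have e3 := coarse_bounds hK vβ i
    have e4 := le_abs_self (coarse K vβ i - coarse K vα i)
    rw [hvα1] at e2
    rw [hvβ1] at e3
    have hs' : 4 * (K : ℤ) * M ≤ N := by exact_mod_cast hs
    have e5 : (M : ℤ) ≤ coarse K vβ i - coarse K vα i := by
      by_contra hcon
      push Not at hcon
      have e6 : coarse K vβ i - coarse K vα i + 1 ≤ M := by omega
      have e7 := mul_le_mul_of_nonneg_left e6 (show (0 : ℤ) ≤ K by omega)
      nlinarith
    omega
  set L' := L.take (M + 1) with hL'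
  have hL'len : L'.length = M + 1 := by rw [hL', List.length_take]; omega
  have hbad := hgood L' (hL1.take _) hL'len.le (coarse K vα) (mem_Bx.2 fun j => by
    have := mem_Bs.1 hvα2 j
    have := abs_coarse_le hK vα j
    simp at *
    linarith) (by rw [hL', List.head?_take, if_neg (by omega), hL2])
  have hcard : L'.toFinset.card = M + 1 := by
    rw [List.toFinset_card_of_nodup (hL4.sublist (List.take_sublist _ _)), hL'len]
  have hsplit := Finset.card_filter_add_card_filter_not (s := L'.toFinset)
    (fun z => ¬ Good ω K ((K : ℤ) • z))
  obtain ⟨Y, hY1, hY2, hY3⟩ := exists_spread 50 s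
    (L'.toFinset.filter fun z => ¬ ¬ Good ω K ((K : ℤ) • z)) (by
      norm_num only
      rw [hcard, hM] at hsplit
      nlinarith)
  refine ⟨Y, hY2.le, hY3, fun z hz => ?_⟩
  obtain ⟨hzL, hzg⟩ := Finset.mem_filter.1 (hY1 hz)
  rw [not_not] at hzg
  obtain ⟨x, hx, hxz⟩ := hL5 z (List.mem_of_mem_take (List.mem_toFinset.1 hzL))
  subst hxz
  obtain ⟨hxP, hlk⟩ := (hB4 x hx).resolve_left (not_not.2 hzg)
  by_contra hcon
  push Not at hcon
  have hfar : ∃ y ∈ P, y ∉ Bs (4 * (K : ℤ)) ((K : ℤ) • coarse K x) := by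
    by_contra hcon
    push Not at hcon
    have e1 := abs_le.1 (mem_Bs.1 (hcon xα hα) i)
    have e2 := abs_le.1 (mem_Bs.1 (hcon xβ hβ) i)
    omega
  obtain ⟨y, hy, hyn⟩ := hfar
  refine hPC x hxP (hlk.2 x (big_of_leave (O := fun a b => Q a b ∧ a ∈ P ∧ b ∈ P) hK
    (fun a b hab => hQ _ _ hab.1) (Bx_mono (by linarith) _ (mem_Bs_coarse hK x))
    ((hPQ x hxP y hy).mono_in le_rfl fun a ha b hb h => ⟨h, ha, hb⟩) hyn
    fun a ha b hb h => hcon a ha b h.2.1 h.2.2 h.1))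

end

section
variable {d : ℕ}

/-! ### Walks and their passage times -/

theorem EdgeOpen.adj {ω : Config d} {x y : ZVec d} (h : EdgeOpen d ω x y) : Adj d x y := by
  obtain ⟨e, h | h, -⟩ := h
  · have := e.2.1
    rw [h] at this
    exact this
  · have := e.2.1
    rw [h] at this
    exact Adj.symm this

theorem pairWeight_nonneg (n : ℕ) (ω : Config d) (x y : ZVec d) : 0 ≤ pairWeight d n ω x y := by
  unfold pairWeight
  split_ifs <;> positivity

theorem pairWeight_le {n : ℕ} (hn : 1 ≤ (Real.log n) ^ 2) (ω : Config d) (x y : ZVec d) :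
    pairWeight d n ω x y ≤ (Real.log n) ^ 2 := by
  unfold pairWeight
  split_ifs
  exacts [hn, le_rfl]

theorem pathCost_append_le (n : ℕ) (ω : Config d) (l l' : List (ZVec d)) :
    pathCost d n ω l' ≤ pathCost d n ω (l ++ l') := by
  induction l with
  | nil => simp
  | cons a l ih =>
    refine ih.trans ?_
    rw [List.cons_append]
    rcases l ++ l' with _ | ⟨b, m⟩
    · simp [pathCost]
    · exact le_add_of_nonneg_left (pairWeight_nonneg _ _ _ _)

/-- There is a walk in `A` from one vertex to another of passage time at most `c`. -/
inductive Wk (n : ℕ) (ω : Config d) (A : Set (ZVec d)) : ZVec d → ZVec d → ℝ → Prop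
  | nil (x : ZVec d) (c : ℝ) (hx : x ∈ A) (hc : 0 ≤ c) : Wk n ω A x x c
  | cons (x y z : ZVec d) (c c' : ℝ) (hx : x ∈ A) (hxy : Adj d x y) (h : Wk n ω A y z c)
      (hc : pairWeight d n ω x y + c ≤ c') : Wk n ω A x z c'

section
variable {n : ℕ} {ω : Config d} {A A' : Set (ZVec d)} {x y z : ZVec d} {c c' : ℝ}

theorem Wk.mono (h : Wk n ω A x y c) (hc : c ≤ c') (hA : A ⊆ A') : Wk n ω A' x y c' := by
  induction h generalizing c' with
  | nil x c hx h0 => exact .nil _ _ (hA hx) (h0.trans hc)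
  | cons x y z c c1 hx hxy h h1 ih =>
    exact .cons _ y _ c _ (hA hx) hxy (ih le_rfl) (h1.trans hc)

theorem Wk.trans (h : Wk n ω A x y c) (h' : Wk n ω A y z c') : Wk n ω A x z (c + c') := by
  induction h with
  | nil x c hx h0 => exact h'.mono (by linarith) le_rfl
  | cons x y _ c c1 hx hxy h h1 ih =>
    exact .cons _ y _ _ _ hx hxy (ih h') (by linarith)

theorem Wk.exists_path (h : Wk n ω A x y c) : ∃ l, IsPath d l ∧ l.head? = some x ∧
    l.getLast? = some y ∧ (∀ v ∈ l, v ∈ A) ∧ pathCost d n ω l ≤ c := by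
  induction h with
  | nil x c hx h0 =>
    refine ⟨[x], ⟨by simp, by simp, List.isChain_singleton _⟩, by simp, by simp, by simpa using hx, ?_⟩
    simpa [pathCost] using h0
  | cons x y z c c1 hx hxy h h1 ih =>
    obtain ⟨l, ⟨k1, k2, k3⟩, k4, k5, k6, k7⟩ := ih
    by_cases hxl : x ∈ l
    · obtain ⟨l1, l2, rfl⟩ := List.append_of_mem hxl
      refine ⟨x :: l2, ⟨by simp, (List.nodup_append.1 k2).2.1, (List.isChain_append.1 k3).2.1⟩,
        by simp, by simpa using k5, fun v hv => k6 v (List.mem_append_right _ hv), ?_⟩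
      have := pathCost_append_le n ω l1 (x :: l2)
      have := pairWeight_nonneg n ω x y
      linarith
    · obtain ⟨b, l, rfl⟩ := List.exists_cons_of_ne_nil k1
      simp only [List.head?_cons, Option.some.injEq] at k4
      subst k4
      refine ⟨x :: b :: l, ⟨by simp, List.nodup_cons.2 ⟨hxl, k2⟩,
        List.isChain_cons_cons.2 ⟨hxy, k3⟩⟩, by simp, by simpa using k5,
        fun v hv => ?_, ?_⟩
      · rcases List.mem_cons.1 hv with rfl | hv
        exacts [hx, k6 v hv]
      · exact (add_le_add_right k7 _).trans h1

theorem Wk.of_list {l : List (ZVec d)} (h1 : l.IsChain (Adj d)) (h2 : l.head? = some x)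
    (h3 : l.getLast? = some y) (h4 : ∀ v ∈ l, v ∈ A) : Wk n ω A x y (pathCost d n ω l) := by
  induction l generalizing x with
  | nil => simp at h2
  | cons a l ih =>
    simp only [List.head?_cons, Option.some.injEq] at h2
    subst h2
    cases l with
    | nil =>
      simp only [List.getLast?_singleton, Option.some.injEq] at h3
      subst h3
      exact .nil _ _ (h4 _ (by simp)) (by simp [pathCost])
    | cons b l =>
      exact .cons _ b _ _ _ (h4 _ (by simp)) (List.isChain_cons_cons.1 h1).1
        (ih (List.isChain_cons_cons.1 h1).2 (by simp) (by simpa using h3)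
          fun v hv => h4 v (List.mem_cons_of_mem _ hv)) le_rfl

end

/-- The number of closed edges of a list with both endpoints in `P`. -/
def closedCount (ω : Config d) (P : Set (ZVec d)) : List (ZVec d) → ℕ
  | [] => 0
  | [_] => 0
  | x :: y :: l => (if x ∈ P ∧ y ∈ P ∧ ¬ EdgeOpen d ω x y then 1 else 0) + closedCount ω P (y :: l)

theorem closedCount_eq (ω : Config d) (P : Set (ZVec d)) (l : List (ZVec d)) :
    closedCount ω P l = ((l.zip l.tail).filter
      fun e => decide (e.1 ∈ P ∧ e.2 ∈ P ∧ ¬ EdgeOpen d ω e.1 e.2)).length := by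
  induction l with
  | nil => rfl
  | cons a l ih =>
    cases l with
    | nil => rfl
    | cons b l =>
      change _ = (((a, b) :: (b :: l).zip l).filter _).length
      rw [closedCount, ih, List.tail_cons, List.filter_cons]
      split_ifs with h1 h2 h2
      · simp [add_comm]
      · exact absurd (decide_eq_true h1) h2
      · exact absurd (of_decide_eq_true h2) h1
      · simp

theorem card_le_closedCount {ι : Type*} {ω : Config d} {P : Set (ZVec d)} {l : List (ZVec d)}
    (Y : Finset ι) (e : ι → ZVec d × ZVec d) (he : ∀ z ∈ Y, e z ∈ l.zip l.tail ∧ (e z).1 ∈ P ∧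
      (e z).2 ∈ P ∧ ¬ EdgeOpen d ω (e z).1 (e z).2)
    (hinj : ∀ y ∈ Y, ∀ z ∈ Y, e y = e z → y = z) : Y.card ≤ closedCount ω P l := by
  rw [closedCount_eq]
  refine le_trans ?_ (List.toFinset_card_le _)
  refine Finset.card_le_card_of_injOn e (fun z hz => ?_) fun y hy z hz => hinj y hy z hz
  have := he z hz
  simp only [List.coe_toFinset, Set.mem_ofPred_eq, List.mem_filter, decide_eq_true_eq]
  exact this

theorem closedCount_eq_zero {ω : Config d} {P : Set (ZVec d)} {l : List (ZVec d)}
    (h : ∀ v ∈ l.tail, v ∉ P) : closedCount ω P l = 0 := by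
  induction l with
  | nil => rfl
  | cons a l ih =>
    cases l with
    | nil => rfl
    | cons b l =>
      rw [closedCount, if_neg (fun h1 => h b (by simp) h1.2.1), zero_add]
      exact ih fun v hv => h v (List.mem_cons_of_mem _ hv)

/-- Cutting a path at its first and last visits to `P`. -/
theorem exists_cut {n : ℕ} {ω : Config d} {A P : Set (ZVec d)} {y : ZVec d}
    {σ : List (ZVec d)} (h1 : σ.IsChain (Adj d)) (h3 : σ.getLast? = some y) (h4 : ∀ v ∈ σ, v ∈ A)
    (hP : ∃ v ∈ σ, v ∈ P) (x : ZVec d) (h2 : σ.head? = some x) :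
    ∃ x1 ∈ P, ∃ x2 ∈ P, ∃ c1 c2 : ℝ, 0 ≤ c1 ∧ Wk n ω A x x1 c1 ∧ Wk n ω A x2 y c2 ∧
      c1 + c2 + (Real.log n) ^ 2 * closedCount ω P σ ≤ pathCost d n ω σ := by
  induction σ generalizing x with
  | nil => simp at h2
  | cons a σ ih =>
    simp only [List.head?_cons, Option.some.injEq] at h2
    subst h2
    by_cases hσ : ∃ v ∈ σ, v ∈ P
    · obtain ⟨b, σ, rfl⟩ : ∃ b σ', σ = b :: σ' := by
        cases σ with
        | nil => simp at hσ
        | cons b l => exact ⟨b, l, rfl⟩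
      have haA : a ∈ A := h4 a (by simp)
      have hab := List.isChain_cons_cons.1 h1
      obtain ⟨x1, hx1, x2, hx2, c1, c2, k0, k1, k2, k3⟩ := ih hab.2 (by simpa using h3)
        (fun v hv => h4 v (List.mem_cons_of_mem _ hv)) hσ b rfl
      have hw := pairWeight_nonneg n ω a b
      by_cases haP : a ∈ P
      · refine ⟨a, haP, x2, hx2, 0, c2, le_rfl, .nil _ _ haA le_rfl, k2, ?_⟩
        simp only [closedCount, pathCost]
        split_ifs with h
        · rw [pairWeight, if_neg h.2.2]
          push_cast
          linarith
        · push_cast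
          linarith
      · refine ⟨x1, hx1, x2, hx2, pairWeight d n ω a b + c1, c2, by linarith,
          .cons _ b _ _ _ haA hab.1 k1 le_rfl, k2, ?_⟩
        simp only [closedCount, pathCost]
        rw [if_neg (fun h => haP h.1)]
        push_cast
        linarith
    · push Not at hσ
      have haP : a ∈ P := by
        obtain ⟨v, hv, hvP⟩ := hP
        rcases List.mem_cons.1 hv with rfl | hv
        exacts [hvP, absurd hvP (hσ v hv)]
      refine ⟨a, haP, a, haP, 0, pathCost d n ω (a :: σ), le_rfl, .nil _ _ (h4 a (by simp)) le_rfl,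
        Wk.of_list h1 rfl h3 h4, ?_⟩
      rw [closedCount_eq_zero (by simpa using hσ)]
      simp

/-- A geodesic can not be much worse than a detour between its extreme visits to `P`. -/
theorem closedCount_le_of_detour {n : ℕ} {ω : Config d} {A P : Set (ZVec d)} {σ : List (ZVec d)}
    (hσ : IsGeodesicIn d n ω A σ) (hP : ∃ v ∈ σ, v ∈ P) {c : ℝ}
    (hc : ∀ x ∈ P, ∀ y ∈ P, Wk n ω A x y c) :
    (Real.log n) ^ 2 * closedCount ω P σ ≤ c := by
  obtain ⟨⟨h1, h2, h3⟩, h4, h5⟩ := hσ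
  obtain ⟨x, hx⟩ : ∃ x, σ.head? = some x := ⟨_, List.head?_eq_some_head h1⟩
  obtain ⟨y, hy⟩ : ∃ y, σ.getLast? = some y := ⟨_, List.getLast?_eq_some_getLast h1⟩
  obtain ⟨x1, hx1, x2, hx2, c1, c2, -, k1, k2, k3⟩ := exists_cut (n := n) (ω := ω) h3 hy h4 hP x hx
  obtain ⟨l, l1, l2, l3, l4, l5⟩ := ((k1.trans (hc x1 hx1 x2 hx2)).trans k2).exists_path
  have := h5 l l1 l4 (by rw [l2, hx]) (by rw [l3, hy])
  linarith

end

section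
variable {d : ℕ}

/-! ### Detours through good boxes -/

theorem norm1_le {r : ℕ} {z x y : ZVec d} (hx : x ∈ Bs r z) (hy : y ∈ Bs r z) :
    norm1 d (y - x) ≤ 2 * d * r := by
  refine (Finset.sum_le_card_nsmul Finset.univ _ (2 * r) fun i _ => ?_).trans (le_of_eq ?_)
  · have h1 := abs_le.1 (mem_Bs.1 hx i)
    have h2 := abs_le.1 (mem_Bs.1 hy i)
    simp only [Pi.sub_apply]
    omega
  · rw [Finset.card_univ, Fintype.card_fin, smul_eq_mul]
    ring

theorem exists_line {r : ℤ} {z v y : ZVec d} (hv : v ∈ Bs r z) (hy : y ∈ Bs r z) :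
    ∃ l : List (ZVec d), l.IsChain (Adj d) ∧ l.head? = some v ∧ l.getLast? = some y ∧ l.Nodup ∧
      (∀ w ∈ l, w ∈ Bs r z) ∧ l.length ≤ norm1 d (y - v) + 1 ∧
      ∀ w ∈ l, norm1 d (y - w) ≤ norm1 d (y - v) := by
  generalize hk : norm1 d (y - v) = k
  induction k using Nat.strong_induction_on generalizing v with
  | _ k ih =>
    by_cases h : v = y
    · subst h
      exact ⟨[v], by simp, by simp, by simp, by simp, by simpa using hv, by simp, by simpa using hk.le⟩
    · obtain ⟨i, hi⟩ := Function.ne_iff.1 h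
      have hlt := norm1_update_sign hi
      have hv' : Function.update v i (v i + (y i - v i).sign) ∈ Bs r z := by
        refine mem_Bs.2 fun j => ?_
        have h1 := abs_le.1 (mem_Bs.1 hv j)
        have h2 := abs_le.1 (mem_Bs.1 hy j)
        have h3 := update_sign_between hi j
        rw [abs_le]
        omega
      obtain ⟨l, h1, h2, h3, h4, h5, h6, h7⟩ := ih _ (hk ▸ hlt) hv' rfl
      cases l with
      | nil => simp at h2
      | cons a l =>
        simp only [List.head?_cons, Option.some.injEq] at h2
        subst h2
        refine ⟨v :: _ :: l, List.isChain_cons_cons.2 ⟨Adj.update_sign hi, h1⟩, rfl, by simpa using h3,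
          List.nodup_cons.2 ⟨fun hvl => ?_, h4⟩, fun w hw => ?_, ?_, fun w hw => ?_⟩
        · have := h7 v hvl
          omega
        · rcases List.mem_cons.1 hw with rfl | hw
          exacts [hv, h5 w hw]
        · rw [List.length_cons]
          omega
        · rcases List.mem_cons.1 hw with rfl | hw
          · exact hk.le
          · have := h7 w hw
            omega

section
variable {n : ℕ}

theorem pathCost_le_length (hn : 1 ≤ (Real.log n) ^ 2) (ω : Config d) (l : List (ZVec d)) :
    pathCost d n ω l ≤ (Real.log n) ^ 2 * l.length := by
  induction l with
  | nil => simp [pathCost]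
  | cons a l ih =>
    cases l with
    | nil => simp [pathCost]; positivity
    | cons b l =>
      have := pairWeight_le hn ω a b
      rw [pathCost, List.length_cons]
      push_cast at ih ⊢
      linarith

theorem pathCost_open {ω : Config d} {l : List (ZVec d)} (h : l.IsChain (EdgeOpen d ω)) :
    pathCost d n ω l ≤ l.length := by
  induction l with
  | nil => simp [pathCost]
  | cons a l ih =>
    cases l with
    | nil => simp [pathCost]
    | cons b l =>
      have h1 := List.isChain_cons_cons.1 h
      have := ih h1.2
      rw [pathCost, List.length_cons, pairWeight, if_pos h1.1]
      push_cast at this ⊢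
      linarith

theorem Wk.direct (hn : 1 ≤ (Real.log n) ^ 2) (ω : Config d) {r : ℕ} {z x y : ZVec d}
    (hx : x ∈ Bs r z) (hy : y ∈ Bs r z) :
    Wk n ω (Bs r z) x y ((Real.log n) ^ 2 * (2 * d * r + 1 : ℕ)) := by
  obtain ⟨l, h1, h2, h3, -, h5, h6, -⟩ := exists_line hx hy
  refine (Wk.of_list h1 h2 h3 h5).mono ((pathCost_le_length hn ω l).trans ?_) le_rfl
  have := norm1_le hx hy
  gcongr
  omega

theorem Wk.of_open {ω : Sym2 (ZVec d) → Bool} {r : ℕ} {z x y : ZVec d}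
    (h : Cn (Op ω) (Bs r z) x y) :
    Wk n (fun e => ω e.pair) (Bs r z) x y ((2 * r + 1) ^ d : ℕ) := by
  obtain ⟨l, h1, h2, h3, h4, h5⟩ := h.exists_nodup
  refine (Wk.of_list (h1.imp fun a b hab => hab.1) h2 h3 h5).mono
    ((pathCost_open (h1.imp fun a b hab => (edgeOpen_pair ω a b).2 hab)).trans ?_) le_rfl
  rw [← card_Bx r z, ← List.toFinset_card_of_nodup h4]
  exact_mod_cast Finset.card_le_card fun v hv => h5 v (List.mem_toFinset.1 hv)

/-- The cost of a step between neighbouring coarse sites. -/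
theorem Wk.coarse_step (hn : 1 ≤ (Real.log n) ^ 2) {ω : Sym2 (ZVec d) → Bool} {K : ℕ}
    {g : ZVec d → ZVec d} (hg : ∀ z, g z ∈ Bs (2 * K) ((K : ℤ) • z))
    (hg' : ∀ z, Good ω K ((K : ℤ) • z) → ∀ z', Star z z' → Big ω K ((K : ℤ) • z') (g z))
    {z z' : ZVec d} (hz : Star z z') :
    Wk n (fun e => ω e.pair) (Bs (50 * K) ((K : ℤ) • z')) (g z) (g z')
      ((100 * K + 1) ^ d + ((if Good ω K ((K : ℤ) • z) then (0 : ℝ) else 1) +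
        (if Good ω K ((K : ℤ) • z') then (0 : ℝ) else 1)) *
        ((Real.log n) ^ 2 * (6 * d * K + 1))) := by
  have e50 : Bs (50 * K) ((K : ℤ) • z') = Bs ((50 * K : ℕ) : ℤ) ((K : ℤ) • z') := by push_cast; rfl
  by_cases h : Good ω K ((K : ℤ) • z) ∧ Good ω K ((K : ℤ) • z')
  · have h1 := h.2.2 _ _ (hg' z h.1 z' hz) (hg' z' h.2 z' fun i => by simp)
    rw [e50] at h1 ⊢
    refine (Wk.of_open h1).mono ?_ le_rfl
    rw [if_pos h.1, if_pos h.2]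
    push_cast
    ring_nf
    exact le_rfl
  · have h3 : ∀ r : ℤ, (3 * K : ℕ) ≤ r → g z ∈ Bs r ((K : ℤ) • z') := fun r hr =>
      Bx_subset (fun i => by have := hz.smul_abs (K := K) i; push_cast at hr; linarith) (hg z)
    have h4 : g z' ∈ Bs (3 * K : ℕ) ((K : ℤ) • z') := Bx_mono (by push_cast; linarith) _ (hg z')
    refine (Wk.direct hn _ (h3 _ le_rfl) h4).mono ?_ (Finset.coe_subset.2 (Bx_mono (by push_cast; linarith) _))
    have h5 : (1 : ℝ) ≤ (if Good ω K ((K : ℤ) • z) then (0 : ℝ) else 1) +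
        (if Good ω K ((K : ℤ) • z') then (0 : ℝ) else 1) := by
      by_cases h6 : Good ω K ((K : ℤ) • z)
      · rw [if_neg fun h7 => h ⟨h6, h7⟩]
        split_ifs; norm_num
      · rw [if_neg h6]
        split_ifs <;> norm_num
    have h6 : 0 ≤ (Real.log n) ^ 2 * (6 * d * K + 1) := by positivity
    have h7 := mul_le_mul_of_nonneg_right h5 h6
    have h8 : (0 : ℝ) ≤ (100 * K + 1) ^ d := by positivity
    push_cast
    linarith

theorem Wk.coarse_list (hn : 1 ≤ (Real.log n) ^ 2) {ω : Sym2 (ZVec d) → Bool} {K : ℕ}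
    {g : ZVec d → ZVec d} (hg : ∀ z, g z ∈ Bs (2 * K) ((K : ℤ) • z))
    (hg' : ∀ z, Good ω K ((K : ℤ) • z) → ∀ z', Star z z' → Big ω K ((K : ℤ) • z') (g z))
    {A : Set (ZVec d)} {l : List (ZVec d)} (hl : l.IsChain Star)
    (hA : ∀ z ∈ l, Bs (50 * K) ((K : ℤ) • z) ⊆ A) {z z' : ZVec d} (hz : l.head? = some z)
    (hz' : l.getLast? = some z') :
    Wk n (fun e => ω e.pair) A (g z) (g z') (l.length * (100 * K + 1) ^ d +
      (2 * (l.filter fun z => ¬ Good ω K ((K : ℤ) • z)).length -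
        (if Good ω K ((K : ℤ) • z) then (0 : ℝ) else 1)) * ((Real.log n) ^ 2 * (6 * d * K + 1))) := by
  induction l generalizing z with
  | nil => simp at hz
  | cons a l ih =>
    simp only [List.head?_cons, Option.some.injEq] at hz
    subst hz
    have hB : 0 ≤ (Real.log n) ^ 2 * (6 * d * K + 1) := by positivity
    have hB0 : (0 : ℝ) ≤ (100 * K + 1) ^ d := by positivity
    cases l with
    | nil =>
      simp only [List.getLast?_singleton, Option.some.injEq] at hz'
      subst hz'
      refine .nil _ _ (hA a (by simp) (Bx_mono (by linarith) _ (hg a))) ?_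
      by_cases h : Good ω K ((K : ℤ) • a)
      · simp only [h, List.filter_cons, not_true_eq_false, decide_false, if_true,
          Bool.false_eq_true, if_false, List.filter_nil, List.length_nil, List.length_singleton]
        push_cast
        linarith
      · simp only [h, List.filter_cons, not_false_eq_true, decide_true, if_true, if_false,
          List.filter_nil, List.length_singleton]
        push_cast
        linarith
    | cons b l =>
      have h1 := List.isChain_cons_cons.1 hl
      have h2 := ((Wk.coarse_step hn hg hg' h1.1).mono le_rfl (hA b (by simp))).trans
        (ih h1.2 (fun z hz => hA z (List.mem_cons_of_mem _ hz)) rfl (by simpa using hz'))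
      refine h2.mono ?_ le_rfl
      rw [List.filter_cons (x := a), List.length_cons (a := a)]
      by_cases h : Good ω K ((K : ℤ) • a)
      · simp only [h, not_true_eq_false, decide_false, if_true, Bool.false_eq_true, if_false]
        push_cast
        linarith
      · simp only [h, not_false_eq_true, decide_true, if_true, if_false, List.length_cons]
        push_cast
        linarith

/-- When few boxes are bad, any two vertices are joined by a cheap walk. -/
theorem Wk.detour (hn : 1 ≤ (Real.log n) ^ 2) {ω : Sym2 (ZVec d) → Bool} {K N s : ℕ} (hK : 0 < K)
    (hN : 51 * K ≤ N) (h : FewBad ω K N (2 * d * (N / K + 1)) s) {x y : ZVec d}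
    (hx : x ∈ Bs N 0) (hy : y ∈ Bs N 0) :
    Wk n (fun e => ω e.pair) (Bs (2 * N) 0) x y
      ((2 * d * (N / K + 1 : ℕ) + 1) * (100 * K + 1) ^ d +
        (2 * (s * 101 ^ d) + 2) * ((Real.log n) ^ 2 * (6 * d * K + 1))) := by
  obtain ⟨g, hg, hg'⟩ : ∃ g : ZVec d → ZVec d, (∀ z, g z ∈ Bs (2 * K) ((K : ℤ) • z)) ∧
      ∀ z, Good ω K ((K : ℤ) • z) → ∀ z', Star z z' → Big ω K ((K : ℤ) • z') (g z) := by
    refine ⟨fun z => if hz : Good ω K ((K : ℤ) • z) then hz.exists_big.choose else (K : ℤ) • z,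
      fun z => ?_, fun z hz => ?_⟩
    · dsimp only
      split_ifs with hz
      · exact hz.exists_big.choose_spec.1
      · exact Bx_self (by positivity) _
    · simp only [dif_pos hz]
      exact hz.exists_big.choose_spec.2
  have hK' : (1 : ℤ) ≤ K := by exact_mod_cast hK
  have hN' : 51 * (K : ℤ) ≤ N := by exact_mod_cast hN
  set R : ℕ := N / K + 1 with hR
  have hKR : (K : ℤ) * R ≤ N + K := by
    have := Nat.mul_div_le N K
    rw [hR]
    push_cast
    have h2 : (K : ℤ) * ((N : ℤ) / K) ≤ N := by exact_mod_cast this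
    linarith
  have hKR' : (N : ℤ) < K * R := by
    have := Nat.lt_mul_div_succ N hK
    rw [hR]
    exact_mod_cast this
  have hcoarse : ∀ v ∈ Bs (N : ℤ) (0 : ZVec d), coarse K v ∈ Bs R (0 : ZVec d) := fun v hv =>
    mem_Bs.2 fun i => by
      have h1 := abs_le.1 (mem_Bs.1 hv i)
      have h2 := coarse_bounds hK v i
      simp only [Pi.zero_apply, sub_zero] at h1 ⊢
      have h3 : coarse K v i < R := by
        by_contra hc
        push Not at hc
        nlinarith
      have h4 : -(R : ℤ) - 1 < coarse K v i := by
        by_contra hc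
        push Not at hc
        nlinarith
      rw [abs_le]
      omega
  have hend : ∀ v ∈ Bs (N : ℤ) (0 : ZVec d), ∀ a ∈ Bs (2 * K) ((K : ℤ) • coarse K v),
      ∀ b ∈ Bs (2 * K) ((K : ℤ) • coarse K v), Wk n (fun e => ω e.pair) (Bs (2 * N) 0) a b
        ((Real.log n) ^ 2 * (6 * d * K + 1)) := by
    intro v hv a ha b hb
    have e : ((2 * K : ℕ) : ℤ) = 2 * (K : ℤ) := by push_cast; rfl
    rw [← e] at ha hb
    refine (Wk.direct hn _ ha hb).mono ?_ (Finset.coe_subset.2 (Bx_subset fun i => ?_))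
    · gcongr
      push_cast
      have : (0 : ℝ) ≤ d * K := by positivity
      nlinarith
    · have h1 := abs_le.1 (mem_Bs.1 (hcoarse v hv) i)
      simp only [Pi.zero_apply, sub_zero, Pi.smul_apply, smul_eq_mul, abs_mul, Nat.abs_cast] at h1 ⊢
      have h2 : |coarse K v i| ≤ R := abs_le.2 h1
      push_cast
      nlinarith
  obtain ⟨l, l1, l2, l3, l4, l5, l6, -⟩ := exists_line (hcoarse x hx) (hcoarse y hy)
  have hlen : l.length ≤ 2 * d * R + 1 := l6.trans (by have := norm1_le (hcoarse x hx) (hcoarse y hy); omega)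
  have hls : l.IsChain Star := l1.imp fun a b hab i => hab.abs_le i
  have hbad := h l hls hlen (coarse K x) (mem_Bx.2 fun i => by
    have h1 := abs_coarse_le hK x i
    have h2 := mem_Bs.1 hx i
    simp only [Pi.zero_apply, sub_zero] at h2 ⊢
    exact h1.trans h2) l2
  have hA : ∀ z ∈ l, Bs (50 * K) ((K : ℤ) • z) ⊆ Bs (2 * N) 0 := fun z hz =>
    Finset.coe_subset.2 (Bx_subset fun i => by
      have h1 := mem_Bs.1 (l5 z hz) i
      simp only [Pi.zero_apply, sub_zero, Pi.smul_apply, smul_eq_mul, abs_mul, Nat.abs_cast] at h1 ⊢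
      nlinarith)
  have key := Wk.coarse_list (n := n) hn hg hg' hls hA l2 l3
  have hin : ∀ v : ZVec d, v ∈ Bs (2 * K) ((K : ℤ) • coarse K v) := fun v =>
    Bx_mono (by linarith) _ (mem_Bs_coarse hK v)
  refine (((hend x hx x (hin x) _ (hg _)).trans key).trans
    (hend y hy _ (hg _) y (hin y))).mono ?_ le_rfl
  have hB : 0 ≤ (Real.log n) ^ 2 * (6 * d * K + 1) := by positivity
  have e1 : ((l.filter fun z => ¬ Good ω K ((K : ℤ) • z)).length : ℝ) ≤ s * 101 ^ d := by
    rw [← List.toFinset_card_of_nodup (l4.filter _), List.toFinset_filter]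
    refine le_trans (Nat.cast_le.2 (le_trans (le_of_eq ?_) hbad)) (by push_cast; rfl)
    congr 1
    ext z
    simp
  have e2 : (l.length : ℝ) ≤ 2 * d * R + 1 := by exact_mod_cast hlen
  have e3 : (0 : ℝ) ≤ if Good ω K ((K : ℤ) • coarse K x) then (0 : ℝ) else 1 := by
    split_ifs <;> norm_num
  have e4 : (0 : ℝ) ≤ (100 * K + 1) ^ d := by positivity
  have e5 := mul_le_mul_of_nonneg_right e2 e4
  have e6 := mul_le_mul_of_nonneg_right (show 2 * ((l.filter fun z => ¬ Good ω K ((K : ℤ) • z)).length : ℝ)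
    - (if Good ω K ((K : ℤ) • coarse K x) then (0 : ℝ) else 1) ≤ 2 * (s * 101 ^ d) by linarith) hB
  linarith

end

end

section
variable {d : ℕ}

/-! ### Avoiding a crossing cluster is too expensive -/

theorem mem_openClusterOf {ω : Config d} {v y : ZVec d} :
    y ∈ openClusterOf d ω v ↔ Cn (EdgeOpen d ω) Set.univ v y := by
  refine ⟨chemDist_ne_top, fun h => ?_⟩
  obtain ⟨γ, h1, h2, h3, h4, h5⟩ := h.exists_nodup
  refine ne_top_of_le_ne_top (ENat.natCast_ne_top (γ.length - 1)) (sInf_le ⟨γ, ⟨?_, h4, ?_⟩, h1, h5, h2, h3, rfl⟩)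
  · rintro rfl
    simp at h2
  · exact h1.imp fun a b hab => hab.adj

theorem boxZ_subset (N : ℕ) : boxZ d N 0 ⊆ Bs N 0 := fun y hy => mem_Bs.2 fun i => by
  have h1 : normInf d (y - 0) ≤ N := hy
  have h2 := (Finset.le_sup (f := fun i => ((y - 0) i).natAbs) (Finset.mem_univ i)).trans h1
  simp only [Pi.sub_apply] at h2
  rw [abs_le]
  omega

theorem Bs_subset_boxR {r : ℕ} {t : ℝ} (h : (r : ℝ) ≤ t) : Bs (r : ℤ) (0 : ZVec d) ⊆ boxR d t 0 := by
  intro y hy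
  refine le_trans (Nat.cast_le.2 (Finset.sup_le fun i _ => ?_)) h
  have := abs_le.1 (mem_Bs.1 hy i)
  simp only [Pi.sub_apply]
  omega

theorem isChain_zip_tail {α : Type*} {O : α → α → Prop} {l : List α} (h : l.IsChain O) :
    l.IsChain fun a b => O a b ∧ (a, b) ∈ l.zip l.tail := by
  induction l with
  | nil => exact .nil
  | cons a l ih =>
    cases l with
    | nil => exact .singleton _
    | cons b l =>
      have h1 := List.isChain_cons_cons.1 h
      exact List.isChain_cons_cons.2 ⟨⟨h1.1, List.mem_cons_self⟩,
        (ih h1.2).imp fun x y hxy => ⟨hxy.1, List.mem_cons_of_mem _ hxy.2⟩⟩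

theorem Cn.of_list_mem {α : Type*} {O : α → α → Prop} {R : Set α} (hO : ∀ a b, O a b → O b a)
    {l : List α} (h1 : l.IsChain O) (h2 : ∀ v ∈ l, v ∈ R) {x y : α} (hx : x ∈ l) (hy : y ∈ l) :
    Cn O R x y := by
  obtain ⟨a, ha⟩ : ∃ a, l.head? = some a := ⟨_, List.head?_eq_some_head (List.ne_nil_of_mem hx)⟩
  exact ((Cn.of_list h1 h2 a x ha hx).symm hO).trans (Cn.of_list h1 h2 a y ha hy)

theorem cost_of_ENevent {n N K₁ K₂ s₁ s₂ : ℕ} {t : ℝ} {ω : Sym2 (ZVec d) → Bool}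
    (hn : 1 ≤ (Real.log n) ^ 2) (ht : 2 ≤ t) (hK₁ : 0 < K₁) (hK₂ : 0 < K₂) (hN₁ : 20 * K₁ ≤ N)
    (hs₁ : 4 * K₁ * (2 * 101 ^ d * s₁) ≤ N) (hs₁' : 0 < s₁) (hN₂ : 51 * K₂ ≤ N)
    (h₁ : FewBad ω K₁ (2 * N) (2 * 101 ^ d * s₁) s₁)
    (h₂ : FewBad ω K₂ N (2 * d * (N / K₂ + 1)) s₂)
    (h : (fun e => ω e.pair) ∈ ENevent d n t N) :
    (Real.log n) ^ 2 * s₁ ≤ (2 * d * (N / K₂ + 1 : ℕ) + 1) * (100 * K₂ + 1) ^ d +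
        (2 * (s₂ * 101 ^ d) + 2) * ((Real.log n) ^ 2 * (6 * d * K₂ + 1)) := by
  obtain ⟨v0, hcross, π, hπ, hπN, ⟨-, -, σ, hσ, hGs⟩, ⟨i, y1, hy1, y2, hy2, hdiam⟩, hav⟩ := h
  obtain ⟨xα, hα, xβ, hβ, hαβ⟩ : ∃ xα ∈ π, ∃ xβ ∈ π, (N : ℤ) ≤ 2 * (xβ i - xα i) := by
    rcases le_total (y1 i) (y2 i) with hle | hle
    · refine ⟨y1, hy1, y2, hy2, ?_⟩
      rw [abs_sub_comm, abs_of_nonneg (sub_nonneg.2 (by exact_mod_cast hle))] at hdiam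
      have : (N : ℝ) ≤ 2 * ((y2 i : ℝ) - y1 i) := by linarith
      exact_mod_cast this
    · refine ⟨y2, hy2, y1, hy1, ?_⟩
      rw [abs_of_nonneg (sub_nonneg.2 (by exact_mod_cast hle))] at hdiam
      have : (N : ℝ) ≤ 2 * ((y1 i : ℝ) - y2 i) := by linarith
      exact_mod_cast this
  set C := openClusterOf d (fun e => ω e.pair) v0 with hCdef
  have hC : ∀ a b, a ∈ C → Op ω a b → b ∈ C := fun a b ha hab =>
    mem_openClusterOf.2 ((mem_openClusterOf.1 ha).tail ((edgeOpen_pair ω a b).2 hab) trivial)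
  obtain ⟨γ, -, hγ1, hγ2, ⟨u, hu, hui⟩, ⟨w, hw, hwi⟩⟩ := hcross i
  have hΓ : Cn (Op ω) (C ∩ Bs (2 * N) 0) u w := by
    refine Cn.of_list_mem (O := Op ω) (R := C ∩ Bs (2 * N) 0) (fun a b => Op.symm) (l := γ)
      (hγ1.imp fun a b => (edgeOpen_pair ω a b).1) (fun v hv => ⟨(hγ2 v hv).1, ?_⟩) hu hw
    have := boxZ_subset _ (hγ2 v hv).2
    push_cast at this
    exact this
  simp only [Pi.zero_apply, zero_sub, zero_add] at hui hwi
  push_cast at hui hwi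
  set Q : ZVec d → ZVec d → Prop := fun a b => Adj d a b ∧ edgeMemPath d a b π with hQ
  have hPQ : ∀ x ∈ {v | v ∈ π}, ∀ y ∈ {v | v ∈ π}, Cn Q {v | v ∈ π} x y := fun x hx y hy =>
    Cn.of_list_mem (O := Q) (fun a b hab => ⟨hab.1.symm, hab.2.symm⟩)
      ((isChain_zip_tail hπ.2.2).imp fun a b hab => ⟨hab.1, Or.inl hab.2⟩) (fun v hv => hv) hx hy
  obtain ⟨Y, hY1, hY2, hY3⟩ := exists_closed_edges hK₁ hN₁ hs₁ hC hΓ hui hwi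
    (Q := Q) (P := {v | v ∈ π}) (fun a b hab => hab.1) (fun v hv => boxZ_subset _ (hπN v hv)) hav hPQ
    hα hβ hαβ h₁
  have hE : ∀ z ∈ Y, ∃ e : ZVec d × ZVec d, (e ∈ σ.zip σ.tail ∧ e.1 ∈ Bs (N : ℤ) (0 : ZVec d) ∧
      e.2 ∈ Bs (N : ℤ) (0 : ZVec d) ∧ ¬ EdgeOpen d (fun e => ω e.pair) e.1 e.2) ∧
      e.1 ∈ Bs (4 * K₁ + 1) ((K₁ : ℤ) • z) := by
    intro z hz
    obtain ⟨a, ha, b, haπ, hbπ, ⟨hab, habπ⟩, hop⟩ := hY3 z hz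
    have haN := boxZ_subset _ (hπN a haπ)
    have hbN := boxZ_subset _ (hπN b hbπ)
    have hcl : ¬ EdgeOpen d (fun e => ω e.pair) a b := fun h => hop ((edgeOpen_pair ω a b).1 h)
    have hcl' : ¬ EdgeOpen d (fun e => ω e.pair) b a := fun h =>
      hop ((edgeOpen_pair ω b a).1 h).symm
    have hmem : edgeMemPath d a b σ := by
      by_contra hc
      exact hcl (hGs a b habπ hc)
    rcases hmem with hm | hm
    · exact ⟨(a, b), ⟨hm, haN, hbN, hcl⟩, Bx_mono (by linarith) _ ha⟩
    · refine ⟨(b, a), ⟨hm, hbN, haN, hcl'⟩, mem_Bs.2 fun j => ?_⟩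
      have h1 := abs_le.1 (mem_Bs.1 ha j)
      have h2 := abs_le.1 (hab.abs_le j)
      dsimp only
      rw [abs_le]
      constructor <;> linarith
  choose! e he1 he2 using hE
  have hcount := card_le_closedCount (ω := fun e => ω e.pair) Y e he1 fun y hy z hz hyz => by
    by_contra hne
    have hK' : (1 : ℤ) ≤ K₁ := by exact_mod_cast hK₁
    refine hY2 y hy z hz hne y ⟨Bx_self (by norm_num) _, mem_Bx.2 fun j => ?_⟩
    have h1 := abs_le.1 (mem_Bs.1 (he2 y hy) j)
    have h2 := abs_le.1 (mem_Bs.1 (he2 z hz) j)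
    rw [hyz] at h1
    simp only [Pi.smul_apply, smul_eq_mul] at h1 h2
    rw [abs_le]
    constructor <;> nlinarith
  obtain ⟨z, hz⟩ := Finset.card_pos.1 (hs₁'.trans_le hY1)
  have hgeo := closedCount_le_of_detour hσ (P := Bs (N : ℤ) 0)
    ⟨(e z).1, (List.of_mem_zip (he1 z hz).1).1, (he1 z hz).2.1⟩ fun x hx y hy =>
      (Wk.detour (n := n) hn hK₂ hN₂ h₂ hx hy).mono le_rfl (by
        have := Bs_subset_boxR (d := d) (r := 2 * N) (t := t * N) (by push_cast; gcongr)
        push_cast at this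
        exact this)
  refine le_trans ?_ hgeo
  gcongr
  exact_mod_cast hY1.trans hcount

end

section
variable {d : ℕ}

/-! ### Choice of the parameters -/

theorem exists_FewBad {p : unitInterval} (hd : 2 ≤ d) (hp : pc d < p) (hp1 : (p : ℝ) < 1) (H : ℕ) :
    ∃ K : ℕ, 0 < K ∧ ∀ r M s : ℕ, M ≤ H * s → ∃ A : Set (Sym2 (ZVec d) → Bool), MeasurableSet A ∧
      (∀ ω, ω ∉ A → FewBad ω K r M s) ∧ (∀ ω ω', Op ω = Op ω' → ω ∈ A → ω' ∈ A) ∧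
      (bern fun _ : Sym2 (ZVec d) => p).real A ≤
        2 * (M + 1) * (2 * r + 1) ^ d * Real.exp (-s) := by
  obtain ⟨K, -, hK, h⟩ := exists_good hd hp hp1
    (show (0 : ℝ) < ((3 ^ d * 2) ^ H)⁻¹ * Real.exp (-1) by positivity) 0
  refine ⟨K, hK, fun r M s hM => ?_⟩
  obtain ⟨A, h1, h2, h3, h4⟩ := prob_FewBad hK h r M s
  refine ⟨A, h1, h2, h3, h4.trans ?_⟩
  have e1 : ((3 : ℝ) ^ d * 2) ^ M ≤ (3 ^ d * 2) ^ (H * s) :=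
    pow_le_pow_right₀ (by have : (1 : ℝ) ≤ 3 ^ d := one_le_pow₀ (by norm_num); linarith) hM
  have e2 : (((3 : ℝ) ^ d * 2) ^ H)⁻¹ ^ s * (3 ^ d * 2) ^ M ≤ 1 := by
    rw [inv_pow, ← pow_mul]
    exact (mul_le_mul_of_nonneg_left e1 (by positivity)).trans_eq (inv_mul_cancel₀ (by positivity))
  have e3 : Real.exp (-1) ^ s = Real.exp (-s) := by
    rw [← Real.exp_nat_mul]
    congr 1
    ring
  calc _ = (((3 : ℝ) ^ d * 2) ^ H)⁻¹ ^ s * (3 ^ d * 2) ^ M *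
        (2 * (M + 1) * (2 * r + 1) ^ d * Real.exp (-s)) := by
        rw [mul_pow _ (Real.exp (-1)), e3, mul_pow _ _ M, pow_succ]
        ring
    _ ≤ _ := mul_le_of_le_one_left (by positivity) e2

theorem poly_mul_exp_le (q : ℝ) (hq : 0 ≤ q) (k : ℕ) {b : ℝ} (hb : 0 < b) :
    ∃ C ≥ 0, ∃ c > 0, ∀ N : ℕ, q * (N : ℝ) ^ k * Real.exp (-(b * N)) ≤ C * Real.exp (-(c * N)) := by
  refine ⟨q * (k.factorial * (2 / b) ^ k), by positivity, b / 2, by positivity, fun N => ?_⟩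
  have h1 := Real.pow_div_factorial_le_exp (b / 2 * N) (by positivity) k
  rw [div_le_iff₀ (by positivity), mul_pow] at h1
  have h2 : (N : ℝ) ^ k ≤ (k.factorial * (2 / b) ^ k) * Real.exp (b / 2 * N) := by
    have h3 := mul_le_mul_of_nonneg_left h1 (show 0 ≤ (2 / b) ^ k by positivity)
    rw [← mul_assoc, ← mul_pow, show 2 / b * (b / 2) = 1 by field_simp, one_pow, one_mul] at h3
    linarith
  calc q * (N : ℝ) ^ k * Real.exp (-(b * N))
      ≤ q * ((k.factorial * (2 / b) ^ k) * Real.exp (b / 2 * N)) * Real.exp (-(b * N)) := by gcongr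
    _ = q * (k.factorial * (2 / b) ^ k) * (Real.exp (b / 2 * N) * Real.exp (-(b * N))) := by ring
    _ = _ := by
        rw [← Real.exp_add]
        congr 2
        ring

/-- The detour is cheaper than the closed edges on large scales. -/
theorem detour_lt {d K₁ K₂ H₂ D : ℕ} (hd : 2 ≤ d) (hD : 0 < D) (hK₁ : 0 < K₁) (hK₂ : 0 < K₂)
    (hH₂ : 1792 * d ^ 2 * D ^ 2 * K₁ ≤ H₂) (B : ℝ) (hB : 0 ≤ B) :
    ∃ N₀ : ℕ, ∃ L₀ : ℝ, 1 ≤ L₀ ∧ 0 < N₀ ∧ ∀ N : ℕ, N₀ ≤ N → ∀ L : ℝ, L₀ ≤ L →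
      (2 * d * (N / K₂ + 1 : ℕ) + 1) * B + (2 * ((2 * d * (N / K₂ + 1) / H₂ + 1 : ℕ) * D) + 2) *
        (L * (6 * d * K₂ + 1)) < L * (N / (4 * K₁ * (2 * D)) : ℕ) := by
  have hd' : (2 : ℝ) ≤ d := by exact_mod_cast hd
  have hD' : (1 : ℝ) ≤ D := by exact_mod_cast hD
  have hK₁' : (1 : ℝ) ≤ K₁ := by exact_mod_cast hK₁
  have hK₂' : (1 : ℝ) ≤ K₂ := by exact_mod_cast hK₂
  have hH₂0 : 0 < H₂ := lt_of_lt_of_le (by positivity) hH₂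
  have hH₂' : (1792 : ℝ) * d ^ 2 * D ^ 2 * K₁ ≤ H₂ := by exact_mod_cast hH₂
  have hH₂1 : (1 : ℝ) ≤ H₂ := by exact_mod_cast hH₂0
  set a : ℝ := 1 / (8 * K₁ * D) with ha
  have ha0 : 0 < a := by positivity
  set E : ℝ := 14 * d * D * (2 * d * K₂ + K₂) + 14 * d * K₂ with hE
  have hE0 : 0 ≤ E := by positivity
  obtain ⟨N₀, hN₀⟩ := exists_nat_gt ((2 + 2 * E) / a)
  refine ⟨N₀ + 1, 1 + 40 * d * B / a, le_add_of_nonneg_right (by positivity), by omega,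
    fun N hN L hL => ?_⟩
  have hL0 : 0 < L := lt_of_lt_of_le (by positivity) hL
  have hN1 : (N₀ : ℝ) + 1 ≤ N := by exact_mod_cast hN
  have hN' : (1 : ℝ) ≤ N := by
    have : (0 : ℝ) ≤ N₀ := by positivity
    linarith
  have f1 : 2 + 2 * E < a * N := by
    rw [div_lt_iff₀ ha0] at hN₀
    nlinarith
  have f2 : ((N / K₂ : ℕ) : ℝ) ≤ N / K₂ := Nat.cast_div_le
  have f2' : (N : ℝ) / K₂ ≤ N := div_le_self (by linarith) hK₂'
  have f3 : (2 * d * (N / K₂ + 1 : ℕ) + 1) * B ≤ L * (a * N / 8) := by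
    have g1 : 40 * d * B ≤ L * a := by
      have : 40 * d * B / a ≤ L := by linarith
      rwa [div_le_iff₀ ha0] at this
    have g2 : (2 * (d : ℝ) * (N / K₂ + 1 : ℕ) + 1) ≤ 5 * d * N := by
      push_cast
      nlinarith
    calc _ ≤ 5 * d * N * B := mul_le_mul_of_nonneg_right g2 hB
      _ = 40 * d * B * (N / 8) := by ring
      _ ≤ L * a * (N / 8) := by gcongr
      _ = _ := by ring
  have f4 : (((2 * d * (N / K₂ + 1) / H₂ + 1 : ℕ) : ℝ) * D) * K₂ ≤
      D * (2 * d * N / H₂) + D * (2 * d * K₂ + K₂) := by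
    have g1 : ((2 * d * (N / K₂ + 1) / H₂ : ℕ) : ℝ) ≤ (2 * d * (N / K₂ + 1)) / H₂ := by
      refine Nat.cast_div_le.trans ?_
      push_cast
      gcongr
    have g2 : (2 * (d : ℝ) * (N / K₂ + 1)) / H₂ * K₂ ≤ 2 * d * N / H₂ + 2 * d * K₂ := by
      have e : (2 * (d : ℝ) * (N / K₂ + 1)) / H₂ * K₂ = 2 * d * N / H₂ + 2 * d * K₂ / H₂ := by
        field_simp
      rw [e]
      have : 2 * d * K₂ / H₂ ≤ 2 * d * (K₂ : ℝ) := div_le_self (by positivity) hH₂1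
      linarith
    push_cast
    have g3 := mul_le_mul_of_nonneg_right g1 (show (0 : ℝ) ≤ K₂ by positivity)
    have g4 := mul_le_mul_of_nonneg_left (g3.trans g2) (show (0 : ℝ) ≤ D by positivity)
    linarith
  have f5 : (28 : ℝ) * d ^ 2 * D / H₂ ≤ a / 8 := by
    rw [ha, div_le_div_iff₀ (by positivity) (by positivity), div_mul_eq_mul_div,
      le_div_iff₀ (by positivity)]
    nlinarith
  have f6 : (2 * (((2 * d * (N / K₂ + 1) / H₂ + 1 : ℕ) : ℝ) * D) + 2) * (6 * d * K₂ + 1) ≤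
      a * N / 8 + E := by
    have g1 : (6 * (d : ℝ) * K₂ + 1) ≤ 7 * d * K₂ := by nlinarith
    calc _ ≤ (2 * (((2 * d * (N / K₂ + 1) / H₂ + 1 : ℕ) : ℝ) * D) + 2) * (7 * d * K₂) := by gcongr
      _ = 14 * d * ((((2 * d * (N / K₂ + 1) / H₂ + 1 : ℕ) : ℝ) * D) * K₂) + 14 * d * K₂ := by ring
      _ ≤ 14 * d * (D * (2 * d * N / H₂) + D * (2 * d * K₂ + K₂)) + 14 * d * K₂ := by gcongr
      _ = 28 * d ^ 2 * D / H₂ * N + E := by rw [hE]; ring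
      _ ≤ a / 8 * N + E := by gcongr
      _ = _ := by ring
  have f7 : a * N - 1 < (N / (4 * K₁ * (2 * D)) : ℕ) := by
    have g1 := Nat.lt_mul_div_succ N (show 0 < 4 * K₁ * (2 * D) by positivity)
    have g2 : (N : ℝ) < (4 * K₁ * (2 * D)) * ((N / (4 * K₁ * (2 * D)) : ℕ) + 1) := by
      exact_mod_cast g1
    rw [sub_lt_iff_lt_add, ha, one_div_mul_eq_div, div_lt_iff₀ (by positivity)]
    linarith
  have f8 := mul_le_mul_of_nonneg_left f6 hL0.le
  have f9 := mul_lt_mul_of_pos_left (show a * N / 8 + (a * N / 8 + E) <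
    ((N / (4 * K₁ * (2 * D)) : ℕ) : ℝ) by linarith) hL0
  linarith

theorem prob_ENevent_le {p : unitInterval} (hd : 2 ≤ d) (hp : pc d < p) (hp1 : (p : ℝ) < 1)
    {μ : Measure (Config d)} (hμ : IsBernoulli d p μ) :
    ∃ N₀ : ℕ, ∃ L₀ : ℝ, 1 ≤ L₀ ∧ ∃ C ≥ (0 : ℝ), ∃ c > (0 : ℝ), ∀ n N : ℕ, ∀ t : ℝ, 2 ≤ t → N₀ ≤ N →
      L₀ ≤ (Real.log n) ^ 2 → μ (ENevent d n t N) ≤ ENNReal.ofReal (C * Real.exp (-(c * N))) := by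
  set D : ℕ := 101 ^ d with hD
  have hD0 : 0 < D := by positivity
  obtain ⟨K₁, hK₁, hA₁⟩ := exists_FewBad hd hp hp1 (2 * D)
  set H₂ : ℕ := 1792 * d ^ 2 * D ^ 2 * K₁ with hH₂
  have hH₂0 : 0 < H₂ := by positivity
  obtain ⟨K₂, hK₂, hA₂⟩ := exists_FewBad hd hp hp1 H₂
  obtain ⟨N₀, L₀, hL₀, hN₀, hlt⟩ := detour_lt hd hD0 hK₁ hK₂ hH₂.ge
    ((100 * K₂ + 1) ^ d) (by positivity)
  obtain ⟨C₁, hC₁, c₁, hc₁, hb₁⟩ := poly_mul_exp_le (2 * 2 * 5 ^ d * Real.exp 1) (by positivity)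
    (d + 1) (show (0 : ℝ) < 1 / (8 * K₁ * D) by positivity)
  obtain ⟨C₂, hC₂, c₂, hc₂, hb₂⟩ := poly_mul_exp_le (2 * (5 * d) * 5 ^ d) (by positivity)
    (d + 1) (show (0 : ℝ) < 1 / (H₂ * K₂) by positivity)
  refine ⟨N₀ + 20 * K₁ + 51 * K₂ + 4 * K₁ * (2 * D), L₀, hL₀, C₁ + C₂, by positivity, min c₁ c₂,
    lt_min hc₁ hc₂, fun n N t ht hN hL => ?_⟩
  have hN1 : 1 ≤ N := by omega
  set s₁ := N / (4 * K₁ * (2 * D)) with hs₁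
  set s₂ := 2 * d * (N / K₂ + 1) / H₂ + 1 with hs₂
  have hs₁N : 4 * K₁ * (2 * D * s₁) ≤ N := by
    rw [← mul_assoc]
    exact Nat.mul_div_le _ _
  have hs₁0 : 0 < s₁ := Nat.div_pos (by omega) (by positivity)
  obtain ⟨A₁, m₁, g₁, i₁, p₁⟩ := hA₁ (2 * N) (2 * D * s₁) s₁ le_rfl
  obtain ⟨A₂, m₂, g₂, i₂, p₂⟩ := hA₂ N (2 * d * (N / K₂ + 1)) s₂
    (Nat.lt_mul_div_succ _ hH₂0).le
  have hNr : (1 : ℝ) ≤ N := by exact_mod_cast hN1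
  have hdr : (2 : ℝ) ≤ d := by exact_mod_cast hd
  have q₁ : (bern fun _ : Sym2 (ZVec d) => p).real A₁ ≤ C₁ * Real.exp (-(c₁ * N)) := by
    refine p₁.trans (le_trans ?_ (hb₁ N))
    have e1 : ((2 * D * s₁ : ℕ) : ℝ) + 1 ≤ 2 * N := by
      have : 2 * D * s₁ ≤ N := le_trans (Nat.le_mul_of_pos_left _ (by positivity)) hs₁N
      have : ((2 * D * s₁ : ℕ) : ℝ) ≤ N := by exact_mod_cast this
      linarith
    have e2 : (2 * ((2 * N : ℕ) : ℝ) + 1) ≤ 5 * N := by push_cast; linarith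
    have e3 : -(s₁ : ℝ) ≤ 1 + -(1 / (8 * K₁ * D) * N) := by
      have g1 := Nat.lt_mul_div_succ N (show 0 < 4 * K₁ * (2 * D) by positivity)
      have g2 : (N : ℝ) ≤ (4 * K₁ * (2 * D)) * (s₁ + 1) := by exact_mod_cast g1.le
      have g3 : 1 / (8 * K₁ * D) * (N : ℝ) ≤ s₁ + 1 := by
        rw [one_div_mul_eq_div, div_le_iff₀ (by positivity)]
        linarith
      linarith
    calc _ ≤ 2 * (2 * N) * (5 * N) ^ d * Real.exp (1 + -(1 / (8 * K₁ * D) * N)) := by gcongr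
      _ = _ := by
        rw [Real.exp_add, mul_pow]
        ring
  have q₂ : (bern fun _ : Sym2 (ZVec d) => p).real A₂ ≤ C₂ * Real.exp (-(c₂ * N)) := by
    refine p₂.trans (le_trans ?_ (hb₂ N))
    have e1 : ((2 * d * (N / K₂ + 1) : ℕ) : ℝ) + 1 ≤ 5 * d * N := by
      have : ((N / K₂ : ℕ) : ℝ) ≤ N := by exact_mod_cast Nat.div_le_self _ _
      push_cast
      nlinarith
    have e2 : (2 * (N : ℝ) + 1) ≤ 5 * N := by linarith
    have e3 : -(s₂ : ℝ) ≤ -(1 / (H₂ * K₂) * N) := by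
      have g1 := Nat.lt_mul_div_succ (2 * d * (N / K₂ + 1)) hH₂0
      have g2 := Nat.lt_mul_div_succ N hK₂
      have g3 : N ≤ H₂ * s₂ * K₂ := by
        calc N ≤ K₂ * (N / K₂ + 1) := g2.le
          _ ≤ K₂ * (2 * d * (N / K₂ + 1)) := by
            gcongr
            exact Nat.le_mul_of_pos_left _ (by omega)
          _ ≤ K₂ * (H₂ * s₂) := by gcongr
          _ = _ := by ring
      have g4 : (N : ℝ) ≤ H₂ * s₂ * K₂ := by exact_mod_cast g3
      rw [neg_le_neg_iff, one_div_mul_eq_div, div_le_iff₀ (by positivity)]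
      linarith
    calc _ ≤ 2 * (5 * d * N) * (5 * N) ^ d * Real.exp (-(1 / (H₂ * K₂) * N)) := by gcongr
      _ = _ := by
        rw [mul_pow]
        ring
  have hle : μ (ENevent d n t N) ≤ (bern fun _ : Sym2 (ZVec d) => p) (A₁ ∪ A₂) := by
    refine hμ.le_of (m₁.union m₂) (fun ω ω' h => Or.imp (i₁ ω ω' h) (i₂ ω ω' h)) fun ω hω => ?_
    by_contra hc
    rw [Set.mem_union, not_or] at hc
    refine absurd (hlt N (by omega) _ hL) (not_lt.2 ?_)
    have := cost_of_ENevent (hL₀.trans hL) ht hK₁ hK₂ (by omega) hs₁N hs₁0 (by omega) (g₁ ω hc.1)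
      (g₂ ω hc.2) hω
    rw [← hs₁, ← hs₂]
    refine this.trans (le_of_eq ?_)
    rw [hD]
    push_cast
    rfl
  refine hle.trans ?_
  rw [← ofReal_measureReal]
  refine ENNReal.ofReal_le_ofReal ((measureReal_union_le _ _).trans ?_)
  have r₁ : Real.exp (-(c₁ * N)) ≤ Real.exp (-(min c₁ c₂ * N)) := by
    gcongr
    exact min_le_left _ _
  have r₂ : Real.exp (-(c₂ * N)) ≤ Real.exp (-(min c₁ c₂ * N)) := by
    gcongr
    exact min_le_right _ _
  have := mul_le_mul_of_nonneg_left r₁ hC₁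
  have := mul_le_mul_of_nonneg_left r₂ hC₂
  linarith

end

end Perco
namespace Perco

/-- Lemma 2.12: crossing-cluster avoidance lemma.  For `p > p_c(d)`
there is `c_* ∈ (0,1)` such that for all `t ≥ 1/c_*` and all `1 ≤ N ≤ exp(c_* log² n)`,
`P(𝓔_N) ≤ c_*⁻¹ exp(−c_* N)`, where `𝓔_N` is the event that some crossing open cluster
of `Λ_{2N}` is disjoint from some path `π ⊆ Λ_N` in `𝔾_*(Λ_{tN})` with `diam(π) ≥ N/2`. -/
theorem crossing_cluster_avoidance
    (d : ℕ) (hd : 2 ≤ d) (p : ℝ) (hp : pc d < p) (hp1 : p < 1)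
    (μ : Measure (Config d)) (hμ : IsBernoulli d p μ) :
    ∃ cs : ℝ, 0 < cs ∧ cs < 1 ∧ ∀ n : ℕ, 2 ≤ n → ∀ t : ℝ, 1 / cs ≤ t →
      ∀ N : ℕ, 1 ≤ N → (N : ℝ) ≤ Real.exp (cs * (Real.log n) ^ 2) →
      μ (ENevent d n t N) ≤ ENNReal.ofReal (cs⁻¹ * Real.exp (-cs * N)) := by
  have hpc : 0 ≤ pc d := Real.sSup_nonneg fun x hx => hx.1
  obtain ⟨N₀, L₀, hL₀, C, hC, c, hc, h⟩ :=
    prob_ENevent_le (p := ⟨p, hpc.trans hp.le, hp1.le⟩) hd hp hp1 hμ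
  have := hμ.1
  set S : ℝ := 3 + N₀ + L₀ + C + c⁻¹ with hS
  have hc' : 0 < c⁻¹ := by positivity
  have hN₀ : (0 : ℝ) ≤ N₀ := by positivity
  have hS3 : 3 ≤ S := by linarith
  have hS0 : 0 < S := by linarith
  refine ⟨S⁻¹, by positivity, inv_lt_one_of_one_lt₀ (by linarith), fun n _ t ht N hN hNn => ?_⟩
  rw [one_div, inv_inv] at ht
  rw [inv_inv]
  by_cases hlarge : N₀ ≤ N ∧ L₀ ≤ (Real.log n) ^ 2
  · refine (h n N t (by linarith) hlarge.1 hlarge.2).trans (ENNReal.ofReal_le_ofReal ?_)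
    have h1 : S⁻¹ ≤ c := inv_le_of_inv_le₀ hc (by linarith)
    have h2 : C ≤ S := by linarith
    have h3 : -(c * N) ≤ -S⁻¹ * N := by
      rw [neg_mul, neg_le_neg_iff]
      gcongr
    gcongr
  · have h3 : (N : ℝ) ≤ S := by
      by_cases h1 : N₀ ≤ N
      · have h2 : (Real.log n) ^ 2 < L₀ := not_le.1 fun h2 => hlarge ⟨h1, h2⟩
        have h4 : S⁻¹ * (Real.log n) ^ 2 ≤ 1 := by
          rw [inv_mul_le_iff₀ hS0]
          linarith
        have h5 := Real.exp_le_exp.2 h4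
        have := Real.exp_one_lt_d9
        linarith
      · have : (N : ℝ) ≤ N₀ := by exact_mod_cast (not_le.1 h1).le
        linarith
    refine prob_le_one.trans ?_
    rw [ENNReal.one_le_ofReal]
    have h4 : -1 ≤ -S⁻¹ * N := by
      have : S⁻¹ * N ≤ 1 := by
        rw [inv_mul_le_iff₀ hS0]
        linarith
      linarith
    have h5 : Real.exp (-1) ≤ Real.exp (-S⁻¹ * N) := Real.exp_le_exp.2 h4
    have h6 : 1 ≤ 3 * Real.exp (-1) := by
      rw [Real.exp_neg, ← div_eq_mul_inv, one_le_div (Real.exp_pos 1)]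
      have := Real.exp_one_lt_d9
      linarith
    calc (1 : ℝ) ≤ 3 * Real.exp (-1) := h6
      _ ≤ S * Real.exp (-S⁻¹ * N) := by gcongr

end Perco
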